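/- arXiv:1504.04278 — 5 statements merged into one kernel-verified Lean document; each statement's English description precedes it below -/
import Mathlib

section
/- Every complete block in a uniquely C_t-saturated graph with at least t vertices (t ≥ 4) has at most three vertices. -/
open SimpleGraph

/-- `G` has a cycle on `t` vertices (a cycle of length `t`). -/
def HasCycleOn {V : Type*} (G : SimpleGraph V) (t : ℕ) : Prop :=
  ∃ (v : V) (w : G.Walk v v), w.IsCycle ∧ w.length = t

/-- `c` is the edge set of some cycle on `t` vertices in `G`. -/
def IsCtEdgeSet {V : Type*} (G : SimpleGraph V) (t : ℕ) (c : Set (Sym2 V)) : Prop :=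
  ∃ (v : V) (w : G.Walk v v), w.IsCycle ∧ w.length = t ∧ {e | e ∈ w.edges} = c

/-- `G` is uniquely `C_t`-saturated: it has no cycle on `t` vertices, and adding any
edge of the complement creates exactly one cycle on `t` vertices. -/
def UniquelyCSat {V : Type*} (G : SimpleGraph V) (t : ℕ) : Prop :=
  ¬ HasCycleOn G t ∧
    ∀ x y : V, x ≠ y → ¬ G.Adj x y →
      ∃! c : Set (Sym2 V), IsCtEdgeSet (G ⊔ fromEdgeSet {s(x, y)}) t c
/-- The set `s` induces a block of `G`: a maximal set of vertices inducing a
connected subgraph with no cut-vertex. -/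
def IsBlock {V : Type*} (G : SimpleGraph V) (s : Set V) : Prop :=
  s.Nonempty ∧ (G.induce s).Connected ∧
    (∀ v ∈ s, (G.induce (s \ {v})).Preconnected) ∧
    ∀ u : Set V, s ⊆ u →
      ((G.induce u).Connected ∧ ∀ v ∈ u, (G.induce (u \ {v})).Preconnected) → u = s

section

variable {V : Type*} {G : SimpleGraph V}

theorem preconnected_induce_of_reach {s T : Set V}
    (hs : ∀ a ∈ s, ∀ b ∈ s, a ≠ b → G.Adj a b)
    (h : ∀ c ∈ T, ∃ d ∈ s, ∃ p : G.Walk c d, ∀ x ∈ p.support, x ∈ T) :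
    (G.induce T).Preconnected := by
  rintro ⟨a, ha⟩ ⟨b, hb⟩
  obtain ⟨c, hc, p, hp⟩ := h a ha
  obtain ⟨d, hd, q, hq⟩ := h b hb
  have h1 := (p.induce T hp).reachable
  have h2 := (q.induce T hq).reachable.symm
  refine h1.trans (SimpleGraph.Reachable.trans ?_ h2)
  by_cases hcd : c = d
  · subst hcd; rfl
  · exact Adj.reachable (hs c hc d hd hcd)

/-- A path between two vertices of a complete block stays in the block. -/
theorem IsBlock.support_subset {s : Set V} (hs : IsBlock G s)
    (hc : ∀ a ∈ s, ∀ b ∈ s, a ≠ b → G.Adj a b) {a b : V} (ha : a ∈ s) (hb : b ∈ s)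
    (p : G.Walk a b) (hp : p.IsPath) : ∀ x ∈ p.support, x ∈ s := by
  classical
  have key := hs.2.2.2 (s ∪ {x | x ∈ p.support}) Set.subset_union_left ?_
  · intro x hx
    rw [← key]
    exact Or.inr hx
  refine ⟨(connected_iff _).2 ⟨preconnected_induce_of_reach hc ?_, ⟨a, Or.inl ha⟩⟩, fun z _ => ?_⟩
  · rintro c (h | h)
    · exact ⟨c, h, .nil, by simp [h]⟩
    · refine ⟨b, hb, p.dropUntil c h, fun x hx => Or.inr (p.support_dropUntil_subset_support h hx)⟩
  · refine preconnected_induce_of_reach hc ?_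
    rintro c ⟨h | h, hz : c ≠ z⟩
    · exact ⟨c, h, .nil, by simp [h, hz]⟩
    · by_cases hzt : z ∈ (p.takeUntil c h).support
      · refine ⟨b, hb, p.dropUntil c h, fun x hx =>
          ⟨Or.inr (p.support_dropUntil_subset_support h hx), ?_⟩⟩
        rintro rfl
        have hp' : ((p.takeUntil c h).append (p.dropUntil c h)).IsPath := by rwa [p.take_spec h]
        exact hp'.ne_of_mem_support_of_append hz.symm hzt hx rfl
      · refine ⟨a, ha, (p.takeUntil c h).reverse, fun x hx => ?_⟩
        rw [Walk.support_reverse, List.mem_reverse] at hx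
        refine ⟨Or.inr (p.support_takeUntil_subset_support h hx), ?_⟩
        rintro rfl
        exact hzt hx

theorem hasCycleOn_of_le_ncard [Finite V] {s : Set V} {t : ℕ} (ht : 3 ≤ t) (hts : t ≤ s.ncard)
    (hc : ∀ a ∈ s, ∀ b ∈ s, a ≠ b → G.Adj a b) : HasCycleOn G t := by
  have : Nonempty (Fin t ↪ s) := by
    have := Fintype.ofFinite s
    rw [Function.Embedding.nonempty_iff_card_le, Fintype.card_fin, ← Nat.card_eq_fintype_card]
    exact hts
  obtain ⟨f⟩ := this
  refine (cycleGraph_isContained_iff ht).1 ⟨⟨⟨fun i => (f i : V), ?_⟩, ?_⟩⟩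
  · intro a b hab
    exact hc _ (f a).2 _ (f b).2 fun h => hab.ne (f.injective (Subtype.ext h))
  · intro a b hab
    exact f.injective (Subtype.ext hab)

theorem exists_isPath_of_isCycle_of_mem_edges {v a b : V} {w : G.Walk v v} (hw : w.IsCycle)
    (he : s(a, b) ∈ w.edges) :
    ∃ p : G.Walk a b, p.IsPath ∧ p.length + 1 = w.length ∧ s(a, b) ∉ p.edges := by
  classical
  have ha := w.fst_mem_support_of_mem_edges he
  have hc := hw.rotate ha
  have he' : s(a, b) ∈ (w.rotate a ha).edges := (w.rotate_edges a ha).mem_iff.2 he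
  have hl : (w.rotate a ha).length = w.length := by simp
  rw [← hl]
  generalize w.rotate a ha = c at *
  cases c with
  | nil => simp at he'
  | @cons _ x _ h p =>
    obtain ⟨hp, hn⟩ := (Walk.cons_isCycle_iff p h).1 hc
    by_cases hxb : x = b
    · subst hxb
      refine ⟨p.reverse, hp.reverse, by simp, by simpa using hn⟩
    · have hbp : s(a, b) ∈ p.edges := by
        simp only [Walk.edges_cons, List.mem_cons] at he'
        rcases he' with h | h
        · simp at h; grind
        · exact h
      have hr := hp.reverse
      have hbr : s(a, b) ∈ p.reverse.edges := by simpa using hbp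
      have hlen : p.reverse.length = p.length := by simp
      generalize p.reverse = r at hr hbr hlen
      cases r with
      | nil => simp at hbr
      | @cons _ y _ h2 q =>
        have hy : b = y := by simpa using hr.eq_snd_of_mem_edges hbr
        subst hy
        rw [Walk.cons_isPath_iff] at hr
        refine ⟨.cons h q.reverse, ?_, ?_, ?_⟩
        · rw [Walk.cons_isPath_iff]
          exact ⟨hr.1.reverse, by simpa using hr.2⟩
        · simpa using hlen
        · simp only [Walk.edges_cons, Walk.edges_reverse, List.mem_cons, List.mem_reverse, not_or]
          refine ⟨by simp; grind, fun hq => hr.2 (q.fst_mem_support_of_mem_edges hq)⟩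

theorem UniquelyCSat.exists_isPath {t : ℕ} (hG : UniquelyCSat G t) {a b : V} (hab : a ≠ b)
    (hadj : ¬ G.Adj a b) : ∃ p : G.Walk a b, p.IsPath ∧ p.length + 1 = t := by
  classical
  obtain ⟨c, ⟨v, w, hw, hl, -⟩, -⟩ := hG.2 a b hab hadj
  have hmem : ∀ e ∈ w.edges, e ≠ s(a, b) → e ∈ G.edgeSet := by
    intro e he hne
    have := w.edges_subset_edgeSet he
    rw [edgeSet_sup, edgeSet_fromEdgeSet] at this
    rcases this with h | h
    · exact h
    · exact (hne h.1).elim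
  by_cases he : s(a, b) ∈ w.edges
  · obtain ⟨p, hp, hpl, hpn⟩ := exists_isPath_of_isCycle_of_mem_edges hw he
    have hpG : ∀ e ∈ p.edges, e ∈ G.edgeSet := by
      intro e he
      have := p.edges_subset_edgeSet he
      rw [edgeSet_sup, edgeSet_fromEdgeSet] at this
      rcases this with h | h
      · exact h
      · exact (hpn (h.1 ▸ he)).elim
    exact ⟨p.transfer G hpG, hp.transfer hpG, by simp [hpl, hl]⟩
  · have hwG := fun e h => hmem e h (fun h' => he (h' ▸ h))
    exact (hG.1 ⟨v, w.transfer G hwG, hw.transfer hwG, by simp [hl]⟩).elim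

theorem isCtEdgeSet_of_isPath {t : ℕ} {a b : V} (hab : a ≠ b) (hadj : ¬ G.Adj a b)
    {p : G.Walk a b} (hp : p.IsPath) (hl : p.length + 1 = t) :
    IsCtEdgeSet (G ⊔ fromEdgeSet {s(a, b)}) t (insert s(a, b) {e | e ∈ p.edges}) := by
  have h : (G ⊔ fromEdgeSet {s(a, b)}).Adj b a := by simp [hab.symm, Sym2.eq_swap]
  have hle : G ≤ G ⊔ fromEdgeSet {s(a, b)} := le_sup_left
  have hn : s(a, b) ∉ p.edges := fun h => hadj (p.edges_subset_edgeSet h)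
  refine ⟨b, .cons h (p.mapLe hle), ?_, by simp [hl], ?_⟩
  · rw [Walk.cons_isCycle_iff]
    refine ⟨hp.mapLe hle, ?_⟩
    simpa [Sym2.eq_swap] using hn
  · ext e
    simp [Sym2.eq_swap]

theorem UniquelyCSat.mem_edges_of_mem_edges {t : ℕ} (hG : UniquelyCSat G t) {a b : V}
    {p q : G.Walk a b} (hab : a ≠ b) (hadj : ¬ G.Adj a b)
    (hp : p.IsPath) (hpl : p.length + 1 = t) (hq : q.IsPath) (hql : q.length + 1 = t)
    {e : Sym2 V} (he : e ∈ p.edges) : e ∈ q.edges := by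
  have h := (hG.2 a b hab hadj).unique (isCtEdgeSet_of_isPath hab hadj hp hpl)
    (isCtEdgeSet_of_isPath hab hadj hq hql)
  have : e ∈ insert s(a, b) {e | e ∈ q.edges} := h ▸ Or.inr he
  rcases this with rfl | h
  · exact (hadj (p.edges_subset_edgeSet he)).elim
  · exact h

theorem exists_walk_map_perm {s : Set V} (hc : ∀ a ∈ s, ∀ b ∈ s, a ≠ b → G.Adj a b)
    (σ : Equiv.Perm V) (hσ : ∀ x ∈ s, σ x ∈ s) {a b : V} (p : G.Walk a b)
    (hp : ∀ x ∈ p.support, x ∈ s) :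
    ∃ q : G.Walk (σ a) (σ b), q.support = p.support.map σ ∧ q.edges = p.edges.map (Sym2.map σ) := by
  induction p with
  | nil => exact ⟨.nil, by simp⟩
  | @cons a c b h p ih =>
    obtain ⟨q, h1, h2⟩ := ih fun x hx => hp x (by simp [hx])
    have hadj : G.Adj (σ a) (σ c) :=
      hc _ (hσ _ (hp _ (by simp))) _ (hσ _ (hp _ (by simp))) (σ.injective.ne h.ne)
    exact ⟨.cons hadj q, by simp [h1], by simp [h2]⟩

theorem isPath_append {a b c : V} {p : G.Walk a b} {q : G.Walk b c} (hp : p.IsPath)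
    (hq : q.IsPath) (h : ∀ x ∈ p.support, x ∈ q.support → x = b) : (p.append q).IsPath := by
  induction p with
  | nil => simpa
  | @cons a d b hadj p ih =>
    rw [Walk.cons_isPath_iff] at hp
    rw [Walk.cons_append, Walk.cons_isPath_iff]
    refine ⟨ih hp.1 hq fun x hx => h x (by simp [hx]), fun hm => ?_⟩
    rw [Walk.mem_support_append_iff] at hm
    rcases hm with hm | hm
    · exact hp.2 hm
    · exact hp.2 (h a (by simp) hm ▸ p.end_mem_support)

/-- A path from outside a complete block into it meets the block first at the vertex through which
its start is attached. -/
theorem IsBlock.exists_isPath_append {s : Set V} (hs : IsBlock G s)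
    (hc : ∀ a ∈ s, ∀ b ∈ s, a ≠ b → G.Adj a b) {x v u : V} (hx : x ∉ s) (hv : v ∈ s)
    (hvx : G.Adj v x) (hu : u ∈ s) (huv : u ≠ v) {p : G.Walk x u} (hp : p.IsPath) :
    ∃ (q : G.Walk x v) (r : G.Walk v u), p = q.append r ∧ q.IsPath ∧ r.IsPath ∧
      (∀ y ∈ q.support, y ∈ s → y = v) ∧ ∀ y ∈ r.support, y ∈ s := by
  classical
  have hcut : ∀ y ∈ s, y ≠ v → ∀ p : G.Walk x y, p.IsPath → v ∈ p.support := by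
    intro y hy hyv p hp
    by_contra hvp
    exact hx (hs.support_subset hc hv hy (.cons hvx p)
      ((Walk.cons_isPath_iff _ _).2 ⟨hp, hvp⟩) x (by simp))
  have hvp := hcut u hu huv p hp
  have hq := hp.takeUntil hvp
  have hr := hp.dropUntil hvp
  refine ⟨p.takeUntil v hvp, p.dropUntil v hvp, (p.take_spec hvp).symm, hq, hr, ?_,
    hs.support_subset hc hv hu _ hr⟩
  generalize p.takeUntil v hvp = q at hq
  intro y hy hys
  by_contra hyv
  have hq' : ((q.takeUntil y hy).append (q.dropUntil y hy)).IsPath := by rwa [q.take_spec hy]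
  exact hq'.ne_of_mem_support_of_append (Ne.symm hyv) (hcut y hys hyv _ (hq.takeUntil hy))
    (Walk.end_mem_support _) rfl

theorem exists_mem_ne_ne_ne {s : Set V} (h : 3 < s.ncard) (a b c : V) :
    ∃ d ∈ s, d ≠ a ∧ d ≠ b ∧ d ≠ c := by
  classical
  obtain ⟨d, hd, hn⟩ := Set.exists_mem_notMem_of_ncard_lt_ncard
    (s := (({a, b, c} : Finset V) : Set V)) (t := s)
    (by rw [Set.ncard_coe_finset]; exact Finset.card_le_three.trans_lt h)
    (Finset.finite_toSet _)
  exact ⟨d, hd, by simpa using hn⟩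

/-- In a uniquely `C_t`-saturated graph, a path on `t` vertices from outside a complete block with
at least four vertices to a vertex of that block uses just one edge of the block. -/
theorem UniquelyCSat.exists_isPath_to_attachment {t : ℕ} (hG : UniquelyCSat G t) {s : Set V}
    (hs : IsBlock G s) (hc : ∀ a ∈ s, ∀ b ∈ s, a ≠ b → G.Adj a b) (h4 : 3 < s.ncard) {x v : V}
    (hx : x ∉ s) (hv : v ∈ s) (hvx : G.Adj v x) :
    ∃ q : G.Walk x v, q.IsPath ∧ q.length + 2 = t ∧ ∀ y ∈ q.support, y ∈ s → y = v := by
  classical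
  obtain ⟨u, hu, huv, -⟩ := exists_mem_ne_ne_ne h4 v v v
  have hxu : x ≠ u := fun h => hx (h ▸ hu)
  have hadj : ¬ G.Adj x u := by
    intro h
    refine hx (hs.support_subset hc hv hu (.cons hvx (.cons h .nil)) ?_ x (by simp))
    simp [Walk.cons_isPath_iff, huv.symm, hvx.ne, hxu]
  obtain ⟨p, hp, hpl⟩ := hG.exists_isPath hxu hadj
  obtain ⟨q, r, rfl, hq, hr, hqs, hrs⟩ := hs.exists_isPath_append hc hx hv hvx hu huv hp
  refine ⟨q, hq, ?_, hqs⟩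
  have hrn : ¬ r.Nil := Walk.not_nil_of_ne huv.symm
  have hpen : s(u, r.penultimate) ∈ r.edges := by
    rw [Sym2.eq_swap]
    exact Walk.mk_penultimate_end_mem_edges hrn
  by_cases hav : r.penultimate = v
  · rw [hav, Sym2.eq_swap] at hpen
    have := hr.length_eq_one_of_mem_edges hpen
    rw [Walk.length_append] at hpl
    omega
  exfalso
  set a := r.penultimate
  have ha : a ∈ s := hrs _ (r.snd_mem_support_of_mem_edges hpen)
  have hau : a ≠ u := (r.adj_of_mem_edges hpen).ne'
  obtain ⟨a', ha', h1, h2, h3⟩ := exists_mem_ne_ne_ne h4 a v u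
  have hσ : ∀ y ∈ s, Equiv.swap a a' y ∈ s := by
    intro y hy
    rw [Equiv.swap_apply_def]
    split_ifs <;> assumption
  have hmap := exists_walk_map_perm hc (Equiv.swap a a') hσ r hrs
  rw [Equiv.swap_apply_of_ne_of_ne (Ne.symm hav) h2.symm,
    Equiv.swap_apply_of_ne_of_ne hau.symm h3.symm] at hmap
  obtain ⟨r', hsupp, hedges⟩ := hmap
  have hr' : r'.IsPath := by
    rw [Walk.isPath_def, hsupp]
    exact hr.support_nodup.map (Equiv.injective _)
  have hlen : r'.length = r.length := by
    rw [← Walk.length_edges, hedges, List.length_map, Walk.length_edges]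
  have hr's : ∀ y ∈ r'.support, y ∈ s := by
    intro y hy
    rw [hsupp, List.mem_map] at hy
    obtain ⟨z, hz, rfl⟩ := hy
    exact hσ z (hrs z hz)
  have he : s(u, a') ∈ r'.edges := by
    rw [hedges, List.mem_map]
    refine ⟨_, hpen, ?_⟩
    rw [Sym2.map_mk, Equiv.swap_apply_left, Equiv.swap_apply_of_ne_of_ne hau.symm h3.symm]
  have hmem : s(u, a') ∈ (q.append r).edges :=
    hG.mem_edges_of_mem_edges hxu hadj (p := q.append r')
      (isPath_append hq hr' fun y hy hy' => hqs y hy (hr's y hy'))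
      (by rw [Walk.length_append] at hpl ⊢; omega) hp hpl (by simp [he])
  have hmem' : s(u, a) ∈ (q.append r).edges := by simp [hpen]
  exact h1 ((hp.eq_penultimate_of_mem_edges hmem).trans
    (hp.eq_penultimate_of_mem_edges hmem').symm)

theorem UniquelyCSat.exists_adj_of_notMem {t : ℕ} (hG : UniquelyCSat G t) {s : Set V} {y z : V}
    (hy : y ∈ s) (hz : z ∉ s) : ∃ v ∈ s, ∃ x ∉ s, G.Adj v x := by
  by_cases h : G.Adj y z
  · exact ⟨y, hy, z, hz, h⟩
  · obtain ⟨p, -, -⟩ := hG.exists_isPath (by rintro rfl; exact hz hy) h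
    obtain ⟨d, -, h1, h2⟩ := p.exists_boundary_dart s hy hz
    exact ⟨_, h1, _, h2, d.adj⟩

end

/-- For `t ≥ 4`, every complete block in a uniquely `C_t`-saturated graph with at least
`t` vertices has at most three vertices. -/
theorem stmt_2 {V : Type*} [Fintype V] (G : SimpleGraph V) (t : ℕ) (ht : 4 ≤ t)
    (hn : t ≤ Fintype.card V) (hG : UniquelyCSat G t) (s : Set V) (hs : IsBlock G s)
    (hcomplete : ∀ a ∈ s, ∀ b ∈ s, a ≠ b → G.Adj a b) :
    s.ncard ≤ 3 := by
  by_contra! h4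
  have hlt : s.ncard < t := by
    by_contra! h
    exact hG.1 (hasCycleOn_of_le_ncard (by omega) h hcomplete)
  obtain ⟨z, hz⟩ : ∃ z, z ∉ s := by
    by_contra! h
    rw [Set.eq_univ_of_forall h, Set.ncard_univ, Nat.card_eq_fintype_card] at hlt
    omega
  obtain ⟨y₀, hy₀⟩ := hs.1
  obtain ⟨v, hv, x, hx, hvx⟩ := hG.exists_adj_of_notMem hy₀ hz
  obtain ⟨q, hq, hql, hqs⟩ := hG.exists_isPath_to_attachment hs hcomplete h4 hx hv hvx
  cases q with
  | nil => exact hx hv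
  | @cons _ y _ hxy r =>
    rw [Walk.cons_isPath_iff] at hq
    rw [Walk.length_cons] at hql
    have hyv : y ≠ v := by
      rintro rfl
      rw [(Walk.isPath_iff_nil.1 hq.1).length_eq_zero] at hql
      omega
    have hys : y ∉ s := fun h => hyv (hqs y (by simp) h)
    obtain ⟨u, hu, huv, -⟩ := exists_mem_ne_ne_ne h4 v v v
    have hyu : y ≠ u := fun h => hys (h ▸ hu)
    have hxu : x ≠ u := fun h => hx (h ▸ hu)
    have hadj : ¬ G.Adj y u := by
      intro h
      refine hx (hs.support_subset hcomplete hv hu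
        (.cons hvx (.cons hxy (.cons h .nil))) ?_ x (by simp))
      simp [Walk.cons_isPath_iff, huv.symm, hvx.ne, hxu, hxy.ne, hyv.symm, hyu]
    have key : ∀ w ∈ s, w ≠ v → w ≠ u → ∃ p : G.Walk y u, p.IsPath ∧ p.length + 1 = t ∧
        s(u, w) ∈ p.edges := by
      intro w hw hwv hwu
      refine ⟨r.append (.cons (hcomplete v hv w hw hwv.symm)
        (.cons (hcomplete w hw u hu hwu) .nil)), isPath_append hq.1 ?_ ?_, ?_, ?_⟩
      · simp [Walk.cons_isPath_iff, hwv.symm, huv.symm, hwu]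
      · intro z hz hz'
        refine hqs z (by simp [hz]) ?_
        simp at hz'
        rcases hz' with rfl | rfl | rfl <;> assumption
      · simp
        omega
      · simp [Sym2.eq_swap]
    obtain ⟨w, hw, hwv, hwu, -⟩ := exists_mem_ne_ne_ne h4 v u u
    obtain ⟨w', hw', hwv', hwu', hww⟩ := exists_mem_ne_ne_ne h4 v u w
    obtain ⟨p, hp, hpl, hpw⟩ := key w hw hwv hwu
    obtain ⟨p', hp', hpl', hpw'⟩ := key w' hw' hwv' hwu'
    have hmem := hG.mem_edges_of_mem_edges hyu hadj hp' hpl' hp hpl hpw'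
    exact hww ((hp.eq_penultimate_of_mem_edges hmem).trans
      (hp.eq_penultimate_of_mem_edges hpw).symm)
end

section
/- For t ≥ 4, a uniquely C_t-saturated graph contains no two distinct vertices with the same neighborhood (twins). -/
open SimpleGraph

namespace SimpleGraph

variable {V : Type*} {G : SimpleGraph V}

/-- Removing an edge at the base point of a cycle leaves a path. -/
lemma Walk.IsCycle.exists_isPath_of_mem_edges {x y : V} {w : G.Walk x x} (hw : w.IsCycle)
    (h : s(x, y) ∈ w.edges) :
    ∃ q : G.Walk y x, q.IsPath ∧ s(x, y) ∉ q.edges ∧ q.length + 1 = w.length ∧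
      ∀ e, e ∈ w.edges ↔ e = s(x, y) ∨ e ∈ q.edges := by
  cases w with
  | nil => simp at h
  | @cons _ z _ hadj p =>
    rw [Walk.cons_isCycle_iff] at hw
    by_cases hz : z = y
    · subst hz
      exact ⟨p, hw.1, hw.2, by simp, by simp⟩
    · have hp : s(x, y) ∈ p.reverse.edges := by
        rw [Walk.edges_cons, List.mem_cons] at h
        rcases h with h | h
        · exact absurd (Sym2.congr_right.mp h).symm hz
        · simpa using h
      have hr : p.reverse.IsPath := hw.1.reverse
      have hlen : p.reverse.length = p.length := by simp
      have hmem : ∀ e, e ∈ p.edges ↔ e ∈ p.reverse.edges := by simp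
      generalize p.reverse = r at hp hr hlen hmem
      cases r with
      | nil => simp at hp
      | @cons _ y' _ hadj' q =>
        rw [Walk.cons_isPath_iff] at hr
        rw [Walk.edges_cons, List.mem_cons] at hp
        rcases hp with hp | hp
        · obtain rfl := (Sym2.congr_right.mp hp)
          have hxq : ∀ v, s(x, v) ∉ q.edges :=
            fun v hv => hr.2 (Walk.fst_mem_support_of_mem_edges q hv)
          refine ⟨q.concat hadj.symm, ?_, ?_, ?_, ?_⟩
          · exact hr.1.concat hr.2 _
          · have := hxq y
            simp only [Walk.edges_concat, List.concat_eq_append,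
              List.mem_append, this, false_or, List.mem_singleton]
            rw [Sym2.eq_swap (a := z), Sym2.congr_right]
            exact fun h => hz h.symm
          · simp at hlen ⊢
            omega
          · intro e
            rw [Walk.edges_cons, List.mem_cons, hmem]
            simp only [Walk.edges_cons, List.mem_cons, Walk.edges_concat,
              List.concat_eq_append, List.mem_append, List.mem_nil_iff,
              Sym2.eq_swap (a := z), or_false]
            tauto
        · exact absurd (Walk.fst_mem_support_of_mem_edges q hp) hr.2

/-- A cycle through the edge `xy` whose edge set is closed under swapping `x` and `y` is a
triangle. -/
lemma Walk.IsCycle.length_eq_three_of_swap [DecidableEq V] {v x y : V} {w : G.Walk v v}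
    (hw : w.IsCycle) (h : s(x, y) ∈ w.edges)
    (hswap : ∀ e ∈ w.edges, Sym2.map (Equiv.swap x y) e ∈ w.edges) : w.length = 3 := by
  have hx : x ∈ w.support := Walk.fst_mem_support_of_mem_edges w h
  have hmem : ∀ e, e ∈ (w.rotate x hx).edges ↔ e ∈ w.edges :=
    fun e => (Walk.rotate_edges w x hx).mem_iff
  obtain ⟨q, hq, hxy, hlen, he⟩ :=
    (hw.rotate hx).exists_isPath_of_mem_edges ((hmem _).mpr h)
  rw [Walk.length_rotate] at hlen
  have hne : x ≠ y := (Walk.adj_of_mem_edges w h).ne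
  simp only [← hmem, he] at hswap
  cases q with
  | nil => exact absurd rfl hne
  | @cons _ a _ hadj p =>
    have hax : a ≠ x := by
      rintro rfl
      simp [Sym2.eq_swap] at hxy
    rw [Walk.cons_isPath_iff] at hq
    have := hswap s(y, a) (by simp)
    rw [Sym2.map_mk] at this
    simp only [Equiv.swap_apply_right, Equiv.swap_apply_of_ne_of_ne hax hadj.ne',
      Walk.edges_cons, List.mem_cons, Sym2.congr_right] at this
    rcases this with h1 | h1 | h1
    · exact absurd h1 hadj.ne'
    · rcases Sym2.eq_iff.mp h1 with h2 | h2
      · exact absurd h2.1 hne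
      · exact absurd h2.1.symm hax
    · have := hq.1.length_eq_one_of_mem_edges (by rwa [Sym2.eq_swap])
      simp at hlen
      omega

end SimpleGraph

/-- For `t ≥ 4`, a uniquely `C_t`-saturated graph contains no twins: no two distinct
vertices have the same neighborhood. -/
theorem stmt_8 {V : Type*} [Fintype V] (G : SimpleGraph V) (t : ℕ) (ht : 4 ≤ t)
    (hG : UniquelyCSat G t) :
    ∀ x y : V, x ≠ y → G.neighborSet x ≠ G.neighborSet y := by
  classical
  intro x y hne hN
  have hN' : ∀ z, G.Adj x z ↔ G.Adj y z := fun z => Set.ext_iff.mp hN z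
  have hxy : ¬ G.Adj x y := fun h => G.loopless.irrefl y ((hN' y).mp h)
  obtain ⟨c, ⟨v, w, hw, hwt, hc⟩, huniq⟩ := hG.2 x y hne hxy
  have hmem : s(x, y) ∈ w.edges := by
    by_contra hnot
    have hE : ∀ e ∈ w.edges, e ∈ G.edgeSet := by
      intro e he
      have := Walk.edges_subset_edgeSet w he
      rw [edgeSet_sup, edgeSet_fromEdgeSet] at this
      rcases this with h | h
      · exact h
      · exact absurd (h.1 ▸ he) hnot
    exact hG.1 ⟨v, w.transfer G hE, hw.transfer hE, by simpa using hwt⟩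
  let f : (G ⊔ fromEdgeSet {s(x, y)}) →g (G ⊔ fromEdgeSet {s(x, y)}) :=
    ⟨Equiv.swap x y, by
      intro a b hab
      have h1 := hN' a
      have h2 := hN' b
      have h3 := G.adj_comm a
      simp only [sup_adj, fromEdgeSet_adj, Set.mem_singleton_iff, Sym2.eq_iff,
        Equiv.swap_apply_def] at hab ⊢
      grind [G.loopless.irrefl x, G.loopless.irrefl y]⟩
  have hf : Function.Injective f := (Equiv.swap x y).injective
  have heq := huniq _ ⟨_, w.map f, hw.map hf, by simpa using hwt, rfl⟩
  have h3 := hw.length_eq_three_of_swap hmem (fun e he => by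
    have : Sym2.map f e ∈ {e | e ∈ (w.map f).edges} := by
      simpa only [Set.mem_ofPred_eq, Walk.edges_map] using List.mem_map_of_mem he
    rw [heq, ← hc] at this
    exact this)
  omega
end

section
/- For t ≥ 6, every uniquely C_t-saturated graph with at least t vertices contains an even cycle of length at most 2t−6. -/
open SimpleGraph

namespace UniqueCycleSaturation

variable {V : Type*} {G : SimpleGraph V}

/-- `S` is the vertex set of a path of length `n` from `u` to `v`. -/
def PathOn (G : SimpleGraph V) (u v : V) (n : ℕ) (S : Set V) : Prop :=
  ∃ p : G.Walk u v, p.IsPath ∧ p.length = n ∧ ∀ x, x ∈ S ↔ x ∈ p.support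

namespace PathOn

variable {u v w : V} {m n : ℕ} {S T : Set V}

theorem left_mem (h : PathOn G u v n S) : u ∈ S := by
  obtain ⟨p, -, -, hS⟩ := h
  exact (hS u).2 p.start_mem_support

theorem right_mem (h : PathOn G u v n S) : v ∈ S := by
  obtain ⟨p, -, -, hS⟩ := h
  exact (hS v).2 p.end_mem_support

theorem symm (h : PathOn G u v n S) : PathOn G v u n S := by
  obtain ⟨p, hp, hn, hS⟩ := h
  exact ⟨p.reverse, hp.reverse, by simpa using hn, by simpa using hS⟩

theorem one_le (h : PathOn G u v n S) (huv : u ≠ v) : 1 ≤ n := by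
  obtain ⟨p, -, rfl, -⟩ := h
  by_contra! h0
  exact huv (p.eq_of_length_eq_zero (by omega))

theorem ne (h : PathOn G u v n S) (hn : n ≠ 0) : u ≠ v := by
  obtain ⟨p, hp, rfl, -⟩ := h
  rintro rfl
  exact hn (Walk.length_eq_zero_iff.2 (Walk.isPath_iff_nil.1 hp))

theorem ofAdj (h : G.Adj u v) : PathOn G u v 1 {u, v} :=
  ⟨h.toWalk, by simpa using h.ne, by simp, by simp⟩

theorem trans (h : PathOn G u v n S) (h' : PathOn G v w m T)
    (hd : ∀ x, x ∈ S → x ∈ T → x = v) : PathOn G u w (n + m) (S ∪ T) := by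
  obtain ⟨p, hp, rfl, hS⟩ := h
  obtain ⟨q, hq, rfl, hT⟩ := h'
  refine ⟨p.append q, ?_, by simp, by simp [hS, hT]⟩
  rw [Walk.isPath_def, Walk.support_append, List.nodup_append]
  have hq' := hq.support_nodup
  rw [← Walk.cons_tail_support, List.nodup_cons] at hq'
  refine ⟨hp.support_nodup, hq'.2, ?_⟩
  rintro a ha _ hb rfl
  have := hd a ((hS a).2 ha) ((hT a).2 (List.mem_of_mem_tail hb))
  exact hq'.1 (this ▸ hb)

/-- Prepend an edge to a path. -/
theorem cons (h : G.Adj u v) (h' : PathOn G v w n S) (hu : u ∉ S) :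
    PathOn G u w (n + 1) (insert u S) := by
  obtain ⟨p, hp, rfl, hS⟩ := h'
  exact ⟨.cons h p, hp.cons (fun hx => hu ((hS u).2 hx)), by simp, by simp [hS]⟩

/-- Remove the first edge of a path. -/
theorem uncons (h : PathOn G u v (n + 1) S) :
    ∃ w T, G.Adj u w ∧ PathOn G w v n T ∧ u ∉ T ∧ ∀ x, x ∈ S ↔ x = u ∨ x ∈ T := by
  obtain ⟨p, hp, hn, hS⟩ := h
  cases p with
  | nil => simp at hn
  | @cons _ w _ h q =>
    rw [Walk.cons_isPath_iff] at hp
    exact ⟨w, {x | x ∈ q.support}, h, ⟨q, hp.1, by simpa using hn, by simp⟩, hp.2,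
      by simpa using hS⟩

/-- Split a path at one of its vertices. -/
theorem split (h : PathOn G u v n S) (hw : w ∈ S) :
    ∃ i j A B, PathOn G u w i A ∧ PathOn G w v j B ∧ i + j = n ∧
      (∀ x, x ∈ S ↔ x ∈ A ∨ x ∈ B) ∧ ∀ x, x ∈ A → x ∈ B → x = w := by
  obtain ⟨p, hp, rfl, hS⟩ := h
  obtain ⟨q, r, hq, hr, rfl⟩ := hp.mem_support_iff_exists_append.1 ((hS w).1 hw)
  refine ⟨q.length, r.length, {x | x ∈ q.support}, {x | x ∈ r.support}, ⟨q, hq, rfl, by simp⟩,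
    ⟨r, hr, rfl, by simp⟩, by simp, by simpa using hS, fun x hx hx' => ?_⟩
  by_contra hne
  exact hp.ne_of_mem_support_of_append hne hx hx' rfl

/-- The initial segment of a path up to the first vertex in a given set. -/
theorem exists_first (h : PathOn G u v n S) (hv : v ∈ T) :
    ∃ w i A, w ∈ T ∧ PathOn G u w i A ∧ i ≤ n ∧ (∀ x, x ∈ A → x ∈ S) ∧
      ∀ x, x ∈ A → x ∈ T → x = w := by
  obtain ⟨p, hp, rfl, hS⟩ := h
  induction p generalizing S with
  | @nil u => exact ⟨u, 0, {u}, hv, ⟨.nil, by simp, rfl, by simp⟩, le_rfl, by simp [hS], by simp⟩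
  | @cons u w v h q ih =>
    by_cases hu : u ∈ T
    · exact ⟨u, 0, {u}, hu, ⟨.nil, by simp, rfl, by simp⟩, by simp, by simp [hS], by simp⟩
    rw [Walk.cons_isPath_iff] at hp
    obtain ⟨z, i, A, hz, hA, hi, hAS, hAT⟩ := ih (S := {x | x ∈ q.support}) hv hp.1 (by simp)
    refine ⟨z, i + 1, insert u A, hz, hA.cons h (fun hx => hp.2 (hAS u hx)),
      by simpa using hi, ?_, ?_⟩
    · rintro x (rfl | hx)
      · simp [hS]
      · simpa [hS] using Or.inr (hAS x hx)
    · rintro x (rfl | hx) hxT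
      · exact absurd hxT hu
      · exact hAT x hx hxT

/-- Two internally disjoint paths with common ends form a cycle. -/
theorem hasCycleOn (h : PathOn G u v n S) (h' : PathOn G v u m T) (huv : u ≠ v)
    (hd : ∀ x, x ∈ S → x ∈ T → x = u ∨ x = v) (hnm : 3 ≤ n + m) : HasCycleOn G (n + m) := by
  obtain ⟨p, hp, rfl, hS⟩ := h
  obtain ⟨q, hq, rfl, hT⟩ := h'
  refine ⟨u, p.append q, hp.isCycle_append hq ?_ (by omega), by simp⟩
  have hp' := hp.support_nodup
  have hq' := hq.support_nodup
  rw [← Walk.cons_tail_support, List.nodup_cons] at hp' hq'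
  intro x hx hx'
  rcases hd x ((hS x).2 (List.mem_of_mem_tail hx))
    ((hT x).2 (List.mem_of_mem_tail hx')) with rfl | rfl
  · exact hp'.1 hx
  · exact hq'.1 hx'

/-- A path of length at least two whose ends are adjacent can be closed up. -/
theorem hasCycleOn_of_adj (h : PathOn G u v n S) (h' : G.Adj v u) (hn : 2 ≤ n) :
    HasCycleOn G (n + 1) :=
  h.hasCycleOn (ofAdj h') h'.ne' (by simp; tauto) (by omega)

end PathOn

/-- `G` has no even cycle of length at most `N`. -/
def NoEvenCycle (G : SimpleGraph V) (N : ℕ) : Prop :=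
  ∀ l, Even l → l ≤ N → ¬ HasCycleOn G l

/-- A path `W` running from a neighbour of `z` to `x`, together with two `z`-`x` paths of different
parity, contains an even cycle. -/
theorem exists_even_cycle {x y z : V} {n d r : ℕ} {W D R : Set V} (hzy : G.Adj z y)
    (hW : PathOn G y x n W) (hzW : z ∉ W) (hD : PathOn G z x d D) (hyD : y ∉ D)
    (hR : PathOn G z x r R) (hRD : ∀ a, a ∈ R → a ∈ D → a = z ∨ a = x)
    (hRW : ∀ a, a ∈ R → a ∈ W → a = x) (hodd : Odd (d + r)) :
    ∃ l, Even l ∧ l ≤ n + d + r ∧ HasCycleOn G l := by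
  obtain ⟨h, i, A, hh, hA, hin, hAW, hAD⟩ := hW.exists_first hD.right_mem
  obtain ⟨d₁, d₂, D₁, D₂, h₁, h₂, rfl, hD₁₂, hdis⟩ := hD.split hh
  have hzx : z ≠ x := fun e => hzW (e ▸ hW.right_mem)
  have hzh : z ≠ h := fun e => hzW (e ▸ hAW h hA.right_mem)
  have hyh : y ≠ h := fun e => hyD (e ▸ hh)
  have hzA : z ∉ A := fun e => hzW (hAW z e)
  have hE : PathOn G z h (i + 1) (insert z A) := hA.cons hzy hzA
  have hi := hA.one_le hyh
  have hd₁ := h₁.one_le hzh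
  have hr := hR.one_le hzx
  by_cases hpar : Even (i + 1 + d₁)
  · refine ⟨_, hpar, by omega, hE.hasCycleOn h₁.symm hzh ?_ (by omega)⟩
    rintro a (rfl | ha) ha'
    · exact Or.inl rfl
    · exact Or.inr (hAD a ha ((hD₁₂ a).2 (Or.inl ha')))
  · have hz₂ : z ∉ D₂ := fun e => hzh (hdis z h₁.left_mem e)
    have hF : PathOn G h z (d₂ + r) (D₂ ∪ R) := h₂.trans hR.symm (by
      intro a ha ha'
      rcases hRD a ha' ((hD₁₂ a).2 (Or.inr ha)) with rfl | rfl
      · exact absurd ha hz₂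
      · rfl)
    refine ⟨i + 1 + (d₂ + r), by grind, by omega, hE.hasCycleOn hF hzh ?_ (by omega)⟩
    rintro a (rfl | ha) (ha' | ha')
    · exact Or.inl rfl
    · exact Or.inl rfl
    · exact Or.inr (hAD a ha ((hD₁₂ a).2 (Or.inr ha')))
    · obtain rfl := hRW a ha' (hAW a ha)
      exact Or.inr (hAD a ha hD.right_mem)

/-- Any two nonadjacent vertices of `G` are joined by a path of length `n`. -/
def NonadjJoined (G : SimpleGraph V) (n : ℕ) : Prop :=
  ∀ x y, x ≠ y → ¬ G.Adj x y → ∃ S, PathOn G x y n S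

theorem exists_even_parts {t : ℕ} (ht : 7 ≤ t) (hodd : Odd t) (hG : NoEvenCycle G (2 * t - 6))
    {x y z : V} (hxz : G.Adj x z) (hzy : G.Adj z y) {S : Set V} (hS : PathOn G x y (t - 1) S) :
    ∃ i j A B, PathOn G x z i A ∧ PathOn G z y j B ∧ i + j = t - 1 ∧ Even i ∧ Even j ∧
      2 ≤ i ∧ 2 ≤ j ∧ ∀ a, a ∈ A → a ∈ B → a = z := by
  by_cases hz : z ∈ S
  · obtain ⟨i, j, A, B, hA, hB, hij, -, hAB⟩ := hS.split hz
    have hi := hA.one_le hxz.ne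
    have hj := hB.one_le hzy.ne
    have hi' : Even i := by
      by_contra hi'
      by_cases h1 : i = 1
      · exact hG _ (by grind) (by omega) (hB.hasCycleOn_of_adj hzy.symm (by omega))
      · exact hG _ (by grind) (by omega) (hA.hasCycleOn_of_adj hxz.symm (by omega))
    exact ⟨i, j, A, B, hA, hB, hij, hi', by grind, by grind, by grind, hAB⟩
  · have := hS.symm.cons hzy hz
    exact absurd (this.hasCycleOn_of_adj hxz (by omega)) (hG _ (by grind) (by omega))

theorem false_of_odd {t : ℕ} (ht : 7 ≤ t) (hodd : Odd t) (hG : NoEvenCycle G (2 * t - 6))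
    (hex : NonadjJoined G (t - 1)) {x y z : V} (hxz : G.Adj x z) (hzy : G.Adj z y)
    (hxy : x ≠ y) (hnxy : ¬ G.Adj x y) : False := by
  obtain ⟨l, a, b, S, hS, hab, hl, hl4, hlt⟩ : ∃ l a b S, PathOn G a b l S ∧ G.Adj a b ∧ Even l ∧
      4 ≤ l ∧ l ≤ t - 3 := by
    obtain ⟨S, hS⟩ := hex x y hxy hnxy
    obtain ⟨i, j, A, B, hA, hB, hij, hi, hj, hi2, hj2, -⟩ :=
      exists_even_parts ht hodd hG hxz hzy hS
    by_cases h : 4 ≤ i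
    · exact ⟨i, x, z, A, hA, hxz, hi, h, by omega⟩
    · exact ⟨j, z, y, B, hB, hzy, hj, by grind, by omega⟩
  obtain ⟨k, rfl⟩ : ∃ k, l = k + 1 + 1 := ⟨l - 2, by omega⟩
  obtain ⟨c, T, hac, hT, haT, -⟩ := hS.uncons
  obtain ⟨d, U, hcd, hU, hcU, hTU⟩ := hT.uncons
  have haU : a ∉ U := fun h => haT ((hTU a).2 (Or.inr h))
  have had : a ≠ d := fun e => haU (e ▸ hU.left_mem)
  have hW := (hU.symm.cons hab haU).symm
  have hnad : ¬ G.Adj a d := fun h =>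
    hG _ hl (by omega) (hW.hasCycleOn_of_adj h (by omega))
  obtain ⟨Q, hQ⟩ := hex a d had hnad
  obtain ⟨i, j, A, B, hA, hB, hij, hi, hj, hi2, hj2, hAB⟩ :=
    exists_even_parts ht hodd hG hac hcd hQ
  obtain ⟨m, hm, hmle, hcyc⟩ := exists_even_cycle hcd hW (by simp [hcU, hac.ne']) hA.symm
    (fun h => hcd.ne' (hAB d h hB.right_mem)) (PathOn.ofAdj hac.symm)
    (by simp) (by simp [hcU]) (by grind)
  exact hG m hm (by omega) hcyc

/-- If `c₀ c₁ c₂ c₃` completed by `W` is a cycle, then a `c₀`-`c₃` path cannot contain `c₁`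
without containing `c₂`. -/
theorem mem_of_mem_of_even {t n : ℕ} (ht : 8 ≤ t) (heven : Even t) (hG : NoEvenCycle G (2 * t - 6))
    {c₀ c₁ c₂ c₃ : V} {W S : Set V} (h01 : G.Adj c₀ c₁) (h12 : G.Adj c₁ c₂) (h23 : G.Adj c₂ c₃)
    (hW : PathOn G c₃ c₀ n W) (h1W : c₁ ∉ W) (h2W : c₂ ∉ W) (hn : n + 2 ≤ t)
    (hS : PathOn G c₀ c₃ (t - 1) S) (h1S : c₁ ∈ S) : c₂ ∈ S := by
  by_contra h2S
  obtain ⟨i, j, A, B, hA, hB, hij, hAB, hdis⟩ := hS.split h1S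
  have h2A : c₂ ∉ A := fun h => h2S ((hAB _).2 (Or.inl h))
  have h2B : c₂ ∉ B := fun h => h2S ((hAB _).2 (Or.inr h))
  have h13 : c₁ ≠ c₃ := fun e => h1W (e ▸ hW.left_mem)
  have h02 : c₀ ≠ c₂ := fun e => h2W (e ▸ hW.right_mem)
  have h0B : c₀ ∉ B := fun h => h01.ne (hdis _ hA.left_mem h)
  have h3A : c₃ ∉ A := fun h => h13 (hdis _ h hB.right_mem).symm
  have hi := hA.one_le h01.ne
  have hj := hB.one_le h13
  have hi' : Even i := by
    by_contra hi'
    have hC := hB.symm.cons h23 h2B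
    exact hG _ (by grind) (by omega) (hC.hasCycleOn_of_adj h12 (by omega))
  by_cases h2 : i = 2
  · obtain ⟨l, hl, hle, hcyc⟩ := exists_even_cycle h12 (hW.cons h23 h2W)
      (by simp [h12.ne, h1W]) hA.symm h2A (PathOn.ofAdj h01.symm) (by simp)
      (by simp [h12.ne, h1W]) (by grind)
    exact hG l hl (by omega) hcyc
  · have hR : PathOn G c₁ c₃ 2 (insert c₁ {c₂, c₃}) :=
      (PathOn.ofAdj h23).cons h12 (by simp [h12.ne, h13])
    obtain ⟨l, hl, hle, hcyc⟩ := exists_even_cycle h01.symm hW.symm h1W hB h0B hR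
      (by simp [h2B]) (by simp [h1W, h2W]) (by grind)
    exact hG l hl (by grind) hcyc

/-- If `c₀ c₁ c₂ c₃` completed by `W` is a cycle, then a `c₀`-`c₃` path that meets `c₁` before `c₂`
is impossible. -/
theorem not_mem_of_even {t n : ℕ} (ht : 8 ≤ t) (heven : Even t) (hG : NoEvenCycle G (2 * t - 6))
    {c₀ c₁ c₂ c₃ : V} {W A B C : Set V} {i j k : ℕ}
    (h01 : G.Adj c₀ c₁) (h12 : G.Adj c₁ c₂) (h23 : G.Adj c₂ c₃)
    (hW : PathOn G c₃ c₀ n W) (h1W : c₁ ∉ W) (h2W : c₂ ∉ W) (hn : n + 2 ≤ t)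
    (hA : PathOn G c₀ c₁ i A) (hB : PathOn G c₁ c₂ j B) (hC : PathOn G c₂ c₃ k C)
    (hijk : i + j + k = t - 1) (h2A : c₂ ∉ A) (h0B : c₀ ∉ B) (h1C : c₁ ∉ C) : False := by
  have hpar {u v : V} {m : ℕ} {P : Set V} (hP : PathOn G u v m P) (huv : G.Adj u v)
      (hm : m ≤ t - 1) : m = 1 ∨ Even m := by
    have := hP.one_le huv.ne
    by_contra! h
    exact hG _ (by grind) (by omega) (hP.hasCycleOn_of_adj huv.symm (by omega))
  have hi := hA.one_le h01.ne
  have hj := hB.one_le h12.ne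
  have hk := hC.one_le h23.ne
  have hi' := hpar hA h01 (by omega)
  have hj' := hpar hB h12 (by omega)
  have hk' := hpar hC h23 (by omega)
  have hWc := hW.cons h23 h2W
  have h1W' : c₁ ∉ insert c₂ W := by simp [h12.ne, h1W]
  have hlarge {u v y : V} {m : ℕ} {P U : Set V} (hP : PathOn G u v m P) (huv : G.Adj u v)
      (hm : Even m) (huy : G.Adj u y) (hU : PathOn G y v (n + 1) U) (huU : u ∉ U) (hyP : y ∉ P) :
      t - 4 ≤ m := by
    by_contra! hlt
    obtain ⟨l, hl, hle, hcyc⟩ := exists_even_cycle huy hU huU hP hyP (PathOn.ofAdj huv)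
      (by simp) (by simp [huU]) (by grind)
    exact hG l hl (by grind) hcyc
  have hi'' : Even i → t - 4 ≤ i := fun h =>
    hlarge hA.symm h01.symm h h12 hWc h1W' h2A
  have hj'' : Even j → t - 4 ≤ j := fun h =>
    hlarge hB h12 h h01.symm hWc.symm h1W' h0B
  have hk'' : Even k → t - 4 ≤ k := fun h =>
    hlarge hC h23 h h12.symm (hW.symm.cons h01.symm h1W) (by simp [h12.ne', h2W]) h1C
  grind

/-- If `c₀ c₁ c₂ c₃` completed by `W` is a cycle, then a `c₀`-`c₃` path that meets `c₂` before `c₁`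
is impossible. -/
theorem not_mem_of_even' {t n : ℕ} (ht : 8 ≤ t) (heven : Even t) (hG : NoEvenCycle G (2 * t - 6))
    {c₀ c₁ c₂ c₃ : V} {W A B C : Set V} {i j k : ℕ}
    (h01 : G.Adj c₀ c₁) (h12 : G.Adj c₁ c₂) (h23 : G.Adj c₂ c₃)
    (hW : PathOn G c₃ c₀ n W) (h1W : c₁ ∉ W) (h2W : c₂ ∉ W) (hn : n + 2 ≤ t)
    (hA : PathOn G c₀ c₂ i A) (hB : PathOn G c₂ c₁ j B) (hC : PathOn G c₁ c₃ k C)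
    (hijk : i + j + k = t - 1) (h1A : c₁ ∉ A) (h3A : c₃ ∉ A) (h0C : c₀ ∉ C) (h2C : c₂ ∉ C) :
    False := by
  have h02 : c₀ ≠ c₂ := fun e => h2W (e ▸ hW.right_mem)
  have h13 : c₁ ≠ c₃ := fun e => h1W (e ▸ hW.left_mem)
  have hi := hA.one_le h02
  have hj := hB.one_le h12.ne'
  have hk := hC.one_le h13
  have hi' : Odd i := by
    by_contra hi'
    exact hG _ (by grind) (by omega)
      ((hA.symm.cons h12 h1A).hasCycleOn_of_adj h01 (by omega))
  have hk' : Odd k := by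
    by_contra hk'
    exact hG _ (by grind) (by omega)
      ((hC.symm.cons h23 h2C |>.symm).hasCycleOn_of_adj h12.symm (by omega))
  have hj' : j = 1 := by
    by_contra hj'
    exact hG _ (by grind) (by omega) (hB.hasCycleOn_of_adj h12 (by omega))
  have hik : i ≤ t - 5 ∨ k ≤ t - 5 := by omega
  rcases hik with hle' | hle'
  · obtain ⟨l, hl, hle, hcyc⟩ := exists_even_cycle h23 hW h2W hA.symm h3A
      ((PathOn.ofAdj h01.symm).cons h12.symm (by simp [h12.ne', h02.symm]))
      (by simp [h1A]) (by simp [h1W, h2W]) (by grind)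
    exact hG l hl (by grind) hcyc
  · obtain ⟨l, hl, hle, hcyc⟩ := exists_even_cycle h01.symm hW.symm h1W hC h0C
      ((PathOn.ofAdj h23).cons h12 (by simp [h12.ne, h13]))
      (by simp [h2C]) (by simp [h1W, h2W]) (by grind)
    exact hG l hl (by grind) hcyc

theorem exists_odd_closed {t : ℕ} (ht : 6 ≤ t) (heven : Even t) (hG : NoEvenCycle G (2 * t - 6))
    {x y z : V} (hxz : G.Adj x z) (hzy : G.Adj z y) {S : Set V} (hS : PathOn G x y (t - 1) S) :
    ∃ n a b T, PathOn G a b n T ∧ G.Adj a b ∧ (n = t - 2 ∨ n = t) := by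
  by_cases hz : z ∈ S
  · obtain ⟨i, j, A, B, hA, hB, hij, -, -⟩ := hS.split hz
    have hi := hA.one_le hxz.ne
    have hj := hB.one_le hzy.ne
    by_cases hi' : i = 1
    · exact ⟨j, _, _, B, hB, hzy, by omega⟩
    by_cases hj' : j = 1
    · exact ⟨i, _, _, A, hA, hxz, by omega⟩
    by_cases hpar : Even i
    · exact absurd (hB.hasCycleOn_of_adj hzy.symm (by omega)) (hG _ (by grind) (by omega))
    · exact absurd (hA.hasCycleOn_of_adj hxz.symm (by omega)) (hG _ (by grind) (by omega))
  · exact ⟨_, _, _, _, hS.symm.cons hzy hz |>.symm, hxz, by omega⟩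

theorem false_of_even {t : ℕ} (ht : 8 ≤ t) (heven : Even t) (hG : NoEvenCycle G (2 * t - 6))
    (hex : NonadjJoined G (t - 1)) {x y z : V} (hxz : G.Adj x z) (hzy : G.Adj z y)
    (hxy : x ≠ y) (hnxy : ¬ G.Adj x y) : False := by
  obtain ⟨S₀, hS₀⟩ := hex x y hxy hnxy
  obtain ⟨m, c₁, c₀, T, hT, h01, hm⟩ := exists_odd_closed (by omega) heven hG hxz hzy hS₀
  obtain ⟨n, rfl⟩ : ∃ n, m = n + 1 + 1 := ⟨m - 2, by omega⟩
  obtain ⟨c₂, U, h12, hU, h1U, hTU⟩ := hT.uncons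
  obtain ⟨c₃, W, h23, hW, h2W, hUW⟩ := hU.uncons
  have h1W : c₁ ∉ W := fun h => h1U ((hUW _).2 (Or.inr h))
  replace h01 := h01.symm
  have h02 : c₀ ≠ c₂ := fun e => h2W (e ▸ hW.right_mem)
  have h13 : c₁ ≠ c₃ := fun e => h1W (e ▸ hW.left_mem)
  have h03 : c₀ ≠ c₃ := (hW.ne (by omega)).symm
  have hn03 : ¬ G.Adj c₀ c₃ := fun h => hG 4 (by decide) (by omega)
    ((((PathOn.ofAdj h).cons h01.symm (by simp [h01.ne', h13])).cons h12.symm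
      (by simp [h12.ne', h02.symm, h23.ne])).hasCycleOn_of_adj h23.symm (by omega))
  obtain ⟨S, hS⟩ := hex c₀ c₃ h03 hn03
  have h12S : c₁ ∈ S ↔ c₂ ∈ S :=
    ⟨mem_of_mem_of_even ht heven hG h01 h12 h23 hW h1W h2W (by omega) hS,
      mem_of_mem_of_even ht heven hG h23.symm h12.symm h01.symm hW.symm h2W h1W (by omega) hS.symm⟩
  by_cases h1S : c₁ ∈ S
  · have h2S := h12S.1 h1S
    obtain ⟨i, j, A, B, hA, hB, hij, hAB, hdis⟩ := hS.split h1S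
    have h0B : c₀ ∉ B := fun h => h01.ne (hdis _ hA.left_mem h)
    have h3A : c₃ ∉ A := fun h => h13 (hdis _ h hB.right_mem).symm
    have h2AB : c₂ ∈ A → c₂ ∉ B := fun h h' => h12.ne' (hdis _ h h')
    rcases (hAB _).1 h2S with h2A | h2B
    · obtain ⟨i', j', A', B', hA', hB', hij', hAB', hdis'⟩ := hA.split h2A
      exact not_mem_of_even' ht heven hG h01 h12 h23 hW h1W h2W (by omega) hA' hB' hB (by omega)
        (by grind [hB'.right_mem]) (by grind) h0B (h2AB h2A)
    · obtain ⟨i', j', A', B', hA', hB', hij', hAB', hdis'⟩ := hB.split h2B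
      exact not_mem_of_even ht heven hG h01 h12 h23 hW h1W h2W (by omega) hA hA' hB' (by omega)
        (by grind) (by grind) (by grind [hA'.left_mem])
  · have h2S : c₂ ∉ S := fun h => h1S (h12S.2 h)
    have hC := (hS.cons h01.symm h1S).symm.cons h23 (by simp [h12.ne', h2S])
    exact hG _ (by grind) (by omega) (hC.hasCycleOn_of_adj h12 (by omega))

theorem exists_transfer_path {x y : V} {w : (G ⊔ fromEdgeSet {s(x, y)}).Walk x y}
    (hw : w.IsPath) (hxy : s(x, y) ∉ w.edges) :
    ∃ p : G.Walk x y, p.IsPath ∧ p.length = w.length := by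
  have h : ∀ e ∈ w.edges, e ∈ G.edgeSet := by
    intro e he
    have := w.edges_subset_edgeSet he
    rw [edgeSet_sup, edgeSet_fromEdgeSet] at this
    rcases this with h | h
    · exact h
    · exact absurd (h.1 ▸ he) hxy
  exact ⟨w.transfer G h, hw.transfer h, by simp⟩

/-- A cycle through the edge `xy` contains a path from `x` to `y` avoiding that edge. -/
theorem exists_path_of_isCycle {H : SimpleGraph V} {x y : V} {w : H.Walk x x} (hw : w.IsCycle)
    (hxy : s(x, y) ∈ w.edges) :
    ∃ p : H.Walk x y, p.IsPath ∧ s(x, y) ∉ p.edges ∧ p.length + 1 = w.length := by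
  cases w with
  | nil => simp at hxy
  | @cons _ a _ h p =>
    rw [Walk.cons_isCycle_iff] at hw
    by_cases hay : y = a
    · subst hay
      exact ⟨p.reverse, hw.1.reverse, by simpa using hw.2, by simp⟩
    have hxp : s(x, y) ∈ p.reverse.edges := by
      simp only [Walk.edges_cons, List.mem_cons] at hxy
      rcases hxy with hxy | hxy
      · exact absurd (Sym2.congr_right.1 hxy) hay
      · simpa using hxy
    have hlen : p.reverse.length = p.length := by simp
    have hpr := hw.1.reverse
    generalize p.reverse = r at hxp hpr hlen
    cases r with
    | nil => simp at hxp
    | @cons _ b _ h' q =>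
      rw [Walk.cons_isPath_iff] at hpr
      rw [Walk.edges_cons, List.mem_cons] at hxp
      rcases hxp with hxp | hxp
      · obtain rfl : y = b := Sym2.congr_right.1 hxp
        have hx : x ∉ q.reverse.support := by simpa using hpr.2
        refine ⟨.cons h q.reverse, hpr.1.reverse.cons hx, ?_, by simp at hlen ⊢; omega⟩
        rw [Walk.edges_cons, List.mem_cons, not_or]
        exact ⟨fun he => hay (Sym2.congr_right.1 he),
          fun he => hx (Walk.fst_mem_support_of_mem_edges _ he)⟩
      · exact absurd (q.fst_mem_support_of_mem_edges hxp) hpr.2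

theorem exists_path_of_uniquelyCSat {t : ℕ} (hG : UniquelyCSat G t) {x y : V} (hxy : x ≠ y)
    (hadj : ¬ G.Adj x y) : ∃ p : G.Walk x y, p.IsPath ∧ p.length + 1 = t := by
  classical
  obtain ⟨c, ⟨v, w, hw, rfl, -⟩, -⟩ := hG.2 x y hxy hadj
  by_cases hmem : s(x, y) ∈ w.edges
  · have hx := w.fst_mem_support_of_mem_edges hmem
    obtain ⟨p, hp, hpe, hlen⟩ := exists_path_of_isCycle (hw.rotate hx)
      ((w.rotate_edges x hx).mem_iff.2 hmem)
    obtain ⟨q, hq, hql⟩ := exists_transfer_path hp hpe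
    exact ⟨q, hq, by rw [hql, hlen, Walk.length_rotate]⟩
  · have h : ∀ e ∈ w.edges, e ∈ G.edgeSet := by
      intro e he
      have := w.edges_subset_edgeSet he
      rw [edgeSet_sup, edgeSet_fromEdgeSet] at this
      rcases this with h | h
      · exact h
      · exact absurd (h.1 ▸ he) hmem
    exact absurd ⟨v, w.transfer G h, hw.transfer h, by simp⟩ hG.1

/-- Two paths with `t` vertices between the same nonadjacent vertices start with the same edge. -/
theorem _root_.UniquelyCSat.eq_of_isPath {t : ℕ} (hG : UniquelyCSat G t) {x y a b : V}
    (hxy : x ≠ y) (hadj : ¬ G.Adj x y) {ha : G.Adj x a} {hb : G.Adj x b}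
    {p : G.Walk a y} {q : G.Walk b y}
    (hp : (Walk.cons ha p).IsPath) (hq : (Walk.cons hb q).IsPath) (hpt : p.length + 2 = t)
    (hqt : q.length + 2 = t) : a = b := by
  obtain ⟨c, -, hc⟩ := hG.2 x y hxy hadj
  have hle : G ≤ G ⊔ fromEdgeSet {s(x, y)} := le_sup_left
  have hyx : (G ⊔ fromEdgeSet {s(x, y)}).Adj y x := by simp [hxy.symm, Sym2.eq_swap]
  have key {r : G.Walk x y} (hr : r.IsPath) (hrt : r.length + 1 = t) :
      {e | e ∈ (Walk.cons hyx (r.mapLe hle)).edges} = c := by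
    refine hc _ ⟨y, _, ?_, by simpa using hrt, rfl⟩
    rw [Walk.cons_isCycle_iff, Walk.isPath_mapLe, Walk.edges_mapLe_eq_edges]
    exact ⟨hr, fun h => hadj (r.adj_of_mem_edges h).symm⟩
  have h := (key hp (by simpa using hpt)).trans (key hq (by simpa using hqt)).symm
  have hmem : s(x, a) ∈ {e | e ∈ (Walk.cons hyx ((Walk.cons hb q).mapLe hle)).edges} := by
    rw [← h]
    simp
  rw [Walk.cons_isPath_iff] at hq
  simp only [Walk.edges_cons, Walk.edges_mapLe_eq_edges, Set.mem_ofPred_eq, List.mem_cons] at hmem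
  rcases hmem with hmem | hmem | hmem
  · obtain rfl : a = y := by
      rw [Sym2.eq_swap (a := y)] at hmem
      exact Sym2.congr_right.1 hmem
    exact absurd ha hadj
  · exact Sym2.congr_right.1 hmem
  · exact absurd (q.fst_mem_support_of_mem_edges hmem) hq.2

theorem _root_.UniquelyCSat.exists_not_adj [Fintype V] {t : ℕ} (ht : 3 ≤ t)
    (hn : t ≤ Fintype.card V) (hG : UniquelyCSat G t) : ∃ x y, x ≠ y ∧ ¬ G.Adj x y := by
  by_contra! h
  refine hG.1 ((cycleGraph_isContained_iff (by omega)).1 ?_)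
  obtain ⟨f⟩ : Nonempty (Fin t ↪ V) := Function.Embedding.nonempty_of_card_le (by simpa using hn)
  exact ⟨⟨⟨f, fun hab => h _ _ (f.injective.ne hab.ne)⟩, f.injective⟩⟩

/-- A walk between distinct nonadjacent vertices yields two nonadjacent vertices with a common
neighbour. -/
theorem exists_common_neighbor {x y : V} (w : G.Walk x y) (hxy : x ≠ y) (hadj : ¬ G.Adj x y) :
    ∃ a z b, G.Adj a z ∧ G.Adj z b ∧ a ≠ b ∧ ¬ G.Adj a b := by
  induction w with
  | nil => exact absurd rfl hxy
  | @cons x z y h p ih =>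
    by_cases hzy : G.Adj z y
    · exact ⟨x, z, y, h, hzy, hxy, hadj⟩
    · exact ih (by rintro rfl; exact hadj h) hzy

/-- `x a b c d y` is a path with five edges. -/
def IsPath5 (G : SimpleGraph V) (x a b c d y : V) : Prop :=
  G.Adj x a ∧ G.Adj a b ∧ G.Adj b c ∧ G.Adj c d ∧ G.Adj d y ∧ x ≠ b ∧ x ≠ c ∧ x ≠ d ∧ x ≠ y ∧
    a ≠ c ∧ a ≠ d ∧ a ≠ y ∧ b ≠ d ∧ b ≠ y ∧ c ≠ y

/-- `G` has no 4-cycle. -/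
def NoC4 (G : SimpleGraph V) : Prop :=
  ∀ a b c d, G.Adj a b → G.Adj b c → G.Adj c d → G.Adj d a → a ≠ c → b ≠ d → False

/-- `G` has no 5-cycle. -/
def NoC5 (G : SimpleGraph V) : Prop :=
  ∀ a b c d e, G.Adj a b → G.Adj b c → G.Adj c d → G.Adj d e → G.Adj e a →
    [a, b, c, d, e].Nodup → False

/-- `G` has no 6-cycle. -/
def NoC6 (G : SimpleGraph V) : Prop :=
  ∀ a b c d e f, IsPath5 G a b c d e f → ¬ G.Adj a f

/-- Any two nonadjacent vertices of `G` are joined by a path with five edges. -/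
def ExistsPath5 (G : SimpleGraph V) : Prop :=
  ∀ x y, x ≠ y → ¬ G.Adj x y → ∃ a b c d, IsPath5 G x a b c d y

/-- Paths with five edges between two nonadjacent vertices of `G` start with the same edge. -/
def UniquePath5 (G : SimpleGraph V) : Prop :=
  ∀ x y, x ≠ y → ¬ G.Adj x y → ∀ a b c d a' b' c' d',
    IsPath5 G x a b c d y → IsPath5 G x a' b' c' d' y → a = a'

/-- In a 5-cycle, two adjacent vertices are not joined by a disjoint path with four edges. -/
theorem false_of_fiveCycle_ear (h6 : NoC6 G) (hun : UniquePath5 G)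
    {a0 a1 a2 a3 a4 b1 b2 b3 : V} (h01 : G.Adj a0 a1) (h12 : G.Adj a1 a2) (h23 : G.Adj a2 a3)
    (h34 : G.Adj a3 a4) (h40 : G.Adj a4 a0) (g01 : G.Adj a0 b1) (g12 : G.Adj b1 b2)
    (g23 : G.Adj b2 b3) (g34 : G.Adj b3 a4)
    (hn : [a0, a1, a2, a3, a4, b1, b2, b3].Nodup) : False := by
  simp only [List.nodup_cons, List.mem_cons, List.not_mem_nil, List.nodup_nil, or_false, not_or,
    not_false_eq_true, and_true] at hn
  have hs : ∀ a b, G.Adj a b → G.Adj b a := fun a b h => h.symm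
  have hne : ∀ a b, G.Adj a b → a ≠ b := fun a b h => h.ne
  have p : IsPath5 G b1 b2 b3 a4 a0 a1 := by unfold IsPath5; grind
  have p' : IsPath5 G b1 a0 a4 a3 a2 a1 := by unfold IsPath5; grind
  have := hun b1 a1 (by grind) (h6 _ _ _ _ _ _ p) _ _ _ _ _ _ _ _ p p'
  grind

theorem noC5 (h4 : NoC4 G) (h6 : NoC6 G) (hex : ExistsPath5 G) (hun : UniquePath5 G) :
    NoC5 G := by
  intro c0 c1 c2 c3 c4 h01 h12 h23 h34 h40 hn
  simp only [List.nodup_cons, List.mem_cons, List.not_mem_nil, List.nodup_nil, or_false, not_or,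
    not_false_eq_true, and_true] at hn
  have hs : ∀ a b, G.Adj a b → G.Adj b a := fun a b h => h.symm
  have hne : ∀ a b, G.Adj a b → a ≠ b := fun a b h => h.ne
  have n02 : ¬ G.Adj c0 c2 := fun h => h4 c0 c2 c3 c4 h h23 h34 h40 (by grind) (by grind)
  have n13 : ¬ G.Adj c1 c3 := fun h => h4 c1 c3 c4 c0 h h34 h40 h01 (by grind) (by grind)
  have n24 : ¬ G.Adj c2 c4 := fun h => h4 c2 c4 c0 c1 h h40 h01 h12 (by grind) (by grind)
  have n30 : ¬ G.Adj c3 c0 := fun h => h4 c3 c0 c1 c2 h h01 h12 h23 (by grind) (by grind)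
  have n41 : ¬ G.Adj c4 c1 := fun h => h4 c4 c1 c2 c3 h h12 h23 h34 (by grind) (by grind)
  obtain ⟨q1,q2,q3,q4,a1,a2,a3,a4,a5,nq⟩ := hex c0 c2 (by grind) (by grind)
  have e12 : q2 ≠ c1 := by
    rintro rfl
    exact h4 q2 q3 q4 c2 a3 a4 a5 h12.symm (by grind) (by grind)
  have e13 : q3 ≠ c1 := by
    rintro rfl
    exact h4 q3 c0 q1 q2 h01.symm a1 a2 a3 (by grind) (by grind)
  have e42 : q2 ≠ c4 := by
    rintro rfl
    exact h6 c0 q1 q2 c3 c2 c1 (by unfold IsPath5; grind) h01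
  have e33 : q3 ≠ c3 := by
    rintro rfl
    exact h6 c2 q4 q3 c4 c0 c1 (by unfold IsPath5; grind) h12.symm
  have e32 : q2 ≠ c3 := by
    rintro rfl
    exact h4 q2 q3 q4 c2 a3 a4 a5 h23 (by grind) (by grind)
  have e43 : q3 ≠ c4 := by
    rintro rfl
    exact h4 q3 c0 q1 q2 h40 a1 a2 a3 (by grind) (by grind)
  have e41 : q1 ≠ c4 := by
    rintro rfl
    by_cases h : q4 = c3
    · subst h
      exact h4 q1 q2 q3 q4 a2 a3 a4 h34 (by grind) (by grind)
    exact h6 q1 q2 q3 q4 c2 c3 (by unfold IsPath5; grind) h34.symm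
  have e34 : q4 ≠ c3 := by
    rintro rfl
    exact h6 q4 q3 q2 q1 c0 c4 (by unfold IsPath5; grind) h34
  have : q1 = c1 ∨ q4 = c1 ∨ (q1 ≠ c1 ∧ q4 ≠ c1) := by tauto
  rcases this with rfl | rfl | ⟨h1, h2⟩
  · exact false_of_fiveCycle_ear h6 hun h01.symm h40.symm h34.symm h23.symm h12.symm a2 a3 a4
      a5 (by grind)
  · exact false_of_fiveCycle_ear h6 hun h12 h23 h34 h40 h01 a4.symm a3.symm
      a2.symm a1.symm (by grind)
  · have h : ¬ G.Adj q1 c1 := fun h => h6 q1 q2 q3 q4 c2 c1 (by unfold IsPath5; grind) h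
    have := hun q1 c1 (by grind) h q2 q3 q4 c2 c0 c4 c3 c2 (by unfold IsPath5; grind)
      (by unfold IsPath5; grind)
    grind

/-- No edge of a 7-cycle lies in a triangle. -/
theorem false_of_sevenCycle_triangle (h4 : NoC4 G) (h6 : NoC6 G) (hun : UniquePath5 G)
    {c0 c1 c2 c3 c4 c5 c6 : V} (h01 : G.Adj c0 c1) (h12 : G.Adj c1 c2) (h23 : G.Adj c2 c3)
    (h34 : G.Adj c3 c4) (h45 : G.Adj c4 c5) (h56 : G.Adj c5 c6) (h60 : G.Adj c6 c0)
    (hn : [c0, c1, c2, c3, c4, c5, c6].Nodup) (w : V) (hw0 : G.Adj c0 w) (hw1 : G.Adj c1 w) :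
    False := by
  simp only [List.nodup_cons, List.mem_cons, List.not_mem_nil, List.nodup_nil, or_false, not_or,
    not_false_eq_true, and_true] at hn
  have hs : ∀ a b, G.Adj a b → G.Adj b a := fun a b h => h.symm
  have hne : ∀ a b, G.Adj a b → a ≠ b := fun a b h => h.ne
  have n02 : w ≠ c2 := by
    rintro rfl
    exact h6 c0 w c3 c4 c5 c6 (by unfold IsPath5; grind) h60.symm
  have n03 : w ≠ c3 := by
    rintro rfl
    exact h4 c0 c1 c2 w h01 h12 h23 hw0.symm (by grind) (by grind)
  have n04 : w ≠ c4 := by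
    rintro rfl
    exact h4 c0 w c5 c6 hw0 h45 h56 h60 (by grind) (by grind)
  have n05 : w ≠ c5 := by
    rintro rfl
    exact h6 c0 c1 c2 c3 c4 w (by unfold IsPath5; grind) hw0
  have n06 : w ≠ c6 := by
    rintro rfl
    exact h6 c1 c2 c3 c4 c5 w (by unfold IsPath5; grind) hw1
  have p : IsPath5 G w c1 c0 c6 c5 c4 := by unfold IsPath5; grind
  have p' : IsPath5 G w c0 c1 c2 c3 c4 := by unfold IsPath5; grind
  have := hun w c4 (by grind) (h6 _ _ _ _ _ _ p) _ _ _ _ _ _ _ _ p p'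
  grind

/-- There are no two disjoint paths with four edges between `u` and `v` when `u` has a neighbour
off these paths. -/
theorem false_of_two_paths (h6 : NoC6 G) (hun : UniquePath5 G) {u d v a1 a2 a3 b1 b2 b3 : V}
    (hd : G.Adj u d) (ha1 : G.Adj u a1) (ha2 : G.Adj a1 a2) (ha3 : G.Adj a2 a3) (ha4 : G.Adj a3 v)
    (hb1 : G.Adj u b1) (hb2 : G.Adj b1 b2) (hb3 : G.Adj b2 b3) (hb4 : G.Adj b3 v)
    (hn : [u, d, v, a1, a2, a3, b1, b2, b3].Nodup) : False := by
  simp only [List.nodup_cons, List.mem_cons, List.not_mem_nil, List.nodup_nil, or_false, not_or,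
    not_false_eq_true, and_true] at hn
  have hs : ∀ a b, G.Adj a b → G.Adj b a := fun a b h => h.symm
  have hne : ∀ a b, G.Adj a b → a ≠ b := fun a b h => h.ne
  have p : IsPath5 G v a3 a2 a1 u d := by unfold IsPath5; grind
  have p' : IsPath5 G v b3 b2 b1 u d := by unfold IsPath5; grind
  have := hun v d (by grind) (h6 _ _ _ _ _ _ p) _ _ _ _ _ _ _ _ p p'
  grind

theorem false_of_sevenCycle (h4 : NoC4 G) (h5 : NoC5 G) (h6 : NoC6 G) (hex : ExistsPath5 G)
    (hun : UniquePath5 G) {c0 c1 c2 c3 c4 c5 c6 : V} (h01 : G.Adj c0 c1) (h12 : G.Adj c1 c2)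
    (h23 : G.Adj c2 c3) (h34 : G.Adj c3 c4) (h45 : G.Adj c4 c5) (h56 : G.Adj c5 c6)
    (h60 : G.Adj c6 c0) (hn : [c0, c1, c2, c3, c4, c5, c6].Nodup) : False := by
  have t01 := false_of_sevenCycle_triangle h4 h6 hun h01 h12 h23 h34 h45 h56 h60 (by grind)
  have t12 := false_of_sevenCycle_triangle h4 h6 hun h12 h23 h34 h45 h56 h60 h01 (by grind)
  have t23 := false_of_sevenCycle_triangle h4 h6 hun h23 h34 h45 h56 h60 h01 h12 (by grind)
  have t34 := false_of_sevenCycle_triangle h4 h6 hun h34 h45 h56 h60 h01 h12 h23 (by grind)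
  have t45 := false_of_sevenCycle_triangle h4 h6 hun h45 h56 h60 h01 h12 h23 h34 (by grind)
  have t56 := false_of_sevenCycle_triangle h4 h6 hun h56 h60 h01 h12 h23 h34 h45 (by grind)
  have t60 := false_of_sevenCycle_triangle h4 h6 hun h60 h01 h12 h23 h34 h45 h56 (by grind)
  simp only [List.nodup_cons, List.mem_cons, List.not_mem_nil, List.nodup_nil, or_false, not_or,
    not_false_eq_true, and_true] at hn
  have hs : ∀ a b, G.Adj a b → G.Adj b a := fun a b h => h.symm
  have hne : ∀ a b, G.Adj a b → a ≠ b := fun a b h => h.ne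
  have n03 : ¬ G.Adj c0 c3 := fun h => h4 c0 c1 c2 c3 h01 h12 h23 h.symm (by grind) (by grind)
  have n04 : ¬ G.Adj c0 c4 := fun h => h4 c0 c4 c5 c6 h h45 h56 h60 (by grind) (by grind)
  have n36 : ¬ G.Adj c3 c6 := fun h => h4 c3 c4 c5 c6 h34 h45 h56 h.symm (by grind) (by grind)
  have n05 : ¬ G.Adj c0 c5 := fun h => t56 c0 h.symm h60
  have n46 : ¬ G.Adj c4 c6 := fun h => t45 c6 h h56
  have n35 : ¬ G.Adj c3 c5 := fun h => t34 c5 h h45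
  have n02 : ¬ G.Adj c0 c2 := fun h => t01 c2 h h12
  have n13 : ¬ G.Adj c1 c3 := fun h => t12 c3 h h23
  obtain ⟨q1,q2,q3,q4,a1,a2,a3,a4,a5,nq⟩ := hex c0 c3 (by grind) n03
  have e12 : q2 ≠ c1 := by
    rintro rfl
    exact t01 q1 a1 a2.symm
  have e13 : q3 ≠ c1 := by
    rintro rfl
    exact h4 q3 c0 q1 q2 h01.symm a1 a2 a3 (by grind) (by grind)
  have e14 : q4 ≠ c1 := by
    rintro rfl
    exact n13 a5
  have e21 : q1 ≠ c2 := by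
    rintro rfl
    exact n02 a1
  have e22 : q2 ≠ c2 := by
    rintro rfl
    exact h4 q2 q3 q4 c3 a3 a4 a5 h23.symm (by grind) (by grind)
  have e23 : q3 ≠ c2 := by
    rintro rfl
    exact t23 q4 a4 a5.symm
  have e11 : q1 ≠ c1 := by
    rintro rfl
    by_cases h : q4 = c2
    · subst h
      exact h4 q1 q2 q3 q4 a2 a3 a4 h12.symm (by grind) (by grind)
    · exact h6 q1 q2 q3 q4 c3 c2 (by unfold IsPath5; grind) h12
  have e24 : q4 ≠ c2 := by
    rintro rfl
    exact h6 q4 q3 q2 q1 c0 c1 (by unfold IsPath5; grind) h12.symm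
  have e41 : q1 ≠ c4 := by
    rintro rfl
    exact n04 a1
  have e64 : q4 ≠ c6 := by
    rintro rfl
    exact n36 a5.symm
  have e51 : q1 ≠ c5 := by
    rintro rfl
    exact n05 a1
  have e54 : q4 ≠ c5 := by
    rintro rfl
    exact n35 a5.symm
  have e43 : q3 ≠ c4 := by
    rintro rfl
    exact t34 q4 a5.symm a4
  have e62 : q2 ≠ c6 := by
    rintro rfl
    exact t60 q1 a2.symm a1
  have e63 : q3 ≠ c6 := by
    rintro rfl
    exact h4 c0 q1 q2 q3 a1 a2 a3 h60 (by grind) (by grind)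
  have e42 : q2 ≠ c4 := by
    rintro rfl
    exact h4 c3 q2 q3 q4 h34 a3 a4 a5 (by grind) (by grind)
  have e52 : q2 ≠ c5 := by
    rintro rfl
    by_cases h : q1 = c6
    · subst h
      by_cases h' : q4 = c4
      · subst h'
        exact t45 q3 a4.symm a3
      · exact h5 q2 q3 q4 c3 c4 a3 a4 a5 h34 h45 (by grind)
    · exact h4 c0 q1 q2 c6 a1 a2 h56 h60 (by grind) (by grind)
  have e53 : q3 ≠ c5 := by
    rintro rfl
    by_cases h : q4 = c4
    · subst h
      by_cases h' : q1 = c6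
      · subst h'
        exact t56 q2 a3.symm a2
      · exact h5 q3 q2 q1 c0 c6 a3.symm a2.symm a1.symm h60.symm h56.symm (by grind)
    · exact h4 c3 q4 q3 c4 a5.symm a4.symm h45.symm h34.symm (by grind) (by grind)
  by_cases h1 : q1 = c6
  · subst h1
    by_cases h2 : q4 = c4
    · subst h2
      exact h5 q1 q2 q3 q4 c5 a2 a3 a4 h45 h56 (by grind)
    · exact false_of_two_paths h6 hun h56.symm h60 h01 h12 h23 a2 a3 a4 a5 (by
        simp only [List.nodup_cons, List.mem_cons, List.not_mem_nil, List.nodup_nil, or_false,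
          not_or, not_false_eq_true, and_true]
        grind)
  · by_cases h2 : q4 = c4
    · subst h2
      exact false_of_two_paths h6 hun h60.symm h01 h12 h23 h34 a1 a2 a3 a4 (by
        simp only [List.nodup_cons, List.mem_cons, List.not_mem_nil, List.nodup_nil, or_false,
          not_or, not_false_eq_true, and_true]
        grind)
    · have p : IsPath5 G q1 q2 q3 q4 c3 c4 := by unfold IsPath5; grind
      have p' : IsPath5 G q1 c0 c1 c2 c3 c4 := by unfold IsPath5; grind
      have := hun _ _ (by grind) (h6 _ _ _ _ _ _ p) _ _ _ _ _ _ _ _ p p'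
      grind

theorem false_of_path5 (h4 : NoC4 G) (h6 : NoC6 G) (hex : ExistsPath5 G) (hun : UniquePath5 G)
    {x y z : V} (hxz : G.Adj x z) (hzy : G.Adj z y) (hn : x ≠ y) (hxy : ¬ G.Adj x y) :
    False := by
  have h5 := noC5 h4 h6 hex hun
  have hs : ∀ a b, G.Adj a b → G.Adj b a := fun a b h => h.symm
  have hne : ∀ a b, G.Adj a b → a ≠ b := fun a b h => h.ne
  obtain ⟨q1,q2,q3,q4,a1,a2,a3,a4,a5,nq⟩ := hex x y hn hxy
  by_cases e1 : z = q1
  · subst e1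
    exact h5 z q2 q3 q4 y a2 a3 a4 a5 hzy.symm (by grind)
  by_cases e4 : z = q4
  · subst e4
    exact h5 z x q1 q2 q3 hxz.symm a1 a2 a3 a4 (by grind)
  by_cases e2 : z = q2
  · subst e2
    exact h4 z q3 q4 y a3 a4 a5 hzy.symm (by grind) (by grind)
  by_cases e3 : z = q3
  · subst e3
    exact h4 z x q1 q2 hxz.symm a1 a2 a3 (by grind) (by grind)
  exact false_of_sevenCycle h4 h5 h6 hex hun a1 a2 a3 a4 a5 hzy.symm hxz.symm (by grind)

theorem noC4_of_noEvenCycle {N : ℕ} (hN : 4 ≤ N) (hG : NoEvenCycle G N) : NoC4 G := by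
  intro a b c d hab hbc hcd hda hac hbd
  refine hG 4 (by decide) hN ⟨a, .cons hab (.cons hbc (.cons hcd (.cons hda .nil))), ?_, rfl⟩
  simp [Walk.cons_isCycle_iff, hbc.ne, hcd.ne, hab.ne, hab.ne', hda.ne, hbd, hac, hac.symm]

theorem noC6_of_noEvenCycle {N : ℕ} (hN : 6 ≤ N) (hG : NoEvenCycle G N) : NoC6 G := by
  rintro x a b c d y ⟨h₁, h₂, h₃, h₄, h₅, hn⟩ hxy
  refine hG 6 (by decide) hN
    ⟨y, .cons hxy.symm (.cons h₁ (.cons h₂ (.cons h₃ (.cons h₄ (.cons h₅ .nil))))), ?_, rfl⟩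
  have := h₁.ne
  have := h₂.ne
  have := h₃.ne
  have := h₄.ne
  have := h₅.ne
  simp [Walk.cons_isCycle_iff]
  grind

theorem _root_.UniquelyCSat.existsPath5 (hG : UniquelyCSat G 6) : ExistsPath5 G := by
  intro x y hxy hadj
  obtain ⟨p, hp, hlen⟩ := exists_path_of_uniquelyCSat hG hxy hadj
  match p, hp, hlen with
  | .cons (v := a) h₁ (.cons (v := b) h₂ (.cons (v := c) h₃ (.cons (v := d) h₄
      (.cons h₅ .nil)))), hp, _ =>
    refine ⟨a, b, c, d, h₁, h₂, h₃, h₄, h₅, ?_⟩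
    simp at hp
    grind

theorem _root_.UniquelyCSat.uniquePath5 (hG : UniquelyCSat G 6) : UniquePath5 G := by
  rintro x y hxy hadj a b c d a' b' c' d' ⟨h₁, h₂, h₃, h₄, h₅, hn⟩ ⟨h₁', h₂', h₃', h₄', h₅', hn'⟩
  have hw {a b c d : V} (h₁ : G.Adj x a) (h₂ : G.Adj a b) (h₃ : G.Adj b c) (h₄ : G.Adj c d)
      (h₅ : G.Adj d y) (hn : x ≠ b ∧ x ≠ c ∧ x ≠ d ∧ x ≠ y ∧ a ≠ c ∧ a ≠ d ∧ a ≠ y ∧ b ≠ d ∧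
        b ≠ y ∧ c ≠ y) :
      (Walk.cons h₁ (.cons h₂ (.cons h₃ (.cons h₄ (.cons h₅ .nil))))).IsPath := by
    simp [h₁.ne, h₂.ne, h₃.ne, h₄.ne, h₅.ne]
    grind
  exact hG.eq_of_isPath hxy hadj (hw h₁ h₂ h₃ h₄ h₅ hn) (hw h₁' h₂' h₃' h₄' h₅' hn') rfl rfl

end UniqueCycleSaturation

open UniqueCycleSaturation in
/-- For `t ≥ 6`, every uniquely `C_t`-saturated graph with at least `t` vertices
contains an even cycle of length at most `2t - 6`. -/
theorem stmt_9 {V : Type*} [Fintype V] (G : SimpleGraph V) (t : ℕ) (ht : 6 ≤ t)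
    (hn : t ≤ Fintype.card V) (hG : UniquelyCSat G t) :
    ∃ l : ℕ, Even l ∧ l ≤ 2 * t - 6 ∧ HasCycleOn G l := by
  by_contra! hno
  replace hno : NoEvenCycle G (2 * t - 6) := hno
  obtain ⟨u, v, huv, hnuv⟩ := hG.exists_not_adj (by omega) hn
  obtain ⟨p, -, -⟩ := exists_path_of_uniquelyCSat hG huv hnuv
  obtain ⟨x, z, y, hxz, hzy, hxy, hnxy⟩ := exists_common_neighbor p huv hnuv
  have hex : NonadjJoined G (t - 1) := by
    intro a b hab hadj
    obtain ⟨q, hq, hlen⟩ := exists_path_of_uniquelyCSat hG hab hadj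
    exact ⟨{c | c ∈ q.support}, q, hq, by omega, fun _ => Iff.rfl⟩
  obtain hodd | heven := (Nat.even_or_odd t).symm
  · exact false_of_odd (by grind) hodd hno hex hxz hzy hxy hnxy
  obtain rfl | ht : t = 6 ∨ 8 ≤ t := by grind
  · exact false_of_path5 (noC4_of_noEvenCycle (by norm_num) hno)
      (noC6_of_noEvenCycle (by norm_num) hno) hG.existsPath5 hG.uniquePath5 hxz hzy hxy hnxy
  · exact false_of_even ht heven hno hex hxz hzy hxy hnxy
end

section
/- A graph with at least five vertices is uniquely C_5-saturated if and only if it is a friendship graph, i.e., it consists of k ≥ 2 triangles pairwise sharing exactly one common vertex. -/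
open SimpleGraph

/-- `G` is a friendship graph: there is a center `z` adjacent to every other vertex,
and every other vertex is adjacent to exactly one vertex besides `z` (so `G` consists
of edge-disjoint triangles all sharing the vertex `z`). -/
def IsFriendship {V : Type*} (G : SimpleGraph V) : Prop :=
  ∃ z : V, (∀ v : V, v ≠ z → G.Adj z v) ∧
    ∀ v : V, v ≠ z → ∃! w : V, w ≠ z ∧ G.Adj v w

/-- `x a b c y` is a path on five vertices in `G`. -/
def IsPathOnFive {V : Type*} (G : SimpleGraph V) (x a b c y : V) : Prop :=
  (G.Adj x a ∧ G.Adj a b ∧ G.Adj b c ∧ G.Adj c y) ∧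
    x ≠ a ∧ x ≠ b ∧ x ≠ c ∧ x ≠ y ∧ a ≠ b ∧ a ≠ c ∧ a ≠ y ∧ b ≠ c ∧ b ≠ y ∧ c ≠ y

theorem IsPathOnFive.symm {V : Type*} {G : SimpleGraph V} {x a b c y : V}
    (h : IsPathOnFive G x a b c y) : IsPathOnFive G y c b a x := by
  obtain ⟨⟨h1, h2, h3, h4⟩, hd⟩ := h
  exact ⟨⟨h4.symm, h3.symm, h2.symm, h1.symm⟩, by grind⟩

theorem isCtEdgeSet_five_iff {V : Type*} (G : SimpleGraph V) (S : Set (Sym2 V)) :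
    IsCtEdgeSet G 5 S ↔ ∃ x a b c y, IsPathOnFive G x a b c y ∧ G.Adj y x ∧
      S = {s(x, a), s(a, b), s(b, c), s(c, y), s(y, x)} := by
  constructor
  · rintro ⟨v, w, hw, hl, rfl⟩
    match v, w, hw, hl with
    | v, .cons (v := a) h1 (.cons (v := b) h2 (.cons (v := c) h3 (.cons (v := d) h4
        (.cons h5 .nil)))), hw, _ =>
      have hn := hw.support_nodup
      simp only [Walk.support_cons, Walk.support_nil, List.tail_cons, List.nodup_cons,
        List.mem_cons, List.not_mem_nil, not_or, or_false] at hn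
      refine ⟨v, a, b, c, d, ⟨⟨h1, h2, h3, h4⟩, ?_⟩, h5, ?_⟩
      · grind
      · ext e
        simp
  · rintro ⟨x, a, b, c, y, ⟨⟨h1, h2, h3, h4⟩, hd⟩, h5, rfl⟩
    refine ⟨x, .cons h1 (.cons h2 (.cons h3 (.cons h4 (.cons h5 .nil)))), ?_, rfl, ?_⟩
    · rw [Walk.cons_isCycle_iff]
      constructor
      · simp [Walk.cons_isPath_iff]
        grind
      · simp
        grind
    · ext e
      simp

theorem hasCycleOn_five_iff {V : Type*} (G : SimpleGraph V) :
    HasCycleOn G 5 ↔ ∃ x a b c y, IsPathOnFive G x a b c y ∧ G.Adj y x := by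
  constructor
  · rintro ⟨v, w, hw, hl⟩
    obtain ⟨x, a, b, c, y, h, hyx, -⟩ := (isCtEdgeSet_five_iff G _).1 ⟨v, w, hw, hl, rfl⟩
    exact ⟨x, a, b, c, y, h, hyx⟩
  · rintro ⟨x, a, b, c, y, h, hyx⟩
    obtain ⟨v, w, hw, hl, -⟩ := (isCtEdgeSet_five_iff G _).2 ⟨x, a, b, c, y, h, hyx, rfl⟩
    exact ⟨v, w, hw, hl⟩

theorem isCtEdgeSet_sup_five_iff {V : Type*} {G : SimpleGraph V}
    (h0 : ∀ x a b c y, IsPathOnFive G x a b c y → ¬ G.Adj y x) {x y : V} (hxy : x ≠ y)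
    (S : Set (Sym2 V)) :
    IsCtEdgeSet (G ⊔ fromEdgeSet {s(x, y)}) 5 S ↔ ∃ a b c, IsPathOnFive G x a b c y ∧
      S = {s(x, a), s(a, b), s(b, c), s(c, y), s(y, x)} := by
  have hadj : ∀ u v, (G ⊔ fromEdgeSet {s(x, y)}).Adj u v ↔
      G.Adj u v ∨ (x = u ∧ y = v ∨ x = v ∧ y = u) := by
    intro u v
    simp only [sup_adj, fromEdgeSet_adj, Set.mem_singleton_iff, Sym2.eq_iff]
    grind
  rw [isCtEdgeSet_five_iff]
  constructor
  · rintro ⟨v, a, b, c, d, ⟨⟨h1, h2, h3, h4⟩, hd⟩, h5, rfl⟩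
    rw [hadj] at h1 h2 h3 h4 h5
    have hrot : ∀ α β γ δ ε : Sym2 V, ({α, β, γ, δ, ε} : Set (Sym2 V)) = {β, γ, δ, ε, α} := by
      intros
      ext
      constructor <;> rintro (h | h | h | h | h) <;> simp [Set.mem_singleton_iff.1 h]
    have hrev : ∀ α β γ δ ε : Sym2 V, ({α, β, γ, δ, ε} : Set (Sym2 V)) = {δ, γ, β, α, ε} := by
      intros
      ext
      constructor <;> rintro (h | h | h | h | h) <;> simp [Set.mem_singleton_iff.1 h]
    have key : ∀ p q r s t : V, (x = p ∧ y = q ∨ x = q ∧ y = p) →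
        (G.Adj q r ∨ (x = q ∧ y = r ∨ x = r ∧ y = q)) →
        (G.Adj r s ∨ (x = r ∧ y = s ∨ x = s ∧ y = r)) →
        (G.Adj s t ∨ (x = s ∧ y = t ∨ x = t ∧ y = s)) →
        (G.Adj t p ∨ (x = t ∧ y = p ∨ x = p ∧ y = t)) →
        (q ≠ r ∧ q ≠ s ∧ q ≠ t ∧ q ≠ p ∧ r ≠ s ∧ r ≠ t ∧ r ≠ p ∧ s ≠ t ∧ s ≠ p ∧ t ≠ p) →
        ({s(v, a), s(a, b), s(b, c), s(c, d), s(d, v)} : Set (Sym2 V)) =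
          {s(q, r), s(r, s), s(s, t), s(t, p), s(p, q)} →
        ∃ a' b' c', IsPathOnFive G x a' b' c' y ∧
          ({s(v, a), s(a, b), s(b, c), s(c, d), s(d, v)} : Set (Sym2 V)) =
          {s(x, a'), s(a', b'), s(b', c'), s(c', y), s(y, x)} := by
      intro p q r s t e k1 k2 k3 k4 hk hS
      have hP : IsPathOnFive G q r s t p :=
        ⟨⟨k1.resolve_right (by grind), k2.resolve_right (by grind), k3.resolve_right (by grind),
          k4.resolve_right (by grind)⟩, hk⟩
      rcases e with ⟨rfl, rfl⟩ | ⟨rfl, rfl⟩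
      · refine ⟨t, s, r, hP.symm, ?_⟩
        rw [hS, Sym2.eq_swap (a := y) (b := r), Sym2.eq_swap (a := r) (b := s),
          Sym2.eq_swap (a := s) (b := t), Sym2.eq_swap (a := t) (b := x),
          Sym2.eq_swap (a := x) (b := y)]
        exact hrev ..
      · exact ⟨r, s, t, hP, hS⟩
    by_cases e5 : x = d ∧ y = v ∨ x = v ∧ y = d
    · exact key d v a b c e5 h1 h2 h3 h4 (by grind) rfl
    by_cases e1 : x = v ∧ y = a ∨ x = a ∧ y = v
    · exact key v a b c d e1 h2 h3 h4 h5 (by grind) (hrot ..)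
    by_cases e2 : x = a ∧ y = b ∨ x = b ∧ y = a
    · exact key a b c d v e2 h3 h4 h5 h1 (by grind) ((hrot ..).trans (hrot ..))
    by_cases e3 : x = b ∧ y = c ∨ x = c ∧ y = b
    · exact key b c d v a e3 h4 h5 h1 h2 (by grind)
        ((hrot ..).trans ((hrot ..).trans (hrot ..)))
    by_cases e4 : x = c ∧ y = d ∨ x = d ∧ y = c
    · exact key c d v a b e4 h5 h1 h2 h3 (by grind)
        ((hrot ..).trans ((hrot ..).trans ((hrot ..).trans (hrot ..))))
    exact absurd (h5.resolve_right e5) (h0 v a b c d ⟨⟨h1.resolve_right e1, h2.resolve_right e2,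
      h3.resolve_right e3, h4.resolve_right e4⟩, hd⟩)
  · rintro ⟨a, b, c, ⟨⟨h1, h2, h3, h4⟩, hd⟩, rfl⟩
    exact ⟨x, a, b, c, y, ⟨⟨.inl h1, .inl h2, .inl h3, .inl h4⟩, hd⟩,
      (hadj _ _).2 (by grind), rfl⟩

theorem uniquelyCSat_five_iff {V : Type*} (G : SimpleGraph V) :
    UniquelyCSat G 5 ↔
      (∀ x a b c y, IsPathOnFive G x a b c y → ¬ G.Adj y x) ∧
      (∀ x y, x ≠ y → ¬ G.Adj x y → ∃ a b c, IsPathOnFive G x a b c y) ∧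
      (∀ x y a b c a' b' c', IsPathOnFive G x a b c y → IsPathOnFive G x a' b' c' y →
        a = a' ∧ b = b' ∧ c = c') := by
  rw [UniquelyCSat, hasCycleOn_five_iff]
  have hneg : (¬ ∃ x a b c y, IsPathOnFive G x a b c y ∧ G.Adj y x) ↔
      ∀ x a b c y, IsPathOnFive G x a b c y → ¬ G.Adj y x := by
    push Not
    rfl
  rw [hneg]
  refine and_congr_right fun h0 => ?_
  constructor
  · intro h
    refine ⟨fun x y hxy hn => ?_, fun x y a b c a' b' c' hP hQ => ?_⟩
    · obtain ⟨S, hS, -⟩ := h x y hxy hn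
      obtain ⟨a, b, c, hP, -⟩ := (isCtEdgeSet_sup_five_iff h0 hxy S).1 hS
      exact ⟨a, b, c, hP⟩
    · have hxy : x ≠ y := hP.2.2.2.2.1
      have hS := (h x y hxy fun hh => h0 _ _ _ _ _ hP hh.symm).unique
        ((isCtEdgeSet_sup_five_iff h0 hxy _).2 ⟨a, b, c, hP, rfl⟩)
        ((isCtEdgeSet_sup_five_iff h0 hxy _).2 ⟨a', b', c', hQ, rfl⟩)
      have m1 : s(x, a) ∈ ({s(x, a'), s(a', b'), s(b', c'), s(c', y), s(y, x)} : Set _) := by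
        rw [← hS]; simp
      have m2 : s(a, b) ∈ ({s(x, a'), s(a', b'), s(b', c'), s(c', y), s(y, x)} : Set _) := by
        rw [← hS]; simp
      have m3 : s(c, y) ∈ ({s(x, a'), s(a', b'), s(b', c'), s(c', y), s(y, x)} : Set _) := by
        rw [← hS]; simp
      simp only [Set.mem_insert_iff, Set.mem_singleton_iff, Sym2.eq_iff] at m1 m2 m3
      have hP' := hP.2
      have hQ' := hQ.2
      have e1 : a = a' := by grind
      have e3 : c = c' := by grind
      have e2 : b = b' := by grind
      exact ⟨e1, e2, e3⟩
  · rintro ⟨h1, h2⟩ x y hxy hn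
    obtain ⟨a, b, c, hP⟩ := h1 x y hxy hn
    refine ⟨_, (isCtEdgeSet_sup_five_iff h0 hxy _).2 ⟨a, b, c, hP, rfl⟩, fun S hS => ?_⟩
    obtain ⟨a', b', c', hQ, rfl⟩ := (isCtEdgeSet_sup_five_iff h0 hxy S).1 hS
    obtain ⟨rfl, rfl, rfl⟩ := h2 x y a b c a' b' c' hP hQ
    rfl

theorem IsFriendship.uniquelyCSat_five {V : Type*} {G : SimpleGraph V} (h : IsFriendship G) :
    UniquelyCSat G 5 := by
  obtain ⟨z, hz, hm⟩ := h
  have hu : ∀ u v w : V, G.Adj u v → G.Adj v w → u ≠ w → u ≠ z → v ≠ z → w ≠ z → False :=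
    fun u v w huv hvw huw hu hv hw => huw ((hm v hv).unique ⟨hu, huv.symm⟩ ⟨hw, hvw⟩)
  have mid : ∀ x a b c y, IsPathOnFive G x a b c y → x ≠ z → y ≠ z → b = z := by
    rintro x a b c y ⟨⟨h1, h2, h3, h4⟩, hd⟩ hx hy
    by_contra hb
    have := hu x a b h1 h2
    have := hu b c y h3 h4
    grind
  rw [uniquelyCSat_five_iff]
  refine ⟨?_, ?_, ?_⟩
  · rintro x a b c y ⟨⟨h1, h2, h3, h4⟩, hd⟩ h5
    have := hu x a b h1 h2
    have := hu a b c h2 h3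
    have := hu b c y h3 h4
    have := hu c y x h4 h5
    have := hu y x a h5 h1
    grind +splitImp
  · intro x y hxy hn
    have hx : x ≠ z := by rintro rfl; exact hn (hz y hxy.symm)
    have hy : y ≠ z := by rintro rfl; exact hn (hz x hxy).symm
    obtain ⟨a, ⟨ha, hxa⟩, -⟩ := hm x hx
    obtain ⟨c, ⟨hc, hyc⟩, -⟩ := hm y hy
    have hac : a ≠ c := by rintro rfl; exact hu x a y hxa hyc.symm hxy hx ha hy
    refine ⟨a, z, c, ⟨hxa, (hz a ha).symm, hz c hc, hyc.symm⟩, ?_⟩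
    have := hxa.ne
    have := hyc.ne
    grind
  · intro x y a b c a' b' c' hP hQ
    have hxy := hP.2.2.2.2.1
    have aux : ∀ a b c y, IsPathOnFive G z a b c y → False := by
      rintro a b c y ⟨⟨h1, h2, h3, h4⟩, hd⟩
      have := hu a b c h2 h3
      grind
    have hx : x ≠ z := by rintro rfl; exact aux _ _ _ _ hP
    have hy : y ≠ z := by
      rintro rfl
      exact aux _ _ _ _ hP.symm
    obtain rfl := mid _ _ _ _ _ hP hx hy
    obtain rfl := mid _ _ _ _ _ hQ hx hy
    obtain ⟨⟨h1, h2, h3, h4⟩, hd⟩ := hP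
    obtain ⟨⟨k1, k2, k3, k4⟩, hd'⟩ := hQ
    exact ⟨(hm x hx).unique ⟨h2.ne, h1⟩ ⟨k2.ne, k1⟩, rfl,
      (hm y hy).unique ⟨h3.ne', h4.symm⟩ ⟨k3.ne', k4.symm⟩⟩

section Saturated

variable {V : Type*} {G : SimpleGraph V}

theorem exists_adj_boundary
    (h1 : ∀ x y, x ≠ y → ¬ G.Adj x y → ∃ a b c, IsPathOnFive G x a b c y)
    (P : V → Prop) {u v : V} (hu : P u) (hv : ¬ P v) : ∃ x y, P x ∧ ¬ P y ∧ G.Adj x y := by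
  by_contra! h
  by_cases ha : G.Adj u v
  · exact h u v hu hv ha
  · obtain ⟨a, b, c, ⟨ha, hb, hc, hd⟩, -⟩ := h1 u v (by rintro rfl; exact hv hu) ha
    grind

theorem eq_of_adj_of_adj_fourCycle
    (h0 : ∀ x a b c y, IsPathOnFive G x a b c y → ¬ G.Adj y x)
    (h2 : ∀ x y a b c a' b' c', IsPathOnFive G x a b c y → IsPathOnFive G x a' b' c' y →
        a = a' ∧ b = b' ∧ c = c')
    {a b c d e f : V} (hab : G.Adj a b) (hbc : G.Adj b c) (hcd : G.Adj c d) (hda : G.Adj d a)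
    (hac : a ≠ c) (hbd : b ≠ d) (hae : G.Adj a e) (heb : e ≠ b) (hec : e ≠ c) (hed : e ≠ d)
    (hef : G.Adj e f) : f = a := by
  by_contra hfa
  have := hab.ne
  have := hbc.ne
  have := hcd.ne
  have := hda.ne
  have := hae.ne
  have := hef.ne
  by_cases hfb : f = b
  · subst hfb
    exact h0 e a d c f ⟨⟨hae.symm, hda.symm, hcd.symm, hbc.symm⟩, by grind⟩ hef.symm
  by_cases hfd : f = d
  · subst hfd
    exact h0 e a b c f ⟨⟨hae.symm, hab, hbc, hcd⟩, by grind⟩ hef.symm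
  by_cases hfc : f = c
  · subst hfc
    have := h2 b e a d f f d a ⟨⟨hab.symm, hda.symm, hcd.symm, hef.symm⟩, by grind⟩
      ⟨⟨hbc, hcd, hda, hae⟩, by grind⟩
    grind
  · have := h2 c f b a e d a e ⟨⟨hbc.symm, hab.symm, hae, hef⟩, by grind⟩
      ⟨⟨hcd, hda, hae, hef⟩, by grind⟩
    grind

theorem eq_of_adj_fourCycle
    (h0 : ∀ x a b c y, IsPathOnFive G x a b c y → ¬ G.Adj y x)
    (h1 : ∀ x y, x ≠ y → ¬ G.Adj x y → ∃ a b c, IsPathOnFive G x a b c y)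
    (h2 : ∀ x y a b c a' b' c', IsPathOnFive G x a b c y → IsPathOnFive G x a' b' c' y →
        a = a' ∧ b = b' ∧ c = c')
    {a b c d e : V} (hab : G.Adj a b) (hbc : G.Adj b c) (hcd : G.Adj c d) (hda : G.Adj d a)
    (hac : a ≠ c) (hbd : b ≠ d) (hae : G.Adj a e) : e = b ∨ e = c ∨ e = d := by
  by_contra! hne
  obtain ⟨heb, hec, hed⟩ := hne
  have pend : ∀ f, G.Adj e f → f = a := fun f =>
    eq_of_adj_of_adj_fourCycle h0 h2 hab hbc hcd hda hac hbd hae heb hec hed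
  have := hab.ne
  have := hbc.ne
  have := hcd.ne
  have := hda.ne
  have := hae.ne
  obtain ⟨p, q, r, ⟨ep, pq, qr, rc⟩, hd⟩ := h1 e c hec fun h => hac (pend c h).symm
  obtain rfl := pend p ep
  have hq : q = b ∨ q = d := by
    by_contra! hq
    have := eq_of_adj_of_adj_fourCycle h0 h2 hab hbc hcd hda hac hbd pq hq.1 (by grind) hq.2 qr
    grind
  have hbd' : G.Adj b d := by
    rcases hq with rfl | rfl
    · by_cases hr : r = d
      · exact hr ▸ qr
      · have := eq_of_adj_of_adj_fourCycle h0 h2 hbc hcd hda hab hbd hac.symm qr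
          (by grind) hr (by grind) rc
        grind
    · by_cases hr : r = b
      · exact (hr ▸ qr).symm
      · have := eq_of_adj_of_adj_fourCycle h0 h2 hda hab hbc hcd hbd.symm hac qr
          (by grind) hr (by grind) rc
        grind
  have := h2 e c p b d p d b ⟨⟨ep, hab, hbd', hcd.symm⟩, by grind⟩
    ⟨⟨ep, hda.symm, hbd'.symm, hbc⟩, by grind⟩
  grind

theorem not_fourCycle [Fintype V] (hn : 5 ≤ Fintype.card V)
    (h0 : ∀ x a b c y, IsPathOnFive G x a b c y → ¬ G.Adj y x)
    (h1 : ∀ x y, x ≠ y → ¬ G.Adj x y → ∃ a b c, IsPathOnFive G x a b c y)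
    (h2 : ∀ x y a b c a' b' c', IsPathOnFive G x a b c y → IsPathOnFive G x a' b' c' y →
        a = a' ∧ b = b' ∧ c = c')
    {a b c d : V} (hab : G.Adj a b) (hbc : G.Adj b c) (hcd : G.Adj c d) (hda : G.Adj d a)
    (hac : a ≠ c) (hbd : b ≠ d) : False := by
  classical
  obtain ⟨v, hv⟩ : ∃ v, v ∉ ({a, b, c, d} : Finset V) := by
    by_contra! h
    have h3 := Finset.card_le_four (a := a) (b := b) (c := c) (d := d)
    rw [Finset.eq_univ_of_forall h, Finset.card_univ] at h3
    omega
  obtain ⟨x, y, hx, hy, hxy⟩ := exists_adj_boundary h1 (· ∈ ({a, b, c, d} : Finset V))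
    (u := a) (by simp) hv
  simp only [Finset.mem_insert, Finset.mem_singleton] at hx hy
  rcases hx with rfl | rfl | rfl | rfl
  · have := eq_of_adj_fourCycle h0 h1 h2 hab hbc hcd hda hac hbd hxy
    grind
  · have := eq_of_adj_fourCycle h0 h1 h2 hbc hcd hda hab hbd hac.symm hxy
    grind
  · have := eq_of_adj_fourCycle h0 h1 h2 hcd hda hab hbc hac.symm hbd.symm hxy
    grind
  · have := eq_of_adj_fourCycle h0 h1 h2 hda hab hbc hcd hbd.symm hac hxy
    grind

theorem not_sixCycle
    (h0 : ∀ x a b c y, IsPathOnFive G x a b c y → ¬ G.Adj y x)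
    (h1 : ∀ x y, x ≠ y → ¬ G.Adj x y → ∃ a b c, IsPathOnFive G x a b c y)
    (h2 : ∀ x y a b c a' b' c', IsPathOnFive G x a b c y → IsPathOnFive G x a' b' c' y →
        a = a' ∧ b = b' ∧ c = c')
    (h4 : ∀ a b c d, G.Adj a b → G.Adj b c → G.Adj c d → G.Adj d a → a ≠ c → b ≠ d → False)
    {a b c d e f : V} (hP : IsPathOnFive G a b c d e) (hef : G.Adj e f) (hfa : G.Adj f a)
    (hfb : f ≠ b) (hfc : f ≠ c) (hfd : f ≠ d) : False := by
  obtain ⟨⟨hab, hbc, hcd, hde⟩, hne⟩ := hP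
  have := hef.ne
  have := hfa.ne
  have out : ∀ a b c d e f x : V, G.Adj a b → G.Adj b c → G.Adj c d → G.Adj d e → G.Adj e f →
      G.Adj f a → [a, b, c, d, e, f, x].Nodup → ¬ G.Adj a x := by
    intro a b c d e f x hab hbc hcd hde hef hfa hnd hax
    simp only [List.nodup_cons, List.mem_cons, List.not_mem_nil, or_false, not_or] at hnd
    have := h2 x d a b c a f e ⟨⟨hax.symm, hab, hbc, hcd⟩, by grind⟩
      ⟨⟨hax.symm, hfa.symm, hef.symm, hde.symm⟩, by grind⟩
    grind
  have all : ∀ v, v = a ∨ v = b ∨ v = c ∨ v = d ∨ v = e ∨ v = f := by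
    by_contra! hv
    obtain ⟨v, hv⟩ := hv
    obtain ⟨x, y, hx, hy, hxy⟩ := exists_adj_boundary h1
      (fun v => v = a ∨ v = b ∨ v = c ∨ v = d ∨ v = e ∨ v = f) (u := a) (v := v) (by simp)
      (by simpa using hv)
    simp only [not_or] at hy
    rcases hx with rfl | rfl | rfl | rfl | rfl | rfl
    · refine out _ _ _ _ _ _ y hab hbc hcd hde hef hfa ?_ hxy
      simp only [List.nodup_cons, List.mem_cons, List.not_mem_nil]
      grind
    · refine out _ _ _ _ _ _ y hbc hcd hde hef hfa hab ?_ hxy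
      simp only [List.nodup_cons, List.mem_cons, List.not_mem_nil]
      grind
    · refine out _ _ _ _ _ _ y hcd hde hef hfa hab hbc ?_ hxy
      simp only [List.nodup_cons, List.mem_cons, List.not_mem_nil]
      grind
    · refine out _ _ _ _ _ _ y hde hef hfa hab hbc hcd ?_ hxy
      simp only [List.nodup_cons, List.mem_cons, List.not_mem_nil]
      grind
    · refine out _ _ _ _ _ _ y hef hfa hab hbc hcd hde ?_ hxy
      simp only [List.nodup_cons, List.mem_cons, List.not_mem_nil]
      grind
    · refine out _ _ _ _ _ _ y hfa hab hbc hcd hde hef ?_ hxy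
      simp only [List.nodup_cons, List.mem_cons, List.not_mem_nil]
      grind
  have nad : ¬ G.Adj a d := fun h => h4 a b c d hab hbc hcd h.symm (by grind) (by grind)
  have nac : ¬ G.Adj a c := fun h =>
    h0 a c d e f ⟨⟨h, hcd, hde, hef⟩, by grind⟩ hfa
  have nae : ¬ G.Adj a e := fun h =>
    h0 a b c d e ⟨⟨hab, hbc, hcd, hde⟩, by grind⟩ h.symm
  have nbd : ¬ G.Adj b d := fun h =>
    h0 a b d e f ⟨⟨hab, h, hde, hef⟩, by grind⟩ hfa
  have nfd : ¬ G.Adj f d := fun h =>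
    h0 a b c d f ⟨⟨hab, hbc, hcd, h.symm⟩, by grind⟩ hfa
  have nbf : ¬ G.Adj b f := fun h =>
    h0 b c d e f ⟨⟨hbc, hcd, hde, hef⟩, by grind⟩ h.symm
  have nce : ¬ G.Adj c e := fun h =>
    h0 a b c e f ⟨⟨hab, hbc, h, hef⟩, by grind⟩ hfa
  obtain ⟨p, q, r, ⟨k1, k2, k3, k4⟩, hk⟩ := h1 a d (by grind) nad
  have hp := all p
  have hq := all q
  have hr := all r
  clear h0 h1 h2 h4 out all
  have hp : p = b ∨ p = f := by grind
  have hr : r = c ∨ r = e := by grind [SimpleGraph.adj_comm]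
  grind [SimpleGraph.adj_comm]

theorem exists_triangles_of_not_adj
    (h1 : ∀ x y, x ≠ y → ¬ G.Adj x y → ∃ a b c, IsPathOnFive G x a b c y)
    (h4 : ∀ a b c d, G.Adj a b → G.Adj b c → G.Adj c d → G.Adj d a → a ≠ c → b ≠ d → False)
    (h6 : ∀ a b c d e f, IsPathOnFive G a b c d e → G.Adj e f → G.Adj f a → f ≠ b → f ≠ c →
      f ≠ d → False)
    {x y z : V} (hxy : x ≠ y) (hn : ¬ G.Adj x y) (hzx : G.Adj z x) (hzy : G.Adj z y) :
    ∃ a c, G.Adj z a ∧ G.Adj x a ∧ G.Adj z c ∧ G.Adj y c := by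
  obtain ⟨a, b, c, hP⟩ := h1 x y hxy hn
  have h := h6 x a b c y z hP hzy.symm hzx
  obtain ⟨⟨k1, k2, k3, k4⟩, hk⟩ := hP
  have hza : z ≠ a := by
    rintro rfl
    exact h4 z b c y k2 k3 k4 hzy.symm (by grind) (by grind)
  have hzc : z ≠ c := by
    rintro rfl
    exact h4 x a b z k1 k2 k3 hzx (by grind) (by grind)
  have hzb : z = b := by
    by_contra hzb
    exact h hza hzb hzc
  subst hzb
  exact ⟨a, c, k2.symm, k1, k3, k4.symm⟩

theorem exists_common_neighbor
    (h1 : ∀ x y, x ≠ y → ¬ G.Adj x y → ∃ a b c, IsPathOnFive G x a b c y)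
    (h4 : ∀ a b c d, G.Adj a b → G.Adj b c → G.Adj c d → G.Adj d a → a ≠ c → b ≠ d → False)
    (h6 : ∀ a b c d e f, IsPathOnFive G a b c d e → G.Adj e f → G.Adj f a → f ≠ b → f ≠ c →
      f ≠ d → False)
    (hc : ∀ x y : V, ∃ z, z ≠ x ∧ z ≠ y)
    {z x : V} (hzx : G.Adj z x) : ∃ a, G.Adj z a ∧ G.Adj x a := by
  by_contra! h
  obtain ⟨w, hwz, hwx⟩ := hc z x
  obtain ⟨u, v, hu, hv, huv⟩ := exists_adj_boundary h1 (fun v => v = z ∨ v = x) (u := z) (v := w)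
    (by simp) (by simp [hwz, hwx])
  simp only [not_or] at hv
  rcases hu with rfl | rfl
  · obtain ⟨a, -, k1, k2, -, -⟩ := exists_triangles_of_not_adj h1 h4 h6 (Ne.symm hv.2)
      (h v huv) hzx huv
    exact h a k1 k2
  · obtain ⟨a, -, k1, k2, -, -⟩ := exists_triangles_of_not_adj h1 h4 h6 (Ne.symm hv.1)
      (fun k => h v k huv) hzx.symm huv
    exact h a k2 k1

theorem exists_common_neighbor_of_not_adj
    (h1 : ∀ x y, x ≠ y → ¬ G.Adj x y → ∃ a b c, IsPathOnFive G x a b c y)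
    (h2 : ∀ x y a b c a' b' c', IsPathOnFive G x a b c y → IsPathOnFive G x a' b' c' y →
        a = a' ∧ b = b' ∧ c = c')
    (ht : ∀ z x, G.Adj z x → ∃ a, G.Adj z a ∧ G.Adj x a)
    {x y : V} (hxy : x ≠ y) (hn : ¬ G.Adj x y) : ∃ z, G.Adj x z ∧ G.Adj z y := by
  have no3 : ∀ x y, ¬ G.Adj x y → (∀ z, G.Adj x z → ¬ G.Adj z y) →
      ∀ a b, G.Adj x a → G.Adj a b → G.Adj b y → x ≠ b → x ≠ y → False := by
    intro x y hn hcn a b hxa hab hby hxb hxy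
    obtain ⟨p, hxp, hap⟩ := ht x a hxa
    obtain ⟨q, haq, hbq⟩ := ht a b hab
    have := hxa.ne
    have := hab.ne
    have := hby.ne
    have := hxp.ne
    have := hap.ne
    have := haq.ne
    have := hbq.ne
    have hay : a ≠ y := by rintro rfl; exact hn hxa
    have hqy : q ≠ y := by rintro rfl; exact hcn a hxa haq
    have hqx : q ≠ x := by rintro rfl; exact hcn b hbq.symm hby
    have hpb : p ≠ b := by rintro rfl; exact hcn p hxp hby
    have hpy : p ≠ y := by rintro rfl; exact hn hxp
    have := h2 x y p a b a q b ⟨⟨hxp, hap.symm, hab, hby⟩, by grind⟩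
      ⟨⟨hxa, haq, hbq.symm, hby⟩, by grind⟩
    grind
  by_contra! hcn
  obtain ⟨p, q, r, ⟨k1, k2, k3, k4⟩, hk⟩ := h1 x y hxy hn
  refine no3 p y (hcn p k1) (fun s hps hsy => ?_) q r k2 k3 k4 (by grind) (by grind)
  refine no3 x y hn hcn p s k1 hps hsy ?_ hxy
  rintro rfl
  exact hn hsy

theorem adj_of_triangle_of_adj
    (h0 : ∀ x a b c y, IsPathOnFive G x a b c y → ¬ G.Adj y x)
    (h4 : ∀ a b c d, G.Adj a b → G.Adj b c → G.Adj c d → G.Adj d a → a ≠ c → b ≠ d → False)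
    (hd : ∀ x y, x ≠ y → ¬ G.Adj x y → ∃ z, G.Adj x z ∧ G.Adj z y)
    {z x x' y : V} (hx : G.Adj z x) (hx' : G.Adj z x') (hxx : G.Adj x x') (hy : G.Adj z y)
    (hyx : y ≠ x) (hyx' : y ≠ x') {w : V} (hw : w ≠ z) : G.Adj z w := by
  by_contra hzw
  obtain ⟨u, hzu, huw⟩ := hd z w hw.symm hzw
  obtain ⟨v, hzv, hvu, hnvu⟩ : ∃ v, G.Adj z v ∧ v ≠ u ∧ ¬ G.Adj v u := by
    by_cases hux : u = x
    · exact ⟨y, hy, by grind, fun h => h4 z y x x' hy (hux ▸ h) hxx hx'.symm hx.ne hyx'⟩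
    by_cases hux' : u = x'
    · exact ⟨y, hy, by grind, fun h => h4 z y x' x hy (hux' ▸ h) hxx.symm hx.symm hx'.ne hyx⟩
    · exact ⟨x, hx, Ne.symm hux, fun h => h4 z u x x' hzu h.symm hxx hx'.symm hx.ne hux'⟩
  have hvw : v ≠ w := by rintro rfl; exact hzw hzv
  obtain ⟨t, hvt, htw⟩ := hd v w hvw fun h => h4 z v w u hzv h huw.symm hzu.symm hw.symm hvu
  have htz : t ≠ z := by rintro rfl; exact hzw htw
  have htu : t ≠ u := by rintro rfl; exact hnvu hvt
  have := hzu.ne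
  have := huw.ne
  have := hzv.ne
  have := hvt.ne
  have := htw.ne
  exact h0 z u w t v ⟨⟨hzu, huw, htw.symm, hvt.symm⟩, by grind⟩ hzv.symm

end Saturated

theorem UniquelyCSat.isFriendship {V : Type*} [Fintype V] {G : SimpleGraph V}
    (hn : 5 ≤ Fintype.card V) (h : UniquelyCSat G 5) : IsFriendship G := by
  classical
  obtain ⟨h0, h1, h2⟩ := (uniquelyCSat_five_iff G).1 h
  have h4 : ∀ a b c d, G.Adj a b → G.Adj b c → G.Adj c d → G.Adj d a → a ≠ c → b ≠ d → False :=
    fun _ _ _ _ => not_fourCycle hn h0 h1 h2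
  have h6 : ∀ a b c d e f, IsPathOnFive G a b c d e → G.Adj e f → G.Adj f a → f ≠ b → f ≠ c →
      f ≠ d → False := fun _ _ _ _ _ _ => not_sixCycle h0 h1 h2 h4
  have hout : ∀ x y z : V, ∃ w, w ≠ x ∧ w ≠ y ∧ w ≠ z := by
    intro x y z
    by_contra! hw
    have hle := Finset.card_le_three (a := x) (b := y) (c := z)
    rw [Finset.eq_univ_of_forall (s := {x, y, z}), Finset.card_univ] at hle
    · omega
    · intro w
      have := hw w
      simp only [Finset.mem_insert, Finset.mem_singleton]
      tauto
  have ht : ∀ z x, G.Adj z x → ∃ a, G.Adj z a ∧ G.Adj x a := fun z x =>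
    exists_common_neighbor h1 h4 h6 fun x y => (hout x y y).imp fun _ hw => ⟨hw.1, hw.2.1⟩
  have hd : ∀ x y, x ≠ y → ¬ G.Adj x y → ∃ z, G.Adj x z ∧ G.Adj z y := fun _ _ =>
    exists_common_neighbor_of_not_adj h1 h2 ht
  obtain ⟨z, hz⟩ : ∃ z, ∀ v, v ≠ z → G.Adj z v := by
    obtain ⟨v⟩ : Nonempty V := Fintype.card_pos_iff.1 (by omega)
    obtain ⟨w, hw, -⟩ := hout v v v
    obtain ⟨p, q, hp, -, hpq⟩ := exists_adj_boundary h1 (· = v) rfl hw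
    obtain ⟨r, hpr, hqr⟩ := ht p q hpq
    obtain ⟨s, hs⟩ := hout p q r
    obtain ⟨z, y, hzm, hym, hzy⟩ := exists_adj_boundary h1 (fun v => v = p ∨ v = q ∨ v = r)
      (u := p) (v := s) (by simp) (by simpa using hs)
    simp only [not_or] at hym
    refine ⟨z, fun v hv => ?_⟩
    rcases hzm with rfl | rfl | rfl
    · exact adj_of_triangle_of_adj h0 h4 hd hpq hpr hqr hzy hym.2.1 hym.2.2 hv
    · exact adj_of_triangle_of_adj h0 h4 hd hpq.symm hqr hpr hzy hym.1 hym.2.2 hv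
    · exact adj_of_triangle_of_adj h0 h4 hd hpr.symm hqr.symm hpq hzy hym.1 hym.2.1 hv
  refine ⟨z, hz, fun v hv => ?_⟩
  obtain ⟨a, hza, hva⟩ := ht z v (hz v hv)
  refine ⟨a, ⟨hza.ne', hva⟩, fun b ⟨hbz, hvb⟩ => ?_⟩
  by_contra hba
  exact h4 z b v a (hz b hbz) hvb.symm hva hza.symm hv.symm hba

/-- A graph with at least five vertices is uniquely `C_5`-saturated if and only if it
is a friendship graph. -/
theorem stmt_10 {V : Type*} [Fintype V] (G : SimpleGraph V)
    (hn : 5 ≤ Fintype.card V) :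
    UniquelyCSat G 5 ↔ IsFriendship G :=
  ⟨UniquelyCSat.isFriendship hn, IsFriendship.uniquelyCSat_five⟩
end

section
/- For t ≥ 6, there are only finitely many uniquely C_t-saturated graphs (up to isomorphism). -/
open SimpleGraph

/-- `x :: l` lists the vertices of a walk of `G` from `x` to `y`; its length is `l.length`. -/
def ListWalk {V : Type*} (G : SimpleGraph V) : V → List V → V → Prop
  | x, [], y => x = y
  | x, a :: l, y => G.Adj x a ∧ ListWalk G a l y

/-- `x :: l` lists the vertices of a path of `G` from `x` to `y`; its length is `l.length`. -/
def ListPath {V : Type*} (G : SimpleGraph V) (x : V) (l : List V) (y : V) : Prop :=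
  ListWalk G x l y ∧ (x :: l).Nodup

/-- The vertices, other than its first one, of the reversal of the walk listed by `x :: l`. -/
def revTail {V : Type*} : V → List V → List V
  | _, [] => []
  | x, a :: l => revTail a l ++ [x]

section Lists

variable {V : Type*} {G : SimpleGraph V} {x y z a b : V} {l p q l₁ l₂ l₃ l₄ : List V}

@[simp] lemma listWalk_nil : ListWalk G x [] y ↔ x = y := Iff.rfl

@[simp] lemma listWalk_cons : ListWalk G x (a :: l) y ↔ G.Adj x a ∧ ListWalk G a l y := Iff.rfl

lemma listWalk_append :
    ListWalk G x (l₁ ++ l₂) z ↔ ∃ y, ListWalk G x l₁ y ∧ ListWalk G y l₂ z := by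
  induction l₁ generalizing x with
  | nil => simp
  | cons a l ih => simp [ih, and_assoc]

lemma ListWalk.append (h₁ : ListWalk G x l₁ y) (h₂ : ListWalk G y l₂ z) :
    ListWalk G x (l₁ ++ l₂) z := listWalk_append.2 ⟨y, h₁, h₂⟩

lemma ListWalk.end_unique (h₁ : ListWalk G x l y) (h₂ : ListWalk G x l z) : y = z := by
  induction l generalizing x with
  | nil => exact h₁.symm.trans h₂
  | cons a l ih => exact ih h₁.2 h₂.2

lemma ListWalk.end_mem (h : ListWalk G x l y) : y ∈ x :: l := by
  induction l generalizing x with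
  | nil => simp [listWalk_nil.1 h]
  | cons a l ih => exact List.mem_cons_of_mem _ (ih h.2)

lemma ListWalk.reverse_eq (h : ListWalk G x l y) : y :: revTail x l = (x :: l).reverse := by
  induction l generalizing x with
  | nil => simp [revTail, listWalk_nil.1 h]
  | cons a l ih => rw [List.reverse_cons, ← ih h.2]; simp [revTail]

lemma ListWalk.reverse (h : ListWalk G x l y) : ListWalk G y (revTail x l) x := by
  induction l generalizing x with
  | nil => exact (listWalk_nil.1 h).symm
  | cons a l ih => exact (ih h.2).append ⟨h.1.symm, rfl⟩

@[simp] lemma length_revTail : (revTail x l).length = l.length := by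
  induction l generalizing x with
  | nil => rfl
  | cons a l ih => simp [revTail, ih]

lemma ListPath.reverse (h : ListPath G x l y) : ListPath G y (revTail x l) x :=
  ⟨h.1.reverse, by rw [h.1.reverse_eq]; exact List.nodup_reverse.2 h.2⟩

lemma ListPath.mem_reverse (h : ListPath G x l y) : a ∈ y :: revTail x l ↔ a ∈ x :: l := by
  rw [h.1.reverse_eq, List.mem_reverse]

lemma ListPath.mem_revTail (h : ListPath G x l y) : a ∈ revTail x l ↔ a ∈ x :: l ∧ a ≠ y := by
  have h1 := h.mem_reverse (a := a)
  have h2 := h.reverse.2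
  grind

lemma listPath_nil : ListPath G x [] x := ⟨rfl, by simp⟩

lemma ListPath.start_notMem (h : ListPath G x l y) : x ∉ l := (List.nodup_cons.1 h.2).1

lemma ListPath.end_mem (h : ListPath G x l y) : y ∈ x :: l := h.1.end_mem

lemma ListPath.end_mem_of_ne (h : ListPath G x l y) (hn : x ≠ y) : y ∈ l := by
  have := h.end_mem
  grind

lemma ListPath.length_pos (h : ListPath G x l y) (hn : x ≠ y) : 0 < l.length :=
  List.length_pos_of_mem (h.end_mem_of_ne hn)

lemma ListPath.end_mem_of_pos (h : ListPath G x l y) (hn : 0 < l.length) : y ∈ l := by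
  rcases l with - | ⟨a, l⟩
  · simp at hn
  · exact h.1.2.end_mem

lemma ListPath.ne_of_pos (h : ListPath G x l y) (hn : 0 < l.length) : x ≠ y := by
  have h1 := h.end_mem_of_pos hn
  have h2 := h.start_notMem
  grind

lemma listPath_cons : ListPath G x (a :: l) y ↔ G.Adj x a ∧ ListPath G a l y ∧ x ∉ a :: l := by
  simp only [ListPath, listWalk_cons, List.nodup_cons (a := x)]
  tauto

lemma ListPath.cons (h : ListPath G a l y) (hadj : G.Adj x a) (hx : x ∉ a :: l) :
    ListPath G x (a :: l) y := listPath_cons.2 ⟨hadj, h, hx⟩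

lemma ListPath.append (h₁ : ListPath G x l₁ y) (h₂ : ListPath G y l₂ z)
    (h : ∀ c ∈ l₂, c ∉ x :: l₁) : ListPath G x (l₁ ++ l₂) z := by
  refine ⟨h₁.1.append h₂.1, ?_⟩
  have h3 := h₁.2
  have h4 := h₂.2
  rw [← List.cons_append, List.nodup_append]
  grind

lemma ListPath.split (h : ListPath G x (l₁ ++ l₂) z) :
    ∃ y, ListPath G x l₁ y ∧ ListPath G y l₂ z ∧ ∀ c ∈ l₂, c ∉ x :: l₁ := by
  obtain ⟨y, h1, h2⟩ := listWalk_append.1 h.1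
  have h3 := h.2
  rw [← List.cons_append, List.nodup_append] at h3
  have h4 := h1.end_mem
  refine ⟨y, ⟨h1, h3.1⟩, ⟨h2, ?_⟩, ?_⟩ <;> grind

lemma ListPath.split_at (h : ListPath G x l y) (ha : a ∈ x :: l) :
    ∃ l₁ l₂, l = l₁ ++ l₂ ∧ ListPath G x l₁ a ∧ ListPath G a l₂ y ∧ ∀ c ∈ l₂, c ∉ x :: l₁ := by
  rcases List.mem_cons.1 ha with rfl | ha
  · exact ⟨[], l, rfl, listPath_nil, h, by have := h.2; grind⟩
  · obtain ⟨s, t, rfl⟩ := List.append_of_mem ha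
    have h' : ListPath G x ((s ++ [a]) ++ t) y := by simpa using h
    obtain ⟨c, h1, h2, h3⟩ := h'.split
    obtain ⟨d, -, h5⟩ := listWalk_append.1 h1.1
    obtain rfl : a = c := h5.2
    exact ⟨s ++ [a], t, by simp, h1, h2, h3⟩

lemma ListPath.split_length (h : ListPath G x l y) {n : ℕ} (hn : n ≤ l.length) :
    ∃ l₁ l₂ c, l = l₁ ++ l₂ ∧ l₁.length = n ∧ ListPath G x l₁ c ∧ ListPath G c l₂ y ∧
      ∀ c ∈ l₂, c ∉ x :: l₁ := by
  have h' : ListPath G x (l.take n ++ l.drop n) y := by simpa using h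
  obtain ⟨c, h1, h2, h3⟩ := h'.split
  exact ⟨l.take n, l.drop n, c, by simp, by simpa using hn, h1, h2, h3⟩

lemma ListPath.append_inj (h : ListPath G x (l₁ ++ l₂) z) (he : l₁ ++ l₂ = l₃ ++ l₄)
    (h₁ : ListWalk G x l₁ y) (h₃ : ListWalk G x l₃ y) : l₁ = l₃ ∧ l₂ = l₄ := by
  have aux : ∀ (l c r : List V), ListPath G x (l ++ c ++ r) z → ListWalk G x l y →
      ListWalk G x (l ++ c) y → c = [] := by
    intro l c r hp hl hlc
    obtain ⟨d, hd, -⟩ := hp.split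
    obtain ⟨e, he1, he2, -⟩ := hd.split
    obtain rfl := he1.1.end_unique hl
    obtain rfl := hd.1.end_unique hlc
    by_contra hc
    exact he2.ne_of_pos (List.length_pos_iff.2 hc) rfl
  rcases List.append_eq_append_iff.1 he with ⟨c, rfl, rfl⟩ | ⟨c, rfl, rfl⟩
  · have := aux l₁ c l₄ (by simpa using h) h₁ h₃
    simp [this]
  · have := aux l₃ c l₂ h h₃ h₁
    simp [this]

end Lists

/-- Paths of length `k` are determined by their ends, and any two distinct non-adjacent vertices
are the ends of a path of length `k`. -/
structure PathSystem {V : Type*} (G : SimpleGraph V) (k : ℕ) : Prop where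
  unique : ∀ {x y p q}, ListPath G x p y → ListPath G x q y → p.length = k → q.length = k → p = q
  exists_path : ∀ {x y}, x ≠ y → ¬ G.Adj x y → ∃ p, ListPath G x p y ∧ p.length = k

/-- Every vertex eventually disappears from the sequence `u`. -/
def FreeSeq {V ι : Type*} (U : Ultrafilter ι) (u : ι → V) : Prop := ∀ x, ∀ᶠ j in U, u j ≠ x

/-- Every vertex eventually disappears from the lists `L j`. -/
def FreeLists {V ι : Type*} (U : Ultrafilter ι) (L : ι → List V) : Prop :=
  ∀ x, ∀ᶠ j in U, x ∉ L j

section Ultra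

variable {V ι : Type*} {U : Ultrafilter ι} {u : ι → V} {L : ι → List V}

lemma eventually_forall_mem_list {α : Type*} (F : List α) {P : α → ι → Prop}
    (h : ∀ a ∈ F, ∀ᶠ j in U, P a j) : ∀ᶠ j in U, ∀ a ∈ F, P a j := by
  induction F with
  | nil => simp
  | cons a F ih =>
    filter_upwards [h a (by simp), ih fun b hb => h b (by simp [hb])] with j h1 h2
    simpa using ⟨h1, h2⟩

lemma FreeSeq.avoid (h : FreeSeq U u) (F : List V) : ∀ᶠ j in U, u j ∉ F := by
  filter_upwards [eventually_forall_mem_list F fun a _ => h a] with j hj hm using hj _ hm rfl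

lemma FreeLists.avoid (h : FreeLists U L) (F : List V) : ∀ᶠ j in U, ∀ a ∈ L j, a ∉ F := by
  filter_upwards [eventually_forall_mem_list F fun a _ => h a] with j hj a ha hF using hj a hF ha

lemma eventually_exists_le {P : ℕ → ι → Prop} (N : ℕ)
    (h : ∀ᶠ j in U, ∃ n ≤ N, P n j) : ∃ n ≤ N, ∀ᶠ j in U, P n j := by
  by_contra! hc
  have h2 : ∀ n ∈ List.range (N + 1), ∀ᶠ j in U, ¬ P n j := fun n hn =>
    hc n (by simpa [Nat.lt_succ_iff] using hn)
  obtain ⟨j, ⟨n, hn, hP⟩, h4⟩ := (h.and (eventually_forall_mem_list _ h2)).exists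
  exact h4 n (by simpa [Nat.lt_succ_iff] using hn) hP

lemma eventually_const (f : ι → ℕ) (N : ℕ) (h : ∀ᶠ j in U, f j ≤ N) :
    ∃ n ≤ N, ∀ᶠ j in U, f j = n :=
  eventually_exists_le N (h.mono fun j hj => ⟨f j, hj, rfl⟩)

lemma eventually_choose {α : ι → Type*} [∀ i, Nonempty (α i)] {P : ∀ i, α i → Prop}
    (h : ∀ᶠ i in U, ∃ a, P i a) : ∃ f : ∀ i, α i, ∀ᶠ i in U, P i (f i) := by
  classical
  exact ⟨fun i => Classical.epsilon (P i), h.mono fun i hi => Classical.epsilon_spec hi⟩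

/-- A family of lists of bounded length is free away from a finite list. -/
lemma exists_free_away (A : ι → List V) (N : ℕ) (h : ∀ᶠ j in U, (A j).length ≤ N) :
    ∃ C : List V, ∀ x ∉ C, ∀ᶠ j in U, x ∉ A j := by
  induction N generalizing A with
  | zero =>
    refine ⟨[], fun x _ => h.mono fun j hj => ?_⟩
    simp [List.length_eq_zero_iff.1 (Nat.le_zero.1 hj)]
  | succ N ih =>
    obtain ⟨C, hC⟩ := ih (fun j => (A j).tail) (h.mono fun j hj => by simpa using hj)
    by_cases hc : ∃ c, ∀ᶠ j in U, (A j).head? = some c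
    · obtain ⟨c, hc⟩ := hc
      refine ⟨c :: C, fun x hx => ?_⟩
      filter_upwards [hc, hC x (by grind)] with j h1 h2
      cases hA : A j <;> grind
    · push Not at hc
      refine ⟨C, fun x hx => ?_⟩
      filter_upwards [hc x, hC x hx] with j h1 h2
      cases hA : A j <;> grind

end Ultra

section PathSystems

variable {V ι : Type*} {G : SimpleGraph V} {k : ℕ} {U : Ultrafilter ι} {u y z : ι → V}

lemma PathSystem.not_adj_of_free (H : PathSystem G k) (hk : 3 ≤ k) (hy : FreeSeq U y) :
    ∀ᶠ i in U, ∀ᶠ j in U, ¬ G.Adj (y i) (y j) := by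
  by_contra hc
  rw [← Ultrafilter.eventually_not] at hc
  have hgood : ∀ᶠ i in U, ∀ᶠ j in U, G.Adj (y i) (y j) := by
    filter_upwards [hc] with i hi
    rw [← Ultrafilter.eventually_not] at hi
    simpa using hi
  have hpath : ∀ n a, (∀ᶠ j in U, G.Adj a (y j)) → ∀ F : List V, ∃ l b, ListPath G a l b ∧
      (∀ᶠ j in U, G.Adj b (y j)) ∧ l.length = n ∧ ∀ x ∈ l, x ∉ F := by
    intro n
    induction n with
    | zero => exact fun a ha F => ⟨[], a, listPath_nil, ha, rfl, by simp⟩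
    | succ n ih =>
      intro a ha F
      obtain ⟨j, h1, h2, h3⟩ := (hgood.and (ha.and (hy.avoid (a :: F)))).exists
      obtain ⟨l, b, h4, h5, h6, h7⟩ := ih (y j) h1 (a :: F)
      exact ⟨y j :: l, b, h4.cons h2 (by grind), h5, by simp [h6], by grind⟩
  obtain ⟨i, hi⟩ := hgood.exists
  obtain ⟨p, b, hp, hb, hl, -⟩ := hpath (k - 2) (y i) hi []
  obtain ⟨c, hc1, hc2⟩ := (hgood.and (hy.avoid (y i :: p))).exists
  have key : ∀ᶠ j in U, ListPath G (y i) (p ++ [y j, y c]) (y c) := by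
    filter_upwards [hb, hc1, hy.avoid (y c :: y i :: p)] with j h1 h2 h3
    refine hp.append (z := y c) ((listPath_nil.cons h2.symm (by grind)).cons h1 ?_) ?_
    · have := hp.end_mem
      grind
    · grind
  obtain ⟨j, hj⟩ := key.exists
  obtain ⟨j', hj', hne⟩ := (key.and (hy (y j))).exists
  have := H.unique hj hj' (by simp; omega) (by simp; omega)
  simp at this
  exact hne this.symm

/-- The stable initial part of a family of paths of length `k` with a common start. -/
lemma PathSystem.exists_stable (H : PathSystem G k) {s : V} {Q : ι → List V}
    (hQ : ∀ᶠ j in U, ListPath G s (Q j) (z j) ∧ (Q j).length = k) :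
    ∃ w R, ∃ L : ι → List V, FreeLists U L ∧ ListPath G s R w ∧
      ∀ᶠ j in U, Q j = R ++ L j := by
  classical
  let P : ℕ → Prop := fun n => ∃ w, ∀ᶠ j in U, ListWalk G s ((Q j).take n) w
  have hP0 : P 0 := ⟨s, by simp⟩
  let n := Nat.findGreatest P k
  have hnk : n ≤ k := Nat.findGreatest_le k
  obtain ⟨w, hw⟩ : P n := Nat.findGreatest_spec (Nat.zero_le k) hP0
  have hfree : FreeLists U fun j => (Q j).drop n := by
    intro x
    by_contra hx
    rw [← Ultrafilter.eventually_not] at hx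
    obtain ⟨c, hck, hc⟩ := eventually_exists_le (U := U)
      (P := fun c j => n < c ∧ ListWalk G s ((Q j).take c) x) k (by
        filter_upwards [hx, hQ] with j h1 h2
        obtain ⟨a, b, hab⟩ := List.append_of_mem (not_not.1 h1)
        have e : Q j = ((Q j).take n ++ a ++ [x]) ++ b := by
          conv_lhs => rw [← List.take_append_drop n (Q j), hab]
          simp
        have hl : ((Q j).take n ++ a ++ [x]).length = n + a.length + 1 := by
          simp; omega
        have hle : n + a.length + 1 ≤ k := by
          rw [← h2.2, e, ← hl]; simp
        refine ⟨n + a.length + 1, hle, by omega, ?_⟩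
        rw [e, List.take_left' hl]
        have h3 := h2.1
        rw [e] at h3
        obtain ⟨d, hd, -⟩ := h3.split
        obtain ⟨d', -, hd'⟩ := listWalk_append.1 hd.1
        obtain rfl : x = d := hd'.2
        exact hd.1)
    have h1 : n < c := hc.exists.choose_spec.1
    have h2 : c ≤ n := Nat.le_findGreatest hck ⟨x, hc.mono fun j hj => hj.2⟩
    omega
  obtain ⟨j₀, h1, h2, h3⟩ := (hw.and hQ).exists
  have hR : ListPath G s ((Q j₀).take n) w := by
    rw [← List.take_append_drop n (Q j₀)] at h2
    obtain ⟨d, hd, -⟩ := h2.split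
    rwa [← hd.1.end_unique h1]
  refine ⟨w, (Q j₀).take n, fun j => (Q j).drop n, hfree, hR, ?_⟩
  filter_upwards [hQ, hw, hfree.avoid (s :: (Q j₀).take n)] with j h4 h5 h6
  have h7 := h4.1
  rw [← List.take_append_drop n (Q j)] at h7
  obtain ⟨d, hd1, hd2, -⟩ := h7.split
  rw [hd1.1.end_unique h5] at hd2
  exact H.unique h4.1 (hR.append hd2 h6) h4.2 (by simp; omega)

/-- `v` starts paths of length `e` avoiding any given finite set. -/
def Stub {V : Type*} (G : SimpleGraph V) (v : V) (e : ℕ) : Prop :=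
  ∀ F : List V, ∃ l b, ListPath G v l b ∧ l.length = e ∧ ∀ x ∈ l, x ∉ F

lemma PathSystem.exists_rooted (H : PathSystem G k) (hk : 3 ≤ k) (hy : FreeSeq U y) :
    ∀ᶠ i in U, ∃ w R, ∃ L : ι → List V, FreeLists U L ∧ ListPath G (y i) R w ∧
      ∀ᶠ j in U, ListPath G w (L j) (y j) ∧ ListPath G (y i) (R ++ L j) (y j) ∧
        R.length + (L j).length = k := by
  filter_upwards [H.not_adj_of_free hk hy] with i hi
  obtain ⟨Q, hQ⟩ := eventually_choose (U := U)
    (P := fun j (q : List V) => ListPath G (y i) q (y j) ∧ q.length = k) (by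
      filter_upwards [hi, hy (y i)] with j h1 h2
      exact H.exists_path h2.symm h1)
  obtain ⟨w, R, L, hL, hR, hQL⟩ := H.exists_stable hQ
  refine ⟨w, R, L, hL, hR, ?_⟩
  filter_upwards [hQ, hQL] with j h1 h2
  rw [h2] at h1
  obtain ⟨d, hd1, hd2, -⟩ := h1.1.split
  rw [hd1.1.end_unique hR.1] at hd2
  exact ⟨hd2, h1.1, by simpa using h1.2⟩

lemma PathSystem.exists_half (H : PathSystem G k) {v : V}
    (h : ∀ᶠ i in U, ∃ R, ∃ L : ι → List V, FreeLists U L ∧ ListPath G (y i) R v ∧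
      ∀ᶠ j in U, ListPath G v (L j) (y j) ∧ ListPath G (y i) (R ++ L j) (y j) ∧
        R.length + (L j).length = k) :
    ∃ m, k = 2 * m ∧ ∃ L : ι → List V, FreeLists U L ∧
      ∀ᶠ j in U, ListPath G v (L j) (y j) ∧ (L j).length = m := by
  obtain ⟨R, hR⟩ := eventually_choose (U := U) h
  obtain ⟨p, hpk, hp⟩ := eventually_const (U := U) (fun i => (R i).length) k (by
    filter_upwards [hR] with i hi
    obtain ⟨L, -, -, h1⟩ := hi
    obtain ⟨j, hj⟩ := h1.exists
    omega)
  obtain ⟨C, hC⟩ := exists_free_away (U := U) (fun j => y j :: R j) (p + 1) (by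
    filter_upwards [hp] with j hj
    simp [hj])
  obtain ⟨h₀, ⟨L, hL, hRv, hall⟩, hp₀⟩ := (hR.and hp).exists
  have hi0 : ∀ᶠ i in U, ListPath G v (L i) (y i) ∧ (L i).length = k - p ∧ ∀ a ∈ L i, a ∉ C := by
    filter_upwards [hall, hL.avoid C] with i h1 h2
    exact ⟨h1.1, by omega, h2⟩
  obtain ⟨i, ⟨hi1, hi2, hi3⟩, ⟨Li, hLi, hRi, halli⟩, hpi⟩ := (hi0.and (hR.and hp)).exists
  have hj := eventually_forall_mem_list (U := U) (L i) fun a ha => hC a (hi3 a ha)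
  obtain ⟨j, hj, ⟨Lj, hLj, hRj, -⟩, hpj, hj1, hj2, hj3⟩ :=
    (hj.and (hR.and (hp.and halli))).exists
  have hpath : ListPath G (y i) (revTail v (L i) ++ revTail (y j) (R j)) (y j) := by
    refine hi1.reverse.append hRj.reverse fun c hc => ?_
    rw [hi1.mem_reverse]
    rw [hRj.mem_revTail] at hc
    grind
  have heq := H.unique hpath hj2 (by simp; omega) (by simp; omega)
  have := (hpath.append_inj heq hi1.reverse.1 hRi.1).1
  have := congrArg List.length this
  rw [length_revTail] at this
  refine ⟨p, by omega, L, hL, ?_⟩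
  filter_upwards [hi0] with i hi
  exact ⟨hi.1, by omega⟩

lemma PathSystem.unique_of_stub (H : PathSystem G k) {s t : V} {r : ℕ} {p q : List V}
    (hs : Stub G s (k - r)) (hrk : r ≤ k) (hp : ListPath G s p t) (hq : ListPath G s q t)
    (hpr : p.length = r) (hqr : q.length = r) : p = q := by
  obtain ⟨l, b, h1, h2, h3⟩ := hs (s :: p ++ q)
  have hr := fun a => h1.mem_reverse (a := a)
  have hp' := hp.start_notMem
  have hq' := hq.start_notMem
  have := H.unique (h1.reverse.append hp fun c hc => by grind)
    (h1.reverse.append hq fun c hc => by grind) (by simp; omega) (by simp; omega)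
  exact List.append_cancel_left this

lemma PathSystem.no_even_cycle (H : PathSystem G k) {s t : V} {r : ℕ} {p : List V}
    (hs : ∀ e ≤ k, Stub G s e) (hp : ListPath G s p t) (hpr : p.length + 1 = 2 * r) (hr : 2 ≤ r)
    (hrk : r ≤ k) (hadj : G.Adj t s) : False := by
  obtain ⟨l₁, l₂, c, rfl, hl, h1, h2, h3⟩ := hp.split_length (n := r) (by omega)
  simp only [List.length_append] at hpr
  have ht := h2.end_mem_of_pos (by omega)
  have hm := h2.mem_revTail (a := s)
  have hc := h1.ne_of_pos (by omega)
  have heq := H.unique_of_stub (hs _ (Nat.sub_le k r)) hrk h1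
    (h2.reverse.cons hadj.symm (by have := h1.start_notMem; have := hp.start_notMem; grind)) hl
    (by simp; omega)
  have : t ∈ l₁ := by rw [heq]; simp
  exact h3 t ht (by simp [this])

end PathSystems

section Neighbours

variable {V ι : Type*} {G : SimpleGraph V} {k : ℕ} {U : Ultrafilter ι} {u : ι → V} {v : V}

lemma stub_of_rooted (hu : FreeSeq U u) (hadj : ∀ i, G.Adj v (u i))
    (h : ∀ᶠ i in U, ∃ L : ι → List V, FreeLists U L ∧
      ∀ᶠ j in U, ListPath G (u i) (L j) (u j) ∧ (L j).length = k) :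
    ∀ e ≤ k, Stub G v e := by
  intro e he F
  rcases e with - | e
  · exact ⟨[], v, listPath_nil, rfl, by simp⟩
  obtain ⟨i, ⟨L, hL, h1⟩, h2⟩ := (h.and (hu.avoid (v :: F))).exists
  obtain ⟨j, ⟨h3, h4⟩, h5⟩ := (h1.and (hL.avoid (v :: F))).exists
  obtain ⟨l₁, l₂, c, he, hl, h6, -⟩ := h3.split_length (n := e) (by omega)
  replace h5 : ∀ a ∈ l₁, a ∉ v :: F := fun a ha => h5 a (by simp [he, ha])
  exact ⟨u i :: l₁, c, h6.cons (hadj i) (by grind), by simp [hl], by grind⟩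

/-- The case of `PathSystem.exists_half_neighbours` in which the paths between members of the
sequence share only their first vertices. -/
lemma PathSystem.false_of_rooted (H : PathSystem G k) (hk : 5 ≤ k) (hu : FreeSeq U u)
    (hadj : ∀ i, G.Adj v (u i))
    (h : ∀ᶠ i in U, ∃ L : ι → List V, FreeLists U L ∧
      ∀ᶠ j in U, ListPath G (u i) (L j) (u j) ∧ (L j).length = k) : False := by
  have hv := stub_of_rooted hu hadj h
  have hodd : ∀ r, k ≠ 2 * r := by
    rintro r hr
    obtain ⟨i, ⟨L, hL, h1⟩, h2⟩ := (h.and (hu v)).exists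
    obtain ⟨j, ⟨h3, h4⟩, h5⟩ := (h1.and (hL.avoid [v])).exists
    exact H.no_even_cycle hv (h3.cons (hadj i) (by grind)) (r := r + 1) (by simp; omega)
      (by omega) (by omega) (hadj j).symm
  have hshort : ∀ i, (∃ L : ι → List V, FreeLists U L ∧
      ∀ᶠ j in U, ListPath G (u i) (L j) (u j) ∧ (L j).length = k) →
      ∀ p, ListPath G v p (u i) → 2 ≤ p.length → k < p.length := by
    rintro i ⟨L, hL, h1⟩ p hp hp2
    by_contra! hpk
    obtain ⟨r, hr | hr⟩ := Nat.even_or_odd' p.length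
    · obtain ⟨j, ⟨h3, h4⟩, h5⟩ := (h1.and (hL.avoid (v :: p))).exists
      obtain ⟨r', hr' | hr'⟩ := Nat.even_or_odd' k
      · exact hodd _ hr'
      · exact H.no_even_cycle hv (hp.append h3 h5) (r := r + r' + 1) (by simp; omega) (by omega)
          (by omega) (hadj j).symm
    · exact H.no_even_cycle hv hp (r := r + 1) (by omega) (by omega) (by omega) (hadj i).symm
  obtain ⟨i₁, h1⟩ := h.exists
  obtain ⟨i₂, h2, hne⟩ := (h.and (hu.avoid [u i₁, v])).exists
  have hs₁ := hshort _ h1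
  have hs₂ := hshort _ h2
  have hv₂ : ∀ e ≤ k, Stub G (u i₂) e := by
    obtain ⟨L, hL, h3⟩ := h2
    intro e he F
    obtain ⟨j, ⟨h3, h4⟩, h5⟩ := (h3.and (hL.avoid F)).exists
    obtain ⟨l₁, l₂, c, he, hl, h6, -⟩ := h3.split_length (n := e) (by omega)
    exact ⟨l₁, c, h6, hl, fun a ha => h5 a (by simp [he, ha])⟩
  obtain ⟨y, hy₂, hyv, hy₁⟩ : ∃ y, G.Adj (u i₂) y ∧ y ≠ v ∧ y ≠ u i₁ := by
    obtain ⟨L, hL, h3⟩ := h2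
    obtain ⟨j, ⟨h3, h4⟩, h5⟩ := (h3.and (hL.avoid [v, u i₁])).exists
    cases hLj : L j with
    | nil => simp [hLj] at h4; omega
    | cons y T =>
      rw [hLj] at h3
      have := h5 y (by simp [hLj])
      exact ⟨y, h3.1.1, by grind, by grind⟩
  have hy₂' := hy₂.ne
  have hv₁' := (hadj i₁).ne
  have hv₂' := (hadj i₂).ne
  have hn : ¬ G.Adj (u i₁) y := by
    intro hn
    have := hs₁ [u i₂, y, u i₁] (((listPath_nil.cons hn.symm (by grind)).cons hy₂ (by grind)).cons
      (hadj i₂) (by grind)) (by simp)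
    simp at this
    omega
  obtain ⟨Z, hZ, hZk⟩ := H.exists_path (Ne.symm hy₁) hn
  obtain ⟨r, hr | hr⟩ := Nat.even_or_odd' k
  · exact hodd _ hr
  by_cases hvZ : v ∈ u i₁ :: Z
  · obtain ⟨Z₁, Z₂, rfl, h3, h4, h5⟩ := hZ.split_at hvZ
    simp only [List.length_append] at hZk
    have h6 := hs₁ _ h3.reverse
    have h7 := h3.length_pos (Ne.symm hv₁')
    have h7' := h4.length_pos (Ne.symm hyv)
    rw [length_revTail] at h6
    have h8 : Z₁.length = 1 := by omega
    by_cases hu₂ : u i₂ ∈ v :: Z₂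
    · obtain ⟨Z₃, Z₄, rfl, h9, h10, h11⟩ := h4.split_at hu₂
      simp only [List.length_append] at hZk
      have h12 := hs₂ _ h9
      have h13 := h9.length_pos hv₂'
      exact H.no_even_cycle hv₂ h10 (r := r) (by omega) (by omega) (by omega) hy₂.symm
    · have := hs₂ (Z₂ ++ [u i₂]) (h4.append (listPath_nil.cons hy₂.symm (by grind)) (by grind))
        (by simp; omega)
      simp at this
      omega
  · by_cases hu₂ : u i₂ ∈ u i₁ :: Z
    · obtain ⟨Z₁, Z₂, rfl, h3, h4, h5⟩ := hZ.split_at hu₂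
      simp only [List.length_append] at hZk
      have h6 := h3.length_pos (by grind)
      have h7 := h4.length_pos hy₂'
      have := hs₂ (u i₁ :: Z₁) (h3.cons (hadj i₁) (by grind)) (by simp; omega)
      simp at this
      omega
    · have h3 := hZ.append (listPath_nil.cons hy₂.symm (by grind)) (l₂ := [u i₂]) (by grind)
      exact H.no_even_cycle hv (h3.cons (hadj i₁) (by grind)) (r := r + 2)
        (by simp; omega) (by omega) (by omega) (hadj i₂).symm

lemma PathSystem.exists_half_neighbours (H : PathSystem G k) (hk : 5 ≤ k) (hu : FreeSeq U u)
    (hadj : ∀ i, G.Adj v (u i)) :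
    ∃ m, k = 2 * m ∧ ∃ L : ι → List V, FreeLists U L ∧
      ∀ᶠ j in U, ListPath G v (L j) (u j) ∧ (L j).length = m := by
  have hcase : ∀ᶠ i in U, (∃ R, ∃ L : ι → List V, FreeLists U L ∧ ListPath G (u i) R v ∧
      ∀ᶠ j in U, ListPath G v (L j) (u j) ∧ ListPath G (u i) (R ++ L j) (u j) ∧
        R.length + (L j).length = k) ∨ (∃ L : ι → List V, FreeLists U L ∧
      ∀ᶠ j in U, ListPath G (u i) (L j) (u j) ∧ (L j).length = k) := by
    filter_upwards [H.exists_rooted (by omega) hu] with i ⟨w, R, L, hL, hR, h⟩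
    have hvi := (hadj i).ne
    by_cases hwv : w = v
    · subst hwv
      exact Or.inl ⟨R, L, hL, hR, h⟩
    by_cases hRn : R = []
    · subst hRn
      obtain rfl : u i = w := hR.1
      exact Or.inr ⟨L, hL, h.mono fun j hj => ⟨hj.1, by simpa using hj.2.2⟩⟩
    exfalso
    by_cases hvR : v ∈ u i :: R
    · obtain ⟨R₁, R₂, rfl, h1, h2, h3⟩ := hR.split_at hvR
      rcases R₂ with - | ⟨r, R₂⟩
      · exact hwv h2.1.symm
      have key : ∀ᶠ j in U, ListPath G (u i) (R₁ ++ u j :: revTail r (R₂ ++ L j)) r ∧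
          R₁.length + R₂.length + (L j).length + 1 = k := by
        filter_upwards [h, hL.avoid (u i :: R₁ ++ [v]), hu v, hu.avoid (u i :: R₁)]
          with j h4 h5 h6 h6'
        have h7 := h4.2.1
        rw [List.append_assoc] at h7
        obtain ⟨d, hd1, hd2, hd3⟩ := h7.split
        obtain rfl := hd1.1.end_unique h1.1
        rw [List.cons_append, listPath_cons] at hd2
        have h8 := fun c => hd2.2.1.mem_reverse (a := c)
        refine ⟨h1.append (hd2.2.1.reverse.cons (hadj j) ?_) ?_, ?_⟩
        · grind
        · grind
        · have := h4.2.2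
          simp only [List.length_append, List.length_cons] at this
          omega
      obtain ⟨j, h4, h4'⟩ := key.exists
      obtain ⟨j', ⟨h5, h5'⟩, h6⟩ := (key.and (hu (u j))).exists
      have := List.append_cancel_left (H.unique h4 h5 (by simp; omega) (by simp; omega))
      grind
    · rcases R with - | ⟨r, R⟩
      · exact hRn rfl
      have key : ∀ᶠ j in U, ListPath G v (u j :: revTail r (R ++ L j)) r ∧
          R.length + (L j).length + 1 = k := by
        filter_upwards [h, hL.avoid [v], hu v] with j h4 h5 h6
        have h7 := h4.2.1
        rw [List.cons_append, listPath_cons] at h7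
        have h8 := fun c => h7.2.1.mem_reverse (a := c)
        refine ⟨h7.2.1.reverse.cons (hadj j) (by grind), ?_⟩
        have := h4.2.2
        simp only [List.length_cons] at this
        omega
      obtain ⟨j, h4, h4'⟩ := key.exists
      obtain ⟨j', ⟨h5, h5'⟩, h6⟩ := (key.and (hu (u j))).exists
      have := H.unique h4 h5 (by simp; omega) (by simp; omega)
      grind
  rcases Ultrafilter.eventually_or.1 hcase with h | h
  · exact H.exists_half h
  · exact (H.false_of_rooted hk hu hadj h).elim

end Neighbours

/-- A free family of paths of length `m` from `v` to neighbours of `v`. -/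
structure Blades {V ι : Type*} (G : SimpleGraph V) (U : Ultrafilter ι) (m : ℕ) (v : V)
    (L : ι → List V) : Prop where
  free : FreeLists U L
  path : ∀ᶠ j in U, ∃ u, G.Adj v u ∧ ListPath G v (L j) u ∧ (L j).length = m

section Blades

variable {V ι : Type*} {G : SimpleGraph V} {k m : ℕ} {U : Ultrafilter ι} {v w x z : V}
  {L : ι → List V}

lemma PathSystem.exists_blades (H : PathSystem G k) (hk : 5 ≤ k)
    (hv : (G.neighborSet v).Infinite) :
    ∃ m, k = 2 * m ∧ ∃ L : ℕ → List V, Blades G (Filter.hyperfilter ℕ) m v L := by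
  let e := hv.natEmbedding
  have hfree : FreeSeq (Filter.hyperfilter ℕ) fun n => (e n : V) := by
    intro x
    have hfin : {n | (e n : V) = x}.Finite := by
      refine Set.Subsingleton.finite fun a ha b hb => e.injective (Subtype.ext ?_)
      exact Eq.trans ha (Eq.symm hb)
    exact Filter.hyperfilter_le_cofinite hfin.compl_mem_cofinite
  obtain ⟨m, hm, L, hL, h⟩ := H.exists_half_neighbours hk hfree fun n => (e n).2
  exact ⟨m, hm, L, hL, h.mono fun j hj => ⟨e j, (e j).2, hj⟩⟩

lemma Blades.stub (h : Blades G U m v L) {e : ℕ} (he : e ≤ m) : Stub G v e := by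
  intro F
  obtain ⟨j, ⟨u, -, h1, h2⟩, h3⟩ := (h.path.and (h.free.avoid F)).exists
  obtain ⟨l₁, l₂, c, hl, hl₁, h4, -⟩ := h1.split_length (n := e) (by omega)
  exact ⟨l₁, c, h4, hl₁, fun a ha => h3 a (by simp [hl, ha])⟩

lemma PathSystem.stub_of_infinite (H : PathSystem G (2 * m)) (hm : 3 ≤ m)
    (hv : (G.neighborSet v).Infinite) {e : ℕ} (he : e ≤ m) : Stub G v e := by
  obtain ⟨m', hm', L, hL⟩ := H.exists_blades (by omega) hv
  obtain rfl : m = m' := by omega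
  exact hL.stub he

lemma infinite_neighborSet (h : ∀ F : List V, ∃ u, G.Adj v u ∧ u ∉ F) :
    (G.neighborSet v).Infinite := by
  intro hfin
  obtain ⟨u, h1, h2⟩ := h hfin.toFinset.toList
  exact h2 (by simpa using h1)

lemma Blades.infinite (h : Blades G U m v L) (hm : 1 ≤ m) : (G.neighborSet v).Infinite := by
  refine infinite_neighborSet fun F => ?_
  obtain ⟨l, b, h1, h2, h3⟩ := h.stub hm F
  rcases l with - | ⟨a, l⟩
  · simp at h2
  · exact ⟨a, h1.1.1, h3 a (by simp)⟩

lemma PathSystem.no_theta (H : PathSystem G (2 * m)) (hm : 3 ≤ m) {n : ℕ} (hn : 2 ≤ n)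
    (hnm : n ≤ 2 * m)
    (h : ∀ F : List V, ∃ l, ListPath G v l w ∧ l.length = n ∧ ∀ a ∈ l, a ≠ w → a ∉ F) : False := by
  have hv : (G.neighborSet v).Infinite := by
    refine infinite_neighborSet fun F => ?_
    obtain ⟨l, h1, h2, h3⟩ := h F
    rcases l with - | ⟨a, l⟩
    · simp at h2; omega
    · refine ⟨a, h1.1.1, h3 a (by simp) ?_⟩
      exact (listPath_cons.1 h1).2.1.ne_of_pos (by simp at h2; omega)
  have hw : (G.neighborSet w).Infinite := by
    refine infinite_neighborSet fun F => ?_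
    obtain ⟨l, h1, h2, h3⟩ := h (v :: F)
    have h4 := fun c => h1.mem_revTail (a := c)
    have h5 := h1.reverse
    have h6 : (revTail v l).length = n := by simp [h2]
    rcases hr : revTail v l with - | ⟨a, l'⟩
    · simp [hr] at h6; omega
    · rw [hr] at h5 h6 h4
      have h7 := h5.1.1
      have h8 : a ≠ v := (listPath_cons.1 h5).2.1.ne_of_pos (by simp at h6; omega)
      have := h7.ne
      have := (h4 a).1 (by simp)
      refine ⟨a, h7, ?_⟩
      have := h3 a
      grind
  obtain ⟨A, a, hA, hAl, hAw⟩ := H.stub_of_infinite hm hv (min_le_left m (2 * m - n)) [w]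
  obtain ⟨B, b, hB, hBl, hBA⟩ := H.stub_of_infinite hm hw (e := 2 * m - n - min m (2 * m - n))
    (by omega) (v :: A)
  have hA' := fun c => hA.mem_reverse (a := c)
  have hB' := hB.start_notMem
  have key : ∀ l, ListPath G v l w → l.length = n → (∀ c ∈ l, c ≠ w → c ∉ A ++ B) →
      ListPath G a (revTail v A ++ (l ++ B)) b ∧ (revTail v A ++ (l ++ B)).length = 2 * m := by
    intro l h1 h2 h3
    have := h1.start_notMem
    refine ⟨hA.reverse.append (h1.append hB ?_) ?_, by simp; omega⟩
    · grind
    · intro c hc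
      have := h3 c
      have := h3 v
      grind
  obtain ⟨l₁, h1, h2, h3⟩ := h (A ++ B)
  obtain ⟨l₂, h4, h5, h6⟩ := h (l₁ ++ (A ++ B))
  obtain ⟨h7, h8⟩ := key l₁ h1 h2 h3
  obtain ⟨h9, h10⟩ := key l₂ h4 h5 fun c hc hcw => by have := h6 c hc hcw; grind
  have heq : l₁ = l₂ :=
    List.append_cancel_right (List.append_cancel_left (H.unique h7 h9 h8 h10))
  subst heq
  rcases l₁ with - | ⟨c, l⟩
  · simp at h2; omega
  · refine h6 c (by simp) ?_ (by simp)
    exact (listPath_cons.1 h1).2.1.ne_of_pos (by simp at h2; omega)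

lemma PathSystem.no_tail (H : PathSystem G (2 * m)) (hm : 3 ≤ m) {B : List V} {u : V}
    (hv : (G.neighborSet v).Infinite) (hB : ListPath G v B u) (hBm : B.length = m)
    (hvu : G.Adj v u) (hx : x ∈ B) {q : List V} (hq : ListPath G x q z)
    (hqm : q.length + 1 = m) (hqB : ∀ a ∈ q, a ∉ v :: B) : False := by
  obtain ⟨m', hm', L, hL⟩ := H.exists_blades (by omega) hv
  obtain rfl : m = m' := by omega
  obtain ⟨j, ⟨u', hu', h1, h2⟩, h3⟩ := (hL.path.and (hL.free.avoid (v :: B ++ q))).exists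
  obtain ⟨B₁, B₂, rfl, h4, h5, h6⟩ := hB.split_at (a := x) (by simp [hx])
  simp only [List.length_append] at hBm
  obtain ⟨C₁, C₂, c, hC, hCl, h7, h8, h9⟩ := h1.split_length (n := B₁.length) (by omega)
  rw [hC] at h1 h2 h3
  simp only [List.length_append] at h2
  have hu3 := h3 u' (h1.end_mem_of_pos (by simp; omega))
  have hv1 := h1.start_notMem
  have hv2 := hB.start_notMem
  have hqr := fun a => hq.mem_reverse (a := a)
  have h4r := fun a => h4.mem_reverse (a := a)
  have h8r := fun a => h8.mem_reverse (a := a)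
  have h7e := h7.end_mem
  have h1e := h1.end_mem
  have h3' : ∀ a, a ∈ C₁ ∨ a ∈ C₂ → a ∉ v :: (B₁ ++ B₂) ++ q := fun a ha => h3 a (by simpa using ha)
  have hvx : v ≠ x := by grind
  have hl₁ := h4.length_pos hvx
  have hdisj : ∀ a ∈ C₂, a ∉ C₁ := by grind
  have hcC : c ∈ C₁ := h7.end_mem_of_pos (by omega)
  have e1 : ListPath G v (u' :: revTail c C₂) c := by
    refine h8.reverse.cons hu' ?_
    grind
  have e2 : ListPath G x (revTail v B₁ ++ u' :: revTail c C₂) c := by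
    refine h4.reverse.append e1 ?_
    intro a ha
    have := h8r a
    have := h3' a
    grind
  have e3 : ListPath G u (v :: C₁) c := h7.cons hvu.symm (by
    have := hB.end_mem_of_pos (by simp; omega)
    have := h3' u
    grind)
  have e4 : ListPath G x (B₂ ++ v :: C₁) c := by
    refine h5.append e3 ?_
    intro a ha
    have := h3' a
    grind
  have e5 := hq.reverse.append e2 (by
    intro a ha
    have h10 := h8r a
    have h11 := h3' a
    have h12 := h4r a
    have h13 := hqB a
    have h14 := e2.start_notMem
    grind)
  have e6 := hq.reverse.append e4 (by
    intro a ha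
    have h11 := h3' a
    have h13 := hqB a
    have h14 := e4.start_notMem
    grind)
  have heq := List.append_cancel_left
    (H.unique e5 e6 (by simp; omega) (by simp; omega))
  rcases C₂ with - | ⟨d, C₂⟩
  · obtain rfl : B₂ = [] := List.length_eq_zero_iff.1 (by simp at h2; omega)
    rcases C₁ with - | ⟨d, C₁⟩
    · simp at h2; omega
    · have hd : d ∈ revTail v B₁ ++ u' :: revTail c [] := by simp [heq]
      have h10 : d ≠ c := (listPath_cons.1 h7).2.1.ne_of_pos (by simp at h2; omega)
      have h11 : c = u' := h8.1
      have h12 := h3' d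
      have h13 := h4r d
      simp [revTail] at hd
      grind
  · have h10 : u' ∈ d :: C₂ := h8.end_mem_of_pos (by simp)
    have h11 : u' ∈ B₂ ++ v :: C₁ := by simp [← heq]
    have h12 := hdisj u' h10
    grind

end Blades

section Half

variable {V ι : Type*} {G : SimpleGraph V} {m : ℕ} {U : Ultrafilter ι} {v w x y z : V}
  {L : ι → List V}

/-- A path ending in `T` contains a path from a vertex of `T` to its start avoiding `T` after its
first vertex. -/
lemma ListPath.exists_first_hit {T M : List V} (h : ListPath G w M y) (hy : y ∈ T) :
    ∃ x ∈ T, ∃ q, ListPath G x q w ∧ (∀ a ∈ q, a ∉ T) ∧ ∀ a ∈ q, a = w ∨ a ∈ M := by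
  induction M generalizing w with
  | nil =>
    obtain rfl : w = y := h.1
    exact ⟨w, hy, [], listPath_nil, by simp, by simp⟩
  | cons b M ih =>
    by_cases hw : w ∈ T
    · exact ⟨w, hw, [], listPath_nil, by simp, by simp⟩
    rw [listPath_cons] at h
    obtain ⟨x, hx, q, hq, hqT, hqM⟩ := ih h.2.1
    have hwq : w ∉ x :: q := by grind
    refine ⟨x, hx, q ++ [w], hq.append (listPath_nil.cons h.1.symm ?_) ?_, ?_, ?_⟩ <;> grind

lemma PathSystem.eq_root (H : PathSystem G (2 * m)) (hm : 3 ≤ m) (hL : Blades G U m v L)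
    {M : ι → List V} (hM : FreeLists U M)
    (h : ∀ᶠ i in U, ∃ y ∈ L i, ListPath G w (M i) y) : w = v := by
  by_contra hwv
  have key : ∀ᶠ i in U, ∃ n ≤ 2 * m, 2 ≤ n ∧
      ∃ l, ListPath G v l w ∧ l.length = n ∧ ∀ a ∈ l, a = w ∨ a ∈ L i ∨ a ∈ M i := by
    filter_upwards [hL.path, hL.free.avoid [w], hM.avoid [v], h]
      with i ⟨u, hu, h1, h2⟩ h3 h4 ⟨y, hy, h5⟩
    obtain ⟨x, hx, q, hq, hqL, hqM⟩ := h5.exists_first_hit hy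
    have hvq : ∀ a ∈ q, a ∉ v :: L i := by
      intro a ha
      have := hqL a ha
      have := hqM a ha
      have := h4 a
      grind
    have hqm : q.length + 1 < m := by
      by_contra! hqm
      obtain ⟨l₁, l₂, c, rfl, hl₁, h6, -⟩ := hq.split_length (n := m - 1) (by omega)
      exact H.no_tail hm (hL.infinite (by omega)) h1 h2 hu hx h6 (by omega)
        fun a ha => hvq a (by simp [ha])
    obtain ⟨B₁, B₂, hB, h6, h7, h8⟩ := h1.split_at (a := x) (by simp [hx])
    have h9 := h6.length_pos (by have := h1.start_notMem; grind)
    have h10 := hq.length_pos (by have := h3 x hx; grind)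
    have h11 : (L i).length = B₁.length + B₂.length := by simp [hB]
    refine ⟨B₁.length + q.length, by omega, by omega, B₁ ++ q, h6.append hq ?_, by simp, ?_⟩
    · intro a ha
      have := hvq a ha
      grind
    · intro a ha
      have := hqM a
      grind
  obtain ⟨n, hn, h1⟩ := eventually_exists_le _ key
  refine H.no_theta (v := v) (w := w) hm h1.exists.choose_spec.1 hn fun F => ?_
  obtain ⟨i, ⟨-, l, h2, h3, h4⟩, h5, h6⟩ := (h1.and ((hL.free.avoid F).and (hM.avoid F))).exists
  exact ⟨l, h2, h3, fun a ha haw => (h4 a ha).elim (fun h => (haw h).elim)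
    fun h => h.elim (h5 a) (h6 a)⟩

/-- Each level of the blades is reached from `v` by a free family of paths of length `m`. -/
lemma PathSystem.exists_level (H : PathSystem G (2 * m)) (hm : 3 ≤ m) (hL : Blades G U m v L)
    {s : ℕ} (hs : s < m) : ∃ N : ι → List V, FreeLists U N ∧
      ∀ᶠ j in U, ∀ c, (L j)[s]? = some c → ListPath G v (N j) c ∧ (N j).length = m := by
  let y : ι → V := fun j => (L j).getD s v
  have hy : ∀ᶠ j in U, (L j)[s]? = some (y j) ∧ y j ∈ L j := by
    filter_upwards [hL.path] with j ⟨u, _, _, h2⟩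
    have hsl : s < (L j).length := by omega
    simp [y, List.getD, List.getElem?_eq_getElem hsl]
  have hfree : FreeSeq U y := by
    intro x
    filter_upwards [hL.free x, hy] with j h1 h2 h3
    exact h1 (h3 ▸ h2.2)
  obtain ⟨m', hm', N, hN, h⟩ := H.exists_half (v := v) (y := y) (U := U) (by
    filter_upwards [H.exists_rooted (by omega) hfree] with i ⟨w, R, M, hM, hR, h⟩
    obtain rfl := H.eq_root hm hL hM (by
      filter_upwards [h, hy] with j h1 h2 using ⟨y j, h2.2, h1.1⟩)
    exact ⟨R, M, hM, hR, h⟩)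
  obtain rfl : m = m' := by omega
  refine ⟨N, hN, ?_⟩
  filter_upwards [h, hy] with j h1 h2 c hc
  obtain rfl : y j = c := by simpa [h2.1] using hc
  exact h1

/-- There are no paths of length strictly between `m` and `2 * m` from `v` to a generic blade. -/
lemma PathSystem.eventually_gap (H : PathSystem G (2 * m)) (hm : 3 ≤ m) (hL : Blades G U m v L) :
    ∀ᶠ i in U, ∀ z ∈ L i, ∀ W, ListPath G v W z → m < W.length → 2 * m ≤ W.length := by
  choose! N hN hNL using fun s (hs : s < m) => H.exists_level hm hL hs
  have hall := eventually_forall_mem_list (U := U) (List.range m)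
    fun s hs => hNL s (List.mem_range.1 hs)
  filter_upwards [hall, hL.path] with i hi ⟨u, hu, h1, h2⟩ z hz W hW hWm
  by_contra! hW2
  obtain ⟨s, hs⟩ := List.mem_iff_getElem?.1 hz
  have hsm : s < m := by
    have := (List.getElem?_eq_some_iff.1 hs).1
    omega
  have hNi := hi s (by simpa using hsm) z hs
  obtain ⟨t, ht⟩ : ∃ t, W.length + t + 1 = 2 * m := ⟨2 * m - W.length - 1, by omega⟩
  have htm : t < m := by omega
  obtain ⟨j, ⟨u', -, h3, h4⟩, h5, h6, h7⟩ := (hL.path.and ((hL.free.avoid (v :: W)).and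
    ((hNL t htm).and ((hN t htm).avoid (v :: N s i))))).exists
  obtain ⟨B₁, B₂, c, hB, hl, h8, h9, -⟩ := h3.split_length (n := t + 1) (by omega)
  have hc : (L j)[t]? = some c := by
    rcases List.eq_nil_or_concat B₁ with rfl | ⟨B, b, rfl⟩
    · simp at hl
    · obtain ⟨d, -, hd⟩ := listWalk_append.1 (List.concat_eq_append ▸ h8.1)
      obtain rfl : b = c := hd.2
      have : B.length = t := by simpa using hl
      subst this
      simp [hB]
  obtain ⟨h10, h11⟩ := h6 c hc
  have e1 := hW.reverse.append h8 (by
    intro a ha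
    rw [hW.mem_reverse]
    exact h5 a (by simp [hB, ha]))
  have e2 := hNi.1.reverse.append h10 (by
    intro a ha
    rw [hNi.1.mem_reverse]
    exact h7 a ha)
  have heq := H.unique e1 e2 (by simp; omega) (by simp; omega)
  have := congrArg List.length (e1.append_inj heq hW.reverse.1 hNi.1.reverse.1).1
  simp at this
  omega

lemma PathSystem.false_of_half (H : PathSystem G (2 * m)) (hm : 3 ≤ m)
    (hL : Blades G U m v L) : False := by
  obtain ⟨i, ⟨u, hvu, hB, hBm⟩, hgap⟩ := (hL.path.and (H.eventually_gap hm hL)).exists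
  generalize L i = B at hB hBm hgap
  have hinf := hL.infinite (by omega)
  have huniq : ∀ {p q : List V} {t : V}, ListPath G v p t → ListPath G v q t → p.length = m →
      q.length = m → p = q := fun hp hq hpl hql =>
    H.unique_of_stub (r := m) (hL.stub (by omega)) (by omega) hp hq hpl hql
  obtain ⟨x₁, x₂, T, rfl⟩ : ∃ x₁ x₂ T, B = x₁ :: x₂ :: T := by
    match B, hBm with
    | [], h => simp at h; omega
    | [_], h => simp at h; omega
    | a :: b :: T, _ => exact ⟨a, b, T, rfl⟩
  have hT : 0 < T.length := by simp at hBm; omega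
  simp only [List.length_cons] at hBm
  have hB₁ := (listPath_cons.1 hB).2.1
  have hB₂ := (listPath_cons.1 hB₁).2.1
  have hv := hB.start_notMem
  have hx₁ := hB₁.start_notMem
  have hx₂ := hB₂.start_notMem
  have huT := hB₂.end_mem_of_pos hT
  have hvu' := hvu.ne
  have hB₁r := fun a => hB₁.mem_revTail (a := a)
  -- the path to the first vertex of the blade that starts with its last vertex
  have hback : ListPath G v (u :: revTail x₁ (x₂ :: T)) x₁ :=
    hB₁.reverse.cons hvu (by have := hB₁.mem_reverse (a := v); grind)
  have hbackl : (u :: revTail x₁ (x₂ :: T)).length = m := by simp; omega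
  have hvx₂ : G.Adj v x₂ := by
    by_contra hn
    obtain ⟨W, hW, hWl⟩ := H.exists_path (x := v) (y := x₂) (by grind) hn
    obtain ⟨A, C, c, rfl, hA, h1, h2, h3⟩ := hW.split_length (n := m + 1) (by omega)
    simp only [List.length_append] at hWl
    refine H.no_tail hm hinf hB (by simpa using hBm) hvu (x := x₂) (by simp) h2.reverse
      (by simp; omega) fun a ha haB => ?_
    rw [h2.mem_revTail] at ha
    obtain ⟨C₁, C₂, rfl, h4, h5, h6⟩ := h2.split_at ha.1
    have h7 := h5.length_pos ha.2
    have hvW := hW.start_notMem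
    simp only [List.length_append] at hWl
    rcases List.mem_cons.1 haB with rfl | haB
    · have := h1.end_mem_of_pos (by omega)
      have := h4.end_mem
      grind
    · have := hgap a haB (A ++ C₁) (h1.append h4 fun c hc => h3 c (by simp [hc]))
        (by simp; omega)
      simp at this
      omega
  have hux₁ : G.Adj u x₁ := by
    by_contra hn
    obtain ⟨Z, hZ, hZl⟩ := H.exists_path (x := x₁) (y := u) (by grind) fun h => hn h.symm
    by_cases hvZ : v ∈ x₁ :: Z
    · obtain ⟨Z₁, Z₂, rfl, h1, h2, h3⟩ := hZ.split_at hvZ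
      simp only [List.length_append] at hZl
      have h4 := h1.length_pos (by grind)
      have h5 := h2.length_pos hvu'
      have h6 := hgap x₁ (by simp) _ h1.reverse
      have h7 := hgap u (by simp [huT]) _ h2
      rw [length_revTail] at h6
      have heq := huniq h1.reverse hback (by simp; omega) hbackl
      have h8 : u ∈ revTail x₁ Z₁ := by simp [heq]
      rw [h1.mem_revTail] at h8
      exact h3 u (h2.end_mem_of_pos h5) h8.1
    · have hmid : ∀ Z₁ Z₂ b, Z = Z₁ ++ Z₂ → ListPath G x₁ Z₁ b → ListPath G b Z₂ u →
          2 ≤ Z₁.length → Z₁.length ≤ m → b ∉ v :: x₁ :: x₂ :: T := by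
        rintro Z₁ Z₂ b rfl h1 h2 h3 h4 hb
        simp only [List.length_append] at hZl
        have h5 := fun a => h2.mem_reverse (a := a)
        have h6 := h1.end_mem
        have h7 := hgap b (by grind) (u :: revTail b Z₂)
          (h2.reverse.cons hvu (by have := h5 v; grind)) (by simp; omega)
        simp at h7
        omega
      rcases Z with - | ⟨a, Z⟩
      · simp at hZl; omega
      have hZ' := listPath_cons.1 hZ
      simp only [List.length_cons] at hZl
      obtain ⟨Z₁, Z₂, c, rfl, h1, h2, h3, h4⟩ := hZ'.2.1.split_length (n := m - 1) (by omega)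
      have htail : ∀ b ∈ Z₁, b ∉ v :: x₁ :: x₂ :: T := by
        intro b hb
        obtain ⟨Y₁, Y₂, rfl, h5, h6, h7⟩ := h2.split_at (a := b) (by simp [hb])
        have h8 := h5.length_pos (by have := h2.start_notMem; grind)
        simp only [List.length_append] at h1
        refine hmid (a :: Y₁) (Y₂ ++ Z₂) b (by simp) (h5.cons hZ'.1 ?_) (h6.append h3 ?_)
          (by simp; omega) (by simp; omega)
        · grind
        · have := h5.end_mem
          grind
      by_cases haB : a ∈ x₁ :: x₂ :: T
      · exact H.no_tail hm hinf hB (by simpa using hBm) hvu haB h2 (by omega) htail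
      · obtain ⟨Y₁, Y₂, d, rfl, h5, h6, -⟩ := h2.split_length (n := m - 2) (by omega)
        refine H.no_tail hm hinf hB (by simpa using hBm) hvu (x := x₁) (by simp)
          (h6.cons hZ'.1 ?_) (by simp; omega) ?_
        · grind
        · grind
  have hfwd : ListPath G v (x₂ :: (T ++ [x₁])) x₁ := by
    refine (hB₂.append (listPath_nil.cons hux₁ (by grind)) ?_).cons hvx₂ ?_
    · grind
    · grind
  have heq := huniq hfwd hback (by simp; omega) hbackl
  grind

lemma PathSystem.finite_neighborSet {k : ℕ} (H : PathSystem G k) (hk : 5 ≤ k) (v : V) :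
    (G.neighborSet v).Finite := by
  by_contra hv
  obtain ⟨m, rfl, L, hL⟩ := H.exists_blades hk hv
  exact H.false_of_half (by omega) hL

lemma PathSystem.finite {k : ℕ} (H : PathSystem G k) (hk : 5 ≤ k) : Finite V := by
  rcases isEmpty_or_nonempty V with hV | ⟨⟨x⟩⟩
  · infer_instance
  have hball : ∀ n : ℕ, ∀ x, {y | ∃ l, ListWalk G x l y ∧ l.length ≤ n}.Finite := by
    intro n
    induction n with
    | zero =>
      intro x
      refine (Set.finite_singleton x).subset ?_
      rintro y ⟨l, h1, h2⟩
      obtain rfl := List.length_eq_zero_iff.1 (Nat.le_zero.1 h2)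
      exact h1.symm
    | succ n ih =>
      intro x
      refine ((Set.finite_singleton x).union
        ((H.finite_neighborSet hk x).biUnion fun a _ => ih a)).subset ?_
      rintro y ⟨l, h1, h2⟩
      rcases l with - | ⟨a, l⟩
      · exact Or.inl h1.symm
      · exact Or.inr (Set.mem_biUnion (x := a) h1.1 ⟨l, h1.2, by simpa using h2⟩)
  refine Set.finite_univ_iff.1 ((hball k x).subset fun y _ => ?_)
  by_cases hxy : x = y
  · exact ⟨[], hxy, by simp⟩
  by_cases hadj : G.Adj x y
  · exact ⟨[y], ⟨hadj, rfl⟩, by simp; omega⟩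
  · obtain ⟨p, hp, hpl⟩ := H.exists_path hxy hadj
    exact ⟨p, hp.1, hpl.le⟩

end Half

section Ultraproduct

variable {ι : Type*} {V : ι → Type*} {U : Ultrafilter ι} {k : ℕ}

def ultraSetoid (U : Ultrafilter ι) (V : ι → Type*) : Setoid (∀ i, V i) where
  r f g := ∀ᶠ i in U, f i = g i
  iseqv := ⟨fun _ => .of_forall fun _ => rfl, fun h => h.mono fun _ => Eq.symm,
    fun h₁ h₂ => by filter_upwards [h₁, h₂] with i using Eq.trans⟩

/-- The ultraproduct of a family of types. -/
abbrev UltraProd (U : Ultrafilter ι) (V : ι → Type*) := Quotient (ultraSetoid U V)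

lemma UltraProd.mk_out (f : ∀ i, V i) :
    ∀ᶠ i in U, (Quotient.mk (ultraSetoid U V) f).out i = f i :=
  Quotient.mk_out (s := ultraSetoid U V) f

lemma UltraProd.eq_iff {a b : UltraProd U V} : a = b ↔ ∀ᶠ i in U, a.out i = b.out i :=
  (Quotient.out_equiv_out (s := ultraSetoid U V)).symm

/-- The ultraproduct of a family of graphs. -/
def ultraGraph (U : Ultrafilter ι) (G : ∀ i, SimpleGraph (V i)) :
    SimpleGraph (UltraProd U V) where
  Adj a b := ∀ᶠ i in U, (G i).Adj (a.out i) (b.out i)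
  symm := ⟨fun _ _ h => h.mono fun _ => Adj.symm⟩
  loopless := ⟨fun _ h => by
    obtain ⟨i, hi⟩ := h.exists
    exact hi.ne rfl⟩

variable {G : ∀ i, SimpleGraph (V i)} {x y : UltraProd U V} {l : List (UltraProd U V)}

lemma listWalk_ultraGraph : ListWalk (ultraGraph U G) x l y ↔
    ∀ᶠ i in U, ListWalk (G i) (x.out i) (l.map fun a => a.out i) (y.out i) := by
  induction l generalizing x with
  | nil => exact UltraProd.eq_iff
  | cons a l ih =>
    simp only [listWalk_cons, List.map_cons, Filter.eventually_and, ih]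
    rfl

lemma UltraProd.notMem_iff : x ∉ l ↔ ∀ᶠ i in U, x.out i ∉ l.map fun a => a.out i := by
  induction l with
  | nil => simp
  | cons a l ih =>
    simp only [List.mem_cons, not_or, List.map_cons, Filter.eventually_and, ih,
      Ultrafilter.eventually_not, UltraProd.eq_iff (a := x)]

lemma UltraProd.nodup_iff : l.Nodup ↔ ∀ᶠ i in U, (l.map fun a => a.out i).Nodup := by
  induction l with
  | nil => simp
  | cons a l ih => simp only [List.nodup_cons, List.map_cons, Filter.eventually_and, ih, notMem_iff]

lemma listPath_ultraGraph : ListPath (ultraGraph U G) x l y ↔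
    ∀ᶠ i in U, ListPath (G i) (x.out i) (l.map fun a => a.out i) (y.out i) := by
  simp only [ListPath, Filter.eventually_and, listWalk_ultraGraph]
  rw [UltraProd.nodup_iff]
  rfl

lemma UltraProd.list_eq {p q : List (UltraProd U V)}
    (h : ∀ᶠ i in U, (p.map fun a => a.out i) = q.map fun a => a.out i) : p = q := by
  induction p generalizing q with
  | nil =>
    obtain ⟨i, hi⟩ := h.exists
    simpa using hi
  | cons a p ih =>
    rcases q with - | ⟨b, q⟩
    · obtain ⟨i, hi⟩ := h.exists
      simp at hi
    · simp only [List.map_cons, List.cons.injEq, Filter.eventually_and] at h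
      rw [UltraProd.eq_iff.2 h.1, ih h.2]

lemma UltraProd.exists_list [∀ i, Nonempty (V i)] (n : ℕ) (p : ∀ i, List (V i))
    (h : ∀ᶠ i in U, (p i).length = n) :
    ∃ l : List (UltraProd U V), l.length = n ∧ ∀ᶠ i in U, (l.map fun a => a.out i) = p i := by
  induction n generalizing p with
  | zero =>
    refine ⟨[], rfl, h.mono fun i hi => ?_⟩
    rw [List.length_eq_zero_iff.1 hi]
    rfl
  | succ n ih =>
    obtain ⟨l, hl, hlp⟩ := ih (fun i => (p i).tail) (h.mono fun i hi => by simp [hi])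
    obtain ⟨f, hf⟩ := eventually_choose (U := U) (P := fun i a => p i = a :: (p i).tail) (by
      filter_upwards [h] with i hi
      cases hp : p i with
      | nil => simp [hp] at hi
      | cons a q => exact ⟨a, rfl⟩)
    refine ⟨Quotient.mk _ f :: l, by simp [hl], ?_⟩
    filter_upwards [hlp, hf, UltraProd.mk_out f] with i h1 h2 h3
    rw [List.map_cons, h1, h3, ← h2]

lemma PathSystem.ultraGraph [∀ i, Nonempty (V i)] (H : ∀ i, PathSystem (G i) k) :
    PathSystem (ultraGraph U G) k where
  unique hp hq hpk hqk := by
    rw [listPath_ultraGraph] at hp hq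
    refine UltraProd.list_eq ?_
    filter_upwards [hp, hq] with i h1 h2
    exact (H i).unique h1 h2 (by simpa) (by simpa)
  exists_path {x y} hne hadj := by
    have h1 := Ultrafilter.eventually_not.2 (mt UltraProd.eq_iff.2 hne)
    have h2 := Ultrafilter.eventually_not.2 hadj
    obtain ⟨p, hp⟩ := eventually_choose (U := U)
      (P := fun i p => ListPath (G i) (x.out i) p (y.out i) ∧ p.length = k)
      (by filter_upwards [h1, h2] with i h3 h4 using (H i).exists_path h3 h4)
    obtain ⟨l, hl, hlp⟩ := UltraProd.exists_list k p (hp.mono fun i hi => hi.2)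
    refine ⟨l, listPath_ultraGraph.2 ?_, hl⟩
    filter_upwards [hp, hlp] with i h3 h4
    rw [h4]
    exact h3.1

lemma UltraProd.infinite {V : ℕ → Type*} [∀ n, Fintype (V n)]
    (h : ∀ n, n < Fintype.card (V n)) : Infinite (UltraProd (Filter.hyperfilter ℕ) V) := by
  have : ∀ n, Nonempty (V n) := fun n => Fintype.card_pos_iff.1 (Nat.zero_lt_of_lt (h n))
  let f : ℕ → ∀ n, V n := fun i n =>
    if hi : i < Fintype.card (V n) then (Fintype.equivFin (V n)).symm ⟨i, hi⟩
    else Classical.arbitrary _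
  refine Infinite.of_injective
    (fun i => (Quotient.mk (ultraSetoid (Filter.hyperfilter ℕ) V) (f i))) fun i j hij => ?_
  have h1 : ∀ᶠ n in (Filter.hyperfilter ℕ : Filter ℕ), f i n = f j n := Quotient.exact hij
  have h2 : ∀ᶠ n in (Filter.hyperfilter ℕ : Filter ℕ), i + j ≤ n := by
    refine Filter.hyperfilter_le_cofinite ?_
    rw [Nat.cofinite_eq_atTop]
    exact Filter.eventually_ge_atTop _
  obtain ⟨n, h3, h4⟩ := (h1.and h2).exists
  have := h n
  simpa [f, show i < Fintype.card (V n) by omega, show j < Fintype.card (V n) by omega] using h3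

/-- Finite graphs with a `PathSystem` have boundedly many vertices. -/
lemma PathSystem.exists_card_le (hk : 5 ≤ k) : ∃ n : ℕ, ∀ (V : Type) [Fintype V]
    (G : SimpleGraph V), PathSystem G k → Fintype.card V ≤ n := by
  by_contra! h
  choose V hV G hG hn using h
  have : ∀ n, Nonempty (V n) := fun n => Fintype.card_pos_iff.1 (Nat.zero_lt_of_lt (hn n))
  have := UltraProd.infinite hn
  exact not_finite_iff_infinite.2 this
    ((PathSystem.ultraGraph (U := Filter.hyperfilter ℕ) hG).finite hk)

end Ultraproduct

section Saturated

variable {V : Type*} {G : SimpleGraph V} {x y : V} {t : ℕ}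

lemma ListWalk.exists_walk {l : List V} (h : ListWalk G x l y) :
    ∃ w : G.Walk x y, w.support = x :: l := by
  induction l generalizing x with
  | nil => obtain rfl : x = y := h; exact ⟨.nil, rfl⟩
  | cons a l ih =>
    obtain ⟨w, hw⟩ := ih h.2
    exact ⟨.cons h.1 w, by simp [hw]⟩

lemma listPath_of_walk (w : G.Walk x y) (hw : w.IsPath) :
    ListPath G x w.support.tail y ∧ w.support.tail.length = w.length := by
  refine ⟨⟨?_, by rw [w.cons_tail_support]; exact hw.support_nodup⟩, by simp⟩
  clear hw
  induction w with
  | nil => rfl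
  | cons h w ih =>
    rw [Walk.support_cons, List.tail_cons, ← w.cons_tail_support]
    exact ⟨h, ih⟩

lemma isPath_eq_of_edges {p q : G.Walk x y} (hp : p.IsPath) (hq : q.IsPath)
    (h : ∀ e, e ∈ p.edges ↔ e ∈ q.edges) : p = q := by
  induction p with
  | nil => exact (Walk.isPath_iff_nil.1 hq).eq_nil.symm
  | @cons x a z hadj p ih =>
    cases q with
    | nil => simp at hp
    | @cons _ b _ hadj' q =>
      obtain rfl : a = b := by
        have := hq.eq_snd_of_mem_edges ((h s(x, a)).1 (by simp))
        simpa using this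
      rw [Walk.cons_isPath_iff] at hp hq
      have h1 : s(x, a) ∉ p.edges := fun h => hp.2 (p.fst_mem_support_of_mem_edges h)
      have h2 : s(x, a) ∉ q.edges := fun h => hq.2 (q.fst_mem_support_of_mem_edges h)
      rw [ih hp.1 hq.1 fun e => ?_]
      have := h e
      simp only [Walk.edges_cons, List.mem_cons] at this
      grind

lemma UniquelyCSat.listPath_unique (h : UniquelyCSat G t) (ht : 3 ≤ t) {p q : List V}
    (hp : ListPath G x p y) (hq : ListPath G x q y) (hpt : p.length + 1 = t)
    (hqt : q.length + 1 = t) : p = q := by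
  obtain ⟨v, hv⟩ := hp.1.exists_walk
  obtain ⟨w, hw⟩ := hq.1.exists_walk
  have hv' : v.IsPath := (Walk.isPath_def v).2 (hv ▸ hp.2)
  have hw' : w.IsPath := (Walk.isPath_def w).2 (hw ▸ hq.2)
  have hvl : v.length + 1 = t := by
    have := v.length_support
    simp [hv] at this
    omega
  have hwl : w.length + 1 = t := by
    have := w.length_support
    simp [hw] at this
    omega
  have hn : ¬ G.Adj y x := by
    intro hadj
    refine h.1 ⟨y, .cons hadj v, (Walk.cons_isCycle_iff v hadj).2 ⟨hv', fun he => ?_⟩, by simpa⟩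
    have := hv'.length_eq_one_of_mem_edges (Sym2.eq_swap ▸ he)
    omega
  have hxy : x ≠ y := hp.ne_of_pos (by omega)
  have hle : G ≤ G ⊔ fromEdgeSet {s(x, y)} := le_sup_left
  have hadj : (G ⊔ fromEdgeSet {s(x, y)}).Adj y x := by simp [hxy.symm]
  have hnot : ∀ w : G.Walk x y, s(y, x) ∉ (w.mapLe hle).edges := fun w he => by
    rw [Walk.edges_mapLe_eq_edges] at he
    exact hn (w.adj_of_mem_edges he)
  have hcyc : ∀ w : G.Walk x y, w.IsPath → w.length + 1 = t →
      IsCtEdgeSet (G ⊔ fromEdgeSet {s(x, y)}) t {e | e ∈ (Walk.cons hadj (w.mapLe hle)).edges} :=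
    fun w hw hwl => ⟨y, _, (Walk.cons_isCycle_iff _ _).2
      ⟨(Walk.isPath_mapLe hle).2 hw, hnot w⟩, by simpa using hwl, rfl⟩
  have heq := (h.2 x y hxy fun h => hn h.symm).unique (hcyc v hv' hvl) (hcyc w hw' hwl)
  have hvw : v = w := by
    refine isPath_eq_of_edges hv' hw' fun e => ?_
    have h1 := Set.ext_iff.1 heq e
    have h2 := hnot v
    have h3 := hnot w
    rw [Walk.edges_mapLe_eq_edges] at h2 h3
    simp only [Set.mem_ofPred_eq, Walk.edges_cons, List.mem_cons, Walk.edges_mapLe_eq_edges] at h1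
    grind
  subst hvw
  simpa [hv] using hw

lemma exists_path_of_isCycle {c : (G ⊔ fromEdgeSet {s(x, y)}).Walk x x} (hc : c.IsCycle)
    (hy : c.snd = y) : ∃ w : G.Walk y x, w.IsPath ∧ w.length + 1 = c.length := by
  cases c with
  | nil => simp at hc
  | cons h p =>
    rw [Walk.snd_cons] at hy
    subst hy
    rw [Walk.cons_isCycle_iff] at hc
    have hp : ∀ e ∈ p.edges, e ∈ G.edgeSet := by
      intro e he
      have h1 := p.edges_subset_edgeSet he
      simp only [edgeSet_sup, edgeSet_fromEdgeSet, Set.mem_union] at h1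
      rcases h1 with h1 | h1
      · exact h1
      · have h2 : e = s(x, _) := h1.1
        exact (hc.2 (h2 ▸ he)).elim
    exact ⟨p.transfer G hp, hc.1.transfer hp, by simp⟩

lemma UniquelyCSat.exists_listPath (h : UniquelyCSat G t) (hxy : x ≠ y) (hn : ¬ G.Adj x y) :
    ∃ p, ListPath G x p y ∧ p.length + 1 = t := by
  obtain ⟨_, v, w, hw, hwt, -⟩ := (h.2 x y hxy hn).exists
  have he : s(x, y) ∈ w.edges := by
    by_contra he
    have hG : ∀ e ∈ w.edges, e ∈ G.edgeSet := by
      intro e hew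
      have h1 := w.edges_subset_edgeSet hew
      simp only [edgeSet_sup, edgeSet_fromEdgeSet, Set.mem_union] at h1
      rcases h1 with h1 | h1
      · exact h1
      · have h2 : e = s(x, y) := h1.1
        exact (he (h2 ▸ hew)).elim
    exact h.1 ⟨v, w.transfer G hG, hw.transfer hG, by simpa⟩
  classical
  have hx := w.fst_mem_support_of_mem_edges he
  obtain ⟨c, hc, hct, hce⟩ : ∃ c : (G ⊔ fromEdgeSet {s(x, y)}).Walk x x,
      c.IsCycle ∧ c.length = t ∧ s(x, y) ∈ c.edges :=
    ⟨w.rotate x hx, hw.rotate hx, by simpa using hwt, (w.rotate_edges x hx).mem_iff.2 he⟩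
  obtain ⟨c, hc, hct, hcy⟩ : ∃ c : (G ⊔ fromEdgeSet {s(x, y)}).Walk x x,
      c.IsCycle ∧ c.length = t ∧ c.snd = y := by
    by_cases hs : c.snd = y
    · exact ⟨c, hc, hct, hs⟩
    refine ⟨c.reverse, hc.reverse, by simpa, ?_⟩
    rw [Walk.snd_reverse]
    cases c with
    | nil => simp at hc
    | cons hadj p =>
      rw [Walk.cons_isCycle_iff] at hc
      rw [Walk.edges_cons, List.mem_cons] at hce
      rcases hce with hce | hce
      · simp at hs hce
        grind
      · have := hc.1.eq_penultimate_of_mem_edges hce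
        rw [Walk.penultimate_cons_of_not_nil _ _ <|
          Walk.edges_eq_nil.not.mp (List.ne_nil_of_mem hce)]
        exact this.symm
  obtain ⟨w, hw, hwl⟩ := exists_path_of_isCycle hc hcy
  have := listPath_of_walk w hw
  exact ⟨_, this.1.reverse, by simp; omega⟩

lemma UniquelyCSat.pathSystem {k : ℕ} (h : UniquelyCSat G (k + 1)) (hk : 2 ≤ k) :
    PathSystem G k where
  unique hp hq hpk hqk := h.listPath_unique (by omega) hp hq (by omega) (by omega)
  exists_path hxy hn := by simpa using h.exists_listPath hxy hn

end Saturated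

/-- For `t ≥ 6`, there are only finitely many uniquely `C_t`-saturated graphs:
the number of vertices of any such graph is bounded, so there are only finitely many
of them up to isomorphism. -/
theorem stmt_14 (t : ℕ) (ht : 6 ≤ t) :
    ∃ n : ℕ, ∀ (V : Type) [Fintype V] (G : SimpleGraph V),
      UniquelyCSat G t → Fintype.card V ≤ n := by
  obtain ⟨k, rfl⟩ : ∃ k, t = k + 1 := ⟨t - 1, by omega⟩
  obtain ⟨n, hn⟩ := PathSystem.exists_card_le (k := k) (by omega)
  exact ⟨n, fun V _ G h => hn V G (h.pathSystem (by omega))⟩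
end
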